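/- arXiv:1603.01899 — 8 statements merged into one kernel-verified Lean document; each statement's English description precedes it below -/
import Mathlib

section
/- Let φ:(0,∞)→ℝ be twice continuously differentiable and A > 0. If φ''(a_A) + (3/a_A) φ'(a_A) > 0, where a_A = 2√A/3^{1/4}, then the equilateral configuration (a,b,c) = (a_A, a_A, a_A) is a local minimizer of E(a,b,c) = φ(a)+φ(b)+φ(c) on the constraint set {(a,b,c) ∈ (0,∞)³ : g(a,b,c) = A²}. -/
/-- Squared area of a triangle with sides `a`, `b`, `c` (Heron's formula). -/
noncomputable def heron (a b c : ℝ) : ℝ :=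
  ((a + b + c) / 2) * ((a + b + c) / 2 - a) * ((a + b + c) / 2 - b) * ((a + b + c) / 2 - c)

lemma aux_taylor (φ : ℝ → ℝ) (hφ : ContDiffOn ℝ 2 φ (Set.Ioi 0)) (r : ℝ) (hr : 0 < r)
    (η : ℝ) (hη : 0 < η) :
    ∀ᶠ t in nhds r, |φ t - (φ r + deriv φ r * (t - r) + deriv (deriv φ) r / 2 * (t - r) ^ 2)|
      ≤ η * (t - r) ^ 2 := by
  have h := taylor_isLittleO (n := 2) (convex_Ioi (0:ℝ)) (Set.mem_Ioi.2 hr) hφ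
  rw [isOpen_Ioi.nhdsWithin_eq (Set.mem_Ioi.2 hr)] at h
  have h2 := h.def hη
  filter_upwards [h2] with t ht
  have e1 : iteratedDerivWithin 1 φ (Set.Ioi 0) r = deriv φ r := by
    rw [iteratedDerivWithin_of_isOpen isOpen_Ioi (Set.mem_Ioi.2 hr), iteratedDeriv_one]
  have e2 : iteratedDerivWithin 2 φ (Set.Ioi 0) r = deriv (deriv φ) r := by
    rw [iteratedDerivWithin_of_isOpen isOpen_Ioi (Set.mem_Ioi.2 hr), iteratedDeriv_succ,
      iteratedDeriv_one]
  rw [taylorWithinEval_succ, taylorWithinEval_succ, taylor_within_zero_eval] at ht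
  norm_num [e1, e2] at ht
  refine le_trans (le_of_eq ?_) ht
  congr 1
  ring

lemma aux_alg (r η x y z p q κ e : ℝ) (hr : 0 < r) (hη : 0 < η) (hη2 : η ≤ 2 * r ^ 3)
    (hκ : κ = q + 3 / r * p)
    (hsmall : η * (1 + |p| * (2 + 3 / r) / (4 * r ^ 3)) ≤ κ / 2)
    (hM : |4 * r ^ 2 * (x + y + z) + 4 * r * (x + y + z) ^ 2 + (x + y + z) ^ 3
      - 8 * r * (x ^ 2 + y ^ 2 + z ^ 2) - 2 * (x + y + z) * (x ^ 2 + y ^ 2 + z ^ 2)| < η)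
    (hT : |x * (24 * r + 8 * (x + y + z))| < η)
    (hG : heron (r + x) (r + y) (r + z) = 3 * r ^ 4 / 16)
    (he : |e - (p * (x + y + z) + q / 2 * (x ^ 2 + y ^ 2 + z ^ 2))|
      ≤ η * (x ^ 2 + y ^ 2 + z ^ 2)) : 0 ≤ e := by
  unfold heron at hG
  set S := x + y + z with hS
  set Q := x ^ 2 + y ^ 2 + z ^ 2 with hQ
  have hQ0 : 0 ≤ Q := by positivity
  set m := 4 * r ^ 2 * S + 4 * r * S ^ 2 + S ^ 3 - 8 * r * Q - 2 * S * Q with hm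
  set w := x * (24 * r + 8 * S) with hw
  have key : S * (4 * r ^ 3 + m) = 6 * r ^ 2 * Q + w * (y * z) := by
    rw [hm, hw, hS, hQ]
    linear_combination 16 * hG
  have hyz : |y * z| ≤ Q := by
    rw [abs_le]; constructor <;> nlinarith [sq_nonneg (y + z), sq_nonneg (y - z), sq_nonneg x]
  have hwyz : |w * (y * z)| ≤ η * Q := by
    rw [abs_mul]; gcongr
  have hM2 : 2 * r ^ 3 ≤ 4 * r ^ 3 + m := by linarith [(abs_lt.1 hM).1]
  have r3 : 0 < r ^ 3 := by positivity
  have hSb : |S| * (2 * r ^ 3) ≤ (6 * r ^ 2 + 2 * r ^ 3) * Q := by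
    calc |S| * (2 * r ^ 3) ≤ |S| * (4 * r ^ 3 + m) := by gcongr
      _ = |6 * r ^ 2 * Q + w * (y * z)| := by
        rw [← key, abs_mul, abs_of_pos (by linarith : 0 < 4 * r ^ 3 + m)]
      _ ≤ |6 * r ^ 2 * Q| + |w * (y * z)| := abs_add_le _ _
      _ ≤ 6 * r ^ 2 * Q + η * Q := by
        rw [abs_of_nonneg (by positivity : 0 ≤ 6 * r ^ 2 * Q)]; gcongr
      _ ≤ _ := by nlinarith
  have hSb' : |S| ≤ (1 + 3 / r) * Q := by
    have : (6 * r ^ 2 + 2 * r ^ 3) * Q = (1 + 3 / r) * Q * (2 * r ^ 3) := by field_simp; ring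
    rw [this] at hSb
    exact le_of_mul_le_mul_right hSb (by positivity)
  have hD : |S - 3 / (2 * r) * Q| ≤ η * ((2 + 3 / r) / (4 * r ^ 3)) * Q := by
    have e1 : S - 3 / (2 * r) * Q = (w * (y * z) - S * m) / (4 * r ^ 3) := by
      field_simp
      linear_combination 2 * key
    rw [e1, abs_div, abs_of_pos (by positivity : 0 < 4 * r ^ 3), div_le_iff₀ (by positivity)]
    calc |w * (y * z) - S * m| ≤ |w * (y * z)| + |S * m| := abs_sub _ _
      _ ≤ η * Q + (1 + 3 / r) * Q * η := by
        rw [abs_mul S]; gcongr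
      _ = _ := by field_simp; ring
  have hpD : |p * (S - 3 / (2 * r) * Q)| ≤ |p| * (η * ((2 + 3 / r) / (4 * r ^ 3)) * Q) := by
    rw [abs_mul]; gcongr
  have h1 := (abs_le.1 he).1
  have h2 := (abs_le.1 hpD).1
  have h3 := mul_le_mul_of_nonneg_right hsmall hQ0
  have h4 : p * S + q / 2 * Q = p * (S - 3 / (2 * r) * Q) + κ / 2 * Q := by
    rw [hκ]; field_simp; ring
  have h5 : η * (1 + |p| * (2 + 3 / r) / (4 * r ^ 3)) * Q
      = η * Q + |p| * (η * ((2 + 3 / r) / (4 * r ^ 3)) * Q) := by ring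
  linarith

/-- If `φ''(a_A) + (3/a_A) φ'(a_A) > 0`, then the equilateral configuration
`(a_A, a_A, a_A)` is a local minimizer of `E(a,b,c) = φ(a) + φ(b) + φ(c)` on the
constraint set `{(a,b,c) ∈ (0,∞)³ : g(a,b,c) = A²}`. -/
theorem stmt_2 (φ : ℝ → ℝ) (hφ : ContDiffOn ℝ 2 φ (Set.Ioi 0))
    (A : ℝ) (hA : 0 < A)
    (aA : ℝ) (haA : aA = 2 * Real.sqrt A / (3 : ℝ) ^ ((1 : ℝ) / 4))
    (hstab : 0 < deriv (deriv φ) aA + 3 / aA * deriv φ aA) :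
    IsLocalMinOn (fun p : ℝ × ℝ × ℝ => φ p.1 + φ p.2.1 + φ p.2.2)
      {p : ℝ × ℝ × ℝ | 0 < p.1 ∧ 0 < p.2.1 ∧ 0 < p.2.2 ∧ heron p.1 p.2.1 p.2.2 = A ^ 2}
      (aA, aA, aA) := by
  have hr : 0 < aA := by rw [haA]; positivity
  have hA2 : A ^ 2 = 3 * aA ^ 4 / 16 := by
    have h3 : ((3 : ℝ) ^ ((1 : ℝ) / 4)) ^ 4 = 3 := by
      rw [← Real.rpow_natCast, ← Real.rpow_mul (by norm_num)]; norm_num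
    have hs : (Real.sqrt A) ^ 4 = A ^ 2 := by
      rw [show (Real.sqrt A) ^ 4 = ((Real.sqrt A) ^ 2) ^ 2 by ring, Real.sq_sqrt hA.le]
    rw [haA, div_pow, mul_pow, h3, hs]; ring
  clear haA
  generalize aA = r at *
  set p := deriv φ r with hp
  set q := deriv (deriv φ) r with hq
  set C := 1 + |p| * (2 + 3 / r) / (4 * r ^ 3) with hC
  have hC0 : 0 < C := by positivity
  set η := min (2 * r ^ 3) ((q + 3 / r * p) / 2 / C) with hη
  have hη0 : 0 < η := lt_min (by positivity) (by positivity)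
  have hsmall : η * C ≤ (q + 3 / r * p) / 2 := by
    rw [← le_div_iff₀ hC0]; exact min_le_right _ _
  have hT := aux_taylor φ hφ r hr η hη0
  have c1 : Filter.Tendsto (fun v : ℝ × ℝ × ℝ => v.1) (nhds (r, r, r)) (nhds r) :=
    (continuous_fst.tendsto (r, r, r))
  have c2 : Filter.Tendsto (fun v : ℝ × ℝ × ℝ => v.2.1) (nhds (r, r, r)) (nhds r) :=
    ((continuous_fst.comp continuous_snd).tendsto (r, r, r))
  have c3 : Filter.Tendsto (fun v : ℝ × ℝ × ℝ => v.2.2) (nhds (r, r, r)) (nhds r) :=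
    ((continuous_snd.comp continuous_snd).tendsto (r, r, r))
  have n1 : ∀ᶠ v : ℝ × ℝ × ℝ in nhds (r, r, r),
      (fun v : ℝ × ℝ × ℝ => (fun x y z : ℝ => |4 * r ^ 2 * (x + y + z) + 4 * r * (x + y + z) ^ 2
      + (x + y + z) ^ 3 - 8 * r * (x ^ 2 + y ^ 2 + z ^ 2)
      - 2 * (x + y + z) * (x ^ 2 + y ^ 2 + z ^ 2)|) (v.1 - r) (v.2.1 - r) (v.2.2 - r)) v < η := by
    refine (Continuous.tendsto ?_ _).eventually_lt_const ?_
    · fun_prop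
    · simpa using hη0
  have n2 : ∀ᶠ v : ℝ × ℝ × ℝ in nhds (r, r, r),
      (fun v : ℝ × ℝ × ℝ => (fun x y z : ℝ => |x * (24 * r + 8 * (x + y + z))|)
        (v.1 - r) (v.2.1 - r) (v.2.2 - r)) v < η := by
    refine (Continuous.tendsto ?_ _).eventually_lt_const ?_
    · fun_prop
    · simpa using hη0
  unfold IsLocalMinOn IsMinFilter
  rw [eventually_nhdsWithin_iff]
  filter_upwards [c1.eventually hT, c2.eventually hT, c3.eventually hT, n1, n2] with
    v t1 t2 t3 m1 m2 hv
  obtain ⟨-, -, -, hG⟩ := hv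
  have := aux_alg r η (v.1 - r) (v.2.1 - r) (v.2.2 - r) p q (q + 3 / r * p)
    (φ v.1 + φ v.2.1 + φ v.2.2 - (φ r + φ r + φ r)) hr hη0 (min_le_left _ _) rfl hsmall m1 m2
    (by rw [← hA2, ← hG]; congr 1 <;> ring)
    (by
      rw [abs_le] at *
      constructor <;> linarith [t1.1, t1.2, t2.1, t2.2, t3.1, t3.2])
  change φ r + φ r + φ r ≤ φ v.1 + φ v.2.1 + φ v.2.2
  linarith
end

section
/- Let φ(r) = c₁/r^{δ₁} − c₂/r^{δ₂} with c₁, c₂ > 0 and δ₁ > δ₂ > 2 (a generalized Lennard–Jones potential). For A > 0 let a_A = 2√A/3^{1/4}. Then the stability condition φ''(a_A) + (3/a_A) φ'(a_A) > 0 holds if and only if A < A₀, where A₀ = (√3/4) · [c₁δ₁(δ₁−2)/(c₂δ₂(δ₂−2))]^{2/(δ₁−δ₂)}. -/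
theorem lj_deriv (c₁ c₂ p q r : ℝ) (hr : 0 < r) :
    deriv (fun r : ℝ => c₁ * r ^ p - c₂ * r ^ q) r
      = (c₁ * p) * r ^ (p - 1) - (c₂ * q) * r ^ (q - 1) := by
  have h1 := (Real.hasDerivAt_rpow_const (x := r) (p := p) (Or.inl hr.ne')).const_mul c₁
  have h2 := (Real.hasDerivAt_rpow_const (x := r) (p := q) (Or.inl hr.ne')).const_mul c₂
  refine (h1.sub h2).deriv.trans ?_
  ring

/-- For the generalized Lennard–Jones potential `φ(r) = c₁/r^δ₁ - c₂/r^δ₂` with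
`c₁, c₂ > 0` and `δ₁ > δ₂ > 2`, the stability condition
`φ''(a_A) + (3/a_A) φ'(a_A) > 0` at `a_A = 2√A/3^(1/4)` holds iff `A < A₀`,
where `A₀ = (√3/4)·[c₁δ₁(δ₁-2)/(c₂δ₂(δ₂-2))]^(2/(δ₁-δ₂))`. -/
theorem stmt_3 (c₁ c₂ δ₁ δ₂ : ℝ) (hc₁ : 0 < c₁) (hc₂ : 0 < c₂)
    (hδ : δ₂ < δ₁) (hδ₂ : 2 < δ₂)
    (φ : ℝ → ℝ) (hφ : φ = fun r : ℝ => c₁ / r ^ δ₁ - c₂ / r ^ δ₂)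
    (A : ℝ) (hA : 0 < A)
    (aA : ℝ) (haA : aA = 2 * Real.sqrt A / (3 : ℝ) ^ ((1 : ℝ) / 4))
    (A₀ : ℝ) (hA₀ : A₀ = Real.sqrt 3 / 4 *
      (c₁ * δ₁ * (δ₁ - 2) / (c₂ * δ₂ * (δ₂ - 2))) ^ (2 / (δ₁ - δ₂))) :
    0 < deriv (deriv φ) aA + 3 / aA * deriv φ aA ↔ A < A₀ := by
  have ha : 0 < aA := by rw [haA]; positivity
  have e0 : ∀ r : ℝ, 0 < r → φ =ᶠ[nhds r] fun r : ℝ => c₁ * r ^ (-δ₁) - c₂ * r ^ (-δ₂) := by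
    intro r hr
    filter_upwards [lt_mem_nhds hr] with x hx
    rw [hφ, Real.rpow_neg hx.le, Real.rpow_neg hx.le]
    simp only [div_eq_mul_inv]
  have e1 : ∀ r : ℝ, 0 < r → deriv φ r
      = (c₁ * -δ₁) * r ^ (-δ₁ - 1) - (c₂ * -δ₂) * r ^ (-δ₂ - 1) := by
    intro r hr
    rw [(e0 r hr).deriv_eq, lj_deriv _ _ _ _ _ hr]
  have e2 : deriv (deriv φ) aA = (c₁ * -δ₁ * (-δ₁ - 1)) * aA ^ (-δ₁ - 1 - 1)
      - (c₂ * -δ₂ * (-δ₂ - 1)) * aA ^ (-δ₂ - 1 - 1) := by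
    have : deriv φ =ᶠ[nhds aA] fun r : ℝ =>
        (c₁ * -δ₁) * r ^ (-δ₁ - 1) - (c₂ * -δ₂) * r ^ (-δ₂ - 1) := by
      filter_upwards [lt_mem_nhds ha] with x hx using e1 x hx
    rw [this.deriv_eq, lj_deriv _ _ _ _ _ ha]
  have hP : 0 < c₁ * δ₁ * (δ₁ - 2) := by
    have h1 : 0 < δ₁ := by linarith
    have h2 : 0 < δ₁ - 2 := by linarith
    positivity
  have hQ : 0 < c₂ * δ₂ * (δ₂ - 2) := by
    have h1 : 0 < δ₂ := by linarith
    have h2 : 0 < δ₂ - 2 := by linarith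
    positivity
  have hd : 0 < δ₁ - δ₂ := by linarith
  have key : deriv (deriv φ) aA + 3 / aA * deriv φ aA
      = aA ^ (-δ₁ - 1 - 1) * (c₁ * δ₁ * (δ₁ - 2) - c₂ * δ₂ * (δ₂ - 2) * aA ^ (δ₁ - δ₂)) := by
    have h3 : aA ^ (-δ₂ - 1 - 1) = aA ^ (-δ₁ - 1 - 1) * aA ^ (δ₁ - δ₂) := by
      rw [← Real.rpow_add ha]; congr 1; ring
    rw [e2, e1 aA ha]
    have h4 : aA ^ (-δ₁ - 1) = aA ^ (-δ₁ - 1 - 1) * aA := by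
      rw [Real.rpow_sub_one ha.ne' (-δ₁ - 1)]; field_simp
    have h5 : aA ^ (-δ₂ - 1) = aA ^ (-δ₁ - 1 - 1) * aA ^ (δ₁ - δ₂) * aA := by
      rw [← h3, Real.rpow_sub_one ha.ne' (-δ₂ - 1)]; field_simp
    rw [h3, h4, h5]
    field_simp
    ring
  have hsq : aA ^ 2 = 4 * A / Real.sqrt 3 := by
    have h6 : ((3 : ℝ) ^ ((1 : ℝ) / 4)) ^ 2 = Real.sqrt 3 := by
      rw [Real.sqrt_eq_rpow, ← Real.rpow_natCast, ← Real.rpow_mul (by norm_num)]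
      norm_num
    rw [haA, div_pow, h6, mul_pow, Real.sq_sqrt hA.le]
    norm_num
  have hpow : aA ^ 2 = (aA ^ (δ₁ - δ₂)) ^ (2 / (δ₁ - δ₂)) := by
    rw [← Real.rpow_mul ha.le, mul_div_cancel₀ _ hd.ne', Real.rpow_two]
  have h3 : 0 < Real.sqrt 3 := by positivity
  have hAeq : A = Real.sqrt 3 / 4 * (aA ^ (δ₁ - δ₂)) ^ (2 / (δ₁ - δ₂)) := by
    rw [← hpow, hsq]; field_simp
  rw [key, mul_pos_iff_of_pos_left (Real.rpow_pos_of_pos ha _), sub_pos, hA₀]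
  conv_rhs => lhs; rw [hAeq]
  rw [mul_lt_mul_iff_right₀ (by positivity),
    Real.rpow_lt_rpow_iff (Real.rpow_nonneg ha.le _) (div_pos hP hQ).le (by positivity),
    lt_div_iff₀ hQ, mul_comm]
end

section
/- Let φ(r) = α e^{−βr} − γ/r^η be a Buckingham potential with α, β, γ > 0 and η > 2, and define F(r) = αβ(βr − 3)e^{−βr} and G(r) = γη(η−2)/r^{η+1} for r > 0. Then (i) for every r > 0, φ''(r) + (3/r)φ'(r) > 0 if and only if F(r) > G(r); (ii) F attains its maximum over (0,∞) at r_m = 4/β; and (iii) if αβ e^{−4} > γη(η−2)(β/4)^{η+1}, then F(r_m) > G(r_m), so there exists r > 0 with φ''(r) + (3/r)φ'(r) > 0. -/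
/-- For the Buckingham potential `φ(r) = α e^{-βr} - γ/r^η` with `α, β, γ > 0`
and `η > 2`, setting `F(r) = αβ(βr - 3)e^{-βr}` and `G(r) = γη(η-2)/r^{η+1}`:
(i) for `r > 0` the stability condition `φ''(r) + (3/r)φ'(r) > 0` holds iff
`F(r) > G(r)`; (ii) `F` attains its maximum on `(0,∞)` at `r_m = 4/β`;
(iii) if `αβe^{-4} > γη(η-2)(β/4)^{η+1}` then `F(r_m) > G(r_m)` and hence the
stability condition holds for some `r > 0`. -/
theorem stmt_4 (α β γ η : ℝ) (hα : 0 < α) (hβ : 0 < β) (hγ : 0 < γ) (hη : 2 < η)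
    (φ F G : ℝ → ℝ)
    (hφ : φ = fun r : ℝ => α * Real.exp (-β * r) - γ / r ^ η)
    (hF : F = fun r : ℝ => α * β * (β * r - 3) * Real.exp (-β * r))
    (hG : G = fun r : ℝ => γ * η * (η - 2) / r ^ (η + 1)) :
    (∀ r : ℝ, 0 < r → (0 < deriv (deriv φ) r + 3 / r * deriv φ r ↔ G r < F r)) ∧
    IsMaxOn F (Set.Ioi 0) (4 / β) ∧
    (γ * η * (η - 2) * (β / 4) ^ (η + 1) < α * β * Real.exp (-4) →
      G (4 / β) < F (4 / β) ∧
        ∃ r : ℝ, 0 < r ∧ 0 < deriv (deriv φ) r + 3 / r * deriv φ r) := by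
  have key : ∀ r : ℝ, 0 < r →
      deriv (deriv φ) r + 3 / r * deriv φ r = (F r - G r) / r := by
    have hexp : ∀ r : ℝ, HasDerivAt (fun x : ℝ => Real.exp (-β * x)) (Real.exp (-β * r) * (-β)) r := by
      intro r
      have h := ((hasDerivAt_id r).const_mul (-β)).exp
      simpa using h
    have h1 : ∀ r : ℝ, 0 < r →
        deriv φ r = α * (Real.exp (-β * r) * (-β)) + γ * η * r ^ (-η - 1) := by
      intro r hr
      have hd := ((hexp r).const_mul α).sub
        ((Real.hasDerivAt_rpow_const (x := r) (p := -η) (Or.inl hr.ne')).const_mul γ)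
      have he : φ =ᶠ[nhds r]
          ((fun x : ℝ => α * Real.exp (-β * x)) - (fun x : ℝ => γ * x ^ (-η))) := by
        filter_upwards [lt_mem_nhds hr] with x hx
        simp only [hφ, Pi.sub_apply]
        rw [Real.rpow_neg hx.le, div_eq_mul_inv]
      rw [(hd.congr_of_eventuallyEq he).deriv]
      ring
    intro r hr
    have hd := (((hexp r).mul_const (-β)).const_mul α).add
        ((Real.hasDerivAt_rpow_const (x := r) (p := -η - 1) (Or.inl hr.ne')).const_mul (γ * η))
    have he : deriv φ =ᶠ[nhds r]
        ((fun x : ℝ => α * (Real.exp (-β * x) * (-β))) + (fun x : ℝ => γ * η * x ^ (-η - 1))) := by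
      filter_upwards [lt_mem_nhds hr] with x hx
      rw [h1 x hx]
      rfl
    rw [(hd.congr_of_eventuallyEq he).deriv, h1 r hr]
    have e1 : r ^ (-η - 1) = (r ^ (η + 1))⁻¹ := by
      rw [← Real.rpow_neg hr.le]
      congr 1
      ring
    have e2 : r ^ (-η - 1 - 1) = (r ^ (η + 1))⁻¹ / r := by
      rw [Real.rpow_sub_one hr.ne', e1]
    rw [e1, e2]
    simp only [hF, hG]
    have hp : 0 < r ^ (η + 1) := Real.rpow_pos_of_pos hr _
    generalize r ^ (η + 1) = p at *
    generalize Real.exp (-β * r) = E at *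
    field_simp
    ring
  have hi : ∀ r : ℝ, 0 < r → (0 < deriv (deriv φ) r + 3 / r * deriv φ r ↔ G r < F r) := by
    intro r hr
    rw [key r hr, div_pos_iff_of_pos_right hr, sub_pos]
  have hFm : F (4 / β) = α * β * Real.exp (-4) := by
    have h4 : β * (4 / β) = 4 := by field_simp
    simp only [hF, neg_mul, h4]
    ring
  refine ⟨hi, ?_, ?_⟩
  · intro r _
    change F r ≤ F (4 / β)
    rw [hFm]
    simp only [hF]
    have h := Real.add_one_le_exp (β * r - 4)
    have h2 : Real.exp (-4) = Real.exp (β * r - 4) * Real.exp (-β * r) := by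
      rw [← Real.exp_add]
      congr 1
      ring
    rw [h2, mul_assoc]
    gcongr
    linarith
  · intro h
    have hGF : G (4 / β) < F (4 / β) := by
      rw [hFm]
      simp only [hG]
      rw [div_eq_mul_inv, ← Real.inv_rpow (by positivity), inv_div]
      exact h
    exact ⟨hGF, 4 / β, by positivity, (hi _ (by positivity)).2 hGF⟩
end

section
/- Let φ:(0,∞)→ℝ be C², define μ(A) = φ''(a_A) + (3/a_A)φ'(a_A) with a_A = 2√A/3^{1/4}, and suppose μ(A₀) = 0 and μ'(A₀) ≠ 0 for some A₀ > 0. Then (A₀, λ_{A₀}, a_{A₀}, a_{A₀}, a_{A₀}) is a bifurcation point of isosceles solutions: for every ε > 0 there exist A > 0 and a solution (λ, a, b, c) of the first-order conditions g(a,b,c)=A², ∇E(a,b,c)+λ∇g(a,b,c)=0 with b = c, a ≠ b, and |A − A₀| + |λ − λ_{A₀}| + |a − a_{A₀}| + |b − a_{A₀}| < ε; moreover the corresponding solutions of type a = c, b ≠ a and of type a = b, c ≠ a also exist in every such neighborhood. -/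
/-- First-order (Lagrange) conditions for the three-particle problem:
`g(a,b,c) = A²` and `∇E(a,b,c) + λ ∇g(a,b,c) = 0`, written componentwise. -/
noncomputable def triFOC (φ : ℝ → ℝ) (A lam a b c : ℝ) : Prop :=
  heron a b c = A ^ 2 ∧
  deriv φ a + lam / 4 * (a * (b ^ 2 + c ^ 2 - a ^ 2)) = 0 ∧
  deriv φ b + lam / 4 * (b * (a ^ 2 + c ^ 2 - b ^ 2)) = 0 ∧
  deriv φ c + lam / 4 * (c * (a ^ 2 + b ^ 2 - c ^ 2)) = 0

/-- A function with a simple zero takes both signs arbitrarily near it. -/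
lemma both_signs (m : ℝ → ℝ) (x : ℝ) (h0 : m x = 0) (h1 : deriv m x ≠ 0) (U : Set ℝ)
    (hU : U ∈ nhds x) : ∃ y ∈ U, ∃ z ∈ U, m y < 0 ∧ 0 < m z := by
  have key : ∀ n : ℝ → ℝ, n x = 0 → 0 < deriv n x → ∃ y ∈ U, ∃ z ∈ U, n y < 0 ∧ 0 < n z := by
    intro n hn hd
    have hs := (eventually_nhdsWithin_sign_eq_of_deriv_pos hd hn).and hU
    obtain ⟨δ, hδ, hb⟩ := Metric.eventually_nhds_iff.1 hs
    have hy := hb (y := x - δ / 2) (by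
      rw [Real.dist_eq, abs_lt]; constructor <;> linarith)
    have hz := hb (y := x + δ / 2) (by
      rw [Real.dist_eq, abs_lt]; constructor <;> linarith)
    refine ⟨_, hy.2, _, hz.2, ?_, ?_⟩
    · rw [← sign_eq_neg_one_iff, hy.1, sign_eq_neg_one_iff]; linarith
    · rw [← sign_eq_one_iff, hz.1, sign_eq_one_iff]; linarith
  rcases lt_or_gt_of_ne h1 with h | h
  · obtain ⟨y, hy, z, hz, h2, h3⟩ := key (fun t => -m t) (by simp [h0]) (by
      rw [deriv.fun_neg]; linarith)
    exact ⟨z, hz, y, hy, by linarith, by linarith⟩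
  · exact key m h0 h

/-- Just to the right of a simple zero, the function has the sign of its derivative. -/
lemma right_pos (n : ℝ → ℝ) (x d : ℝ) (h0 : n x = 0) (hd : HasDerivAt n d x) (h : 0 < d) :
    ∀ᶠ t in nhdsWithin (0 : ℝ) (Set.Ioi 0), 0 < n (x + t) := by
  have hs := eventually_nhdsWithin_sign_eq_of_deriv_pos (by rw [hd.deriv]; exact h) h0
  have hc : Filter.Tendsto (fun t : ℝ => x + t) (nhdsWithin (0 : ℝ) (Set.Ioi 0)) (nhds x) := by
    have : Filter.Tendsto (fun t : ℝ => x + t) (nhds 0) (nhds (x + 0)) := by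
      exact (continuous_const.add continuous_id).tendsto 0
    rw [add_zero] at this
    exact this.mono_left nhdsWithin_le_nhds
  filter_upwards [hc.eventually hs, self_mem_nhdsWithin] with t ht ht0
  rw [← sign_eq_one_iff, ht, sign_eq_one_iff]
  have : (0 : ℝ) < t := ht0
  linarith

/-- Abstract existence of isosceles solutions: only first derivative values matter. -/
lemma exists_pair (φ : ℝ → ℝ) (hφ : ContDiffOn ℝ 2 φ (Set.Ioi 0)) (b₁ b₂ l r : ℝ) (hl : 0 < l)
    (h1 : b₁ ∈ Set.Ioo l r) (h2 : b₂ ∈ Set.Ioo l r)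
    (m1 : deriv (deriv φ) b₁ + 3 / b₁ * deriv φ b₁ < 0)
    (m2 : 0 < deriv (deriv φ) b₂ + 3 / b₂ * deriv φ b₂) :
    ∃ a ∈ Set.Ioo l r, ∃ b ∈ Set.Ioo l r, a ≠ b ∧
      a * b * deriv φ a - (2 * b ^ 2 - a ^ 2) * deriv φ b = 0 := by
  have hf : ContDiffOn ℝ 1 (deriv φ) (Set.Ioi 0) :=
    ((contDiffOn_succ_iff_deriv_of_isOpen (n := 1) isOpen_Ioi).1 (by rw [one_add_one_eq_two]; exact hφ)).2.2
  have hfd : ∀ x, 0 < x → HasDerivAt (deriv φ) (deriv (deriv φ) x) x := fun x hx =>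
    ((hf.differentiableOn (by norm_num)).differentiableAt (Ioi_mem_nhds hx)).hasDerivAt
  have hfc : ContinuousOn (deriv φ) (Set.Ioi 0) := hf.continuousOn
  have hd : ∀ b, 0 < b → HasDerivAt
      (fun a => a * b * deriv φ a - (2 * b ^ 2 - a ^ 2) * deriv φ b)
      (b ^ 2 * (deriv (deriv φ) b + 3 / b * deriv φ b)) b := by
    intro b hb
    have e1 := ((((hasDerivAt_id b).mul_const b).mul (hfd b hb))).sub
      ((((hasDerivAt_id b).pow 2).const_sub (2 * b ^ 2)).mul_const (deriv φ b))
    refine (e1.congr_deriv ?_)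
    simp
    field_simp
    ring
  have p1 : 0 < b₁ := hl.trans h1.1
  have p2 : 0 < b₂ := hl.trans h2.1
  have s1 := right_pos _ _ _ (by simp only [Pi.neg_apply]; ring) (hd b₁ p1).neg (by
    have := mul_neg_of_pos_of_neg (pow_pos p1 2) m1
    linarith)
  have s2 := right_pos _ _ _ (by ring) (hd b₂ p2) (mul_pos (pow_pos p2 2) m2)
  have hr : 0 < r - max b₁ b₂ := sub_pos.2 (max_lt h1.2 h2.2)
  have s3 : ∀ᶠ t in nhdsWithin (0 : ℝ) (Set.Ioi 0), t < r - max b₁ b₂ :=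
    Filter.Eventually.filter_mono nhdsWithin_le_nhds (Iio_mem_nhds hr)
  obtain ⟨t, ⟨⟨t1, t2⟩, t3⟩, t0⟩ := ((s1.and s2).and s3 |>.and self_mem_nhdsWithin).exists
  have t0 : 0 < t := t0
  have pos : ∀ b ∈ Set.uIcc b₁ b₂, 0 < b := fun b hb =>
    lt_of_lt_of_le (lt_min p1 p2) hb.1
  have hc : ContinuousOn (fun b => (b + t) * b * deriv φ (b + t)
      - (2 * b ^ 2 - (b + t) ^ 2) * deriv φ b) (Set.uIcc b₁ b₂) := by
    have c1 : ContinuousOn (fun b => deriv φ (b + t)) (Set.uIcc b₁ b₂) :=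
      hfc.comp (by fun_prop) (fun b hb => by
        have := pos b hb
        simp only [Set.mem_Ioi]; linarith)
    have c2 : ContinuousOn (fun b => deriv φ b) (Set.uIcc b₁ b₂) := hfc.mono pos
    fun_prop
  obtain ⟨b, hb, hb0⟩ := intermediate_value_uIcc hc (show (0 : ℝ) ∈ _ from by
    rw [Set.mem_uIcc]
    left
    constructor
    · simp only [Pi.neg_apply] at t1
      linarith
    · exact t2.le)
  have b1 : l < b := lt_of_lt_of_le (lt_min h1.1 h2.1) hb.1
  have b2 : b ≤ max b₁ b₂ := hb.2
  exact ⟨b + t, ⟨by linarith, by linarith⟩, b, ⟨b1, by linarith⟩, by linarith, hb0⟩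

/-- If `μ(A₀) = 0` and `μ'(A₀) ≠ 0`, where `μ(A) = φ''(a_A) + (3/a_A)φ'(a_A)`,
then `(A₀, λ_{A₀}, a_{A₀}, a_{A₀}, a_{A₀})` is a bifurcation point of isosceles
solutions of the first-order conditions: arbitrarily close to it there are
solutions with `b = c`, `a ≠ b`, and the corresponding solutions of types
`a = c`, `b ≠ a` and `a = b`, `c ≠ a` as well. -/
theorem stmt_9 (φ : ℝ → ℝ) (hφ : ContDiffOn ℝ 2 φ (Set.Ioi 0))
    (aOf μ : ℝ → ℝ)
    (haOf : ∀ A : ℝ, aOf A = 2 * Real.sqrt A / (3 : ℝ) ^ ((1 : ℝ) / 4))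
    (hμ : ∀ A : ℝ, μ A = deriv (deriv φ) (aOf A) + 3 / aOf A * deriv φ (aOf A))
    (A₀ : ℝ) (hA₀ : 0 < A₀) (hμ0 : μ A₀ = 0) (hμ1 : deriv μ A₀ ≠ 0)
    (a₀ lam₀ : ℝ) (ha₀ : a₀ = aOf A₀) (hlam₀ : lam₀ = -4 * deriv φ a₀ / a₀ ^ 3) :
    ∀ ε : ℝ, 0 < ε →
      (∃ A lam a b c : ℝ, 0 < A ∧ 0 < a ∧ 0 < b ∧ 0 < c ∧
        triFOC φ A lam a b c ∧ b = c ∧ a ≠ b ∧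
        |A - A₀| + |lam - lam₀| + |a - a₀| + |b - a₀| < ε) ∧
      (∃ A lam a b c : ℝ, 0 < A ∧ 0 < a ∧ 0 < b ∧ 0 < c ∧
        triFOC φ A lam a b c ∧ a = c ∧ b ≠ a ∧
        |A - A₀| + |lam - lam₀| + |b - a₀| + |a - a₀| < ε) ∧
      (∃ A lam a b c : ℝ, 0 < A ∧ 0 < a ∧ 0 < b ∧ 0 < c ∧
        triFOC φ A lam a b c ∧ a = b ∧ c ≠ a ∧
        |A - A₀| + |lam - lam₀| + |c - a₀| + |a - a₀| < ε) := by
  intro ε hε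
  have h3 : (0 : ℝ) < (3 : ℝ) ^ ((1 : ℝ) / 4) := by positivity
  have h34 : ((3 : ℝ) ^ ((1 : ℝ) / 4)) ^ 4 = 3 := by
    rw [← Real.rpow_natCast, ← Real.rpow_mul (by norm_num)]; norm_num
  have hpos : 0 < a₀ := by
    rw [ha₀, haOf]
    have := Real.sqrt_pos.2 hA₀
    positivity
  have ha4 : 3 * a₀ ^ 4 = 16 * A₀ ^ 2 := by
    rw [ha₀, haOf, div_pow, h34, mul_pow,
      show Real.sqrt A₀ ^ 4 = (Real.sqrt A₀ ^ 2) ^ 2 by ring, Real.sq_sqrt hA₀.le]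
    ring
  have hheq : heron a₀ a₀ a₀ = A₀ ^ 2 := by
    unfold heron; nlinarith [ha4]
  have hf : ContDiffOn ℝ 1 (deriv φ) (Set.Ioi 0) :=
    ((contDiffOn_succ_iff_deriv_of_isOpen (n := 1) isOpen_Ioi).1 (by rw [one_add_one_eq_two]; exact hφ)).2.2
  have hfc : ContinuousAt (deriv φ) a₀ := hf.continuousOn.continuousAt (Ioi_mem_nhds hpos)
  have c0 : ContinuousAt (fun p : ℝ × ℝ => heron p.1 p.2 p.2) (a₀, a₀) := by
    unfold heron; fun_prop
  have cl : ContinuousAt (fun p : ℝ × ℝ => -4 * deriv φ p.2 / (p.2 * p.1 ^ 2)) (a₀, a₀) := by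
    have c1 : ContinuousAt (fun p : ℝ × ℝ => deriv φ p.2) (a₀, a₀) :=
      ContinuousAt.comp (f := fun p : ℝ × ℝ => p.2) (g := deriv φ) hfc continuousAt_snd
    refine ContinuousAt.div (by fun_prop) (by fun_prop) ?_
    simp only
    positivity
  have cF : ContinuousAt (fun p : ℝ × ℝ => |Real.sqrt (heron p.1 p.2 p.2) - A₀|
      + |-4 * deriv φ p.2 / (p.2 * p.1 ^ 2) - lam₀| + |p.1 - a₀| + |p.2 - a₀|) (a₀, a₀) := by
    have := c0.sqrt
    fun_prop
  have e1 := Filter.Tendsto.eventually_lt_const (u := ε) (by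
    simp only [hheq, Real.sqrt_sq hA₀.le, hlam₀, sub_self, abs_zero]
    rw [show a₀ * a₀ ^ 2 = a₀ ^ 3 by ring]
    simpa using hε) cF.tendsto
  have e2 := Filter.Tendsto.eventually_const_lt (u := 0) (by
    simp only [hheq]; positivity) c0.tendsto
  obtain ⟨δ, hδ, hb⟩ := Metric.eventually_nhds_iff.1 (e1.and e2)
  set l := max (a₀ - δ) (a₀ / 2) with hl
  set r := a₀ + δ with hr
  have hl0 : 0 < l := lt_max_of_lt_right (by linarith)
  have hla : l < a₀ := max_lt (by linarith) (by linarith)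
  have hcont : ContinuousAt aOf A₀ := by
    rw [show aOf = fun A => 2 * Real.sqrt A / (3 : ℝ) ^ ((1 : ℝ) / 4) from funext haOf]
    fun_prop
  have hU : aOf ⁻¹' (Set.Ioo l r) ∈ nhds A₀ :=
    hcont (Ioo_mem_nhds (by rw [← ha₀]; exact hla) (by rw [← ha₀]; linarith))
  obtain ⟨y, hy, z, hz, my, mz⟩ := both_signs μ A₀ hμ0 hμ1 _ hU
  rw [hμ] at my mz
  obtain ⟨a, ha, b, hb', hab, hH⟩ := exists_pair φ hφ _ _ l r hl0 hy hz my mz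
  have pa : 0 < a := hl0.trans ha.1
  have pb : 0 < b := hl0.trans hb'.1
  have hd : dist (a, b) (a₀, a₀) < δ := by
    have hl1 : a₀ - δ ≤ l := le_max_left _ _
    rw [Prod.dist_eq, max_lt_iff, Real.dist_eq, Real.dist_eq, abs_lt, abs_lt]
    obtain ⟨u1, u2⟩ := ha
    obtain ⟨u3, u4⟩ := hb'
    refine ⟨⟨?_, ?_⟩, ?_, ?_⟩ <;> simp only <;> linarith
  obtain ⟨f1, f2⟩ := hb hd
  have hA : 0 < Real.sqrt (heron a b b) := Real.sqrt_pos.2 f2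
  have hs : Real.sqrt (heron a b b) ^ 2 = heron a b b := Real.sq_sqrt f2.le
  have q1 : deriv φ a + (-4 * deriv φ b / (b * a ^ 2)) / 4 * (a * (b ^ 2 + b ^ 2 - a ^ 2)) = 0 := by
    field_simp
    linarith
  have q2 : deriv φ b + (-4 * deriv φ b / (b * a ^ 2)) / 4 * (b * (a ^ 2 + b ^ 2 - b ^ 2)) = 0 := by
    field_simp
    ring
  have q2' : deriv φ b + (-4 * deriv φ b / (b * a ^ 2)) / 4 * (b * (b ^ 2 + a ^ 2 - b ^ 2)) = 0 := by
    rw [← q2]; ring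
  have w1 : heron b a b = heron a b b := by unfold heron; ring
  have w2 : heron b b a = heron a b b := by unfold heron; ring
  refine ⟨⟨_, _, a, b, b, hA, pa, pb, pb, ⟨hs.symm, q1, q2, q2⟩, rfl, hab, f1⟩,
    ⟨_, _, b, a, b, hA, pb, pa, pb, ⟨w1.trans hs.symm, q2, q1, q2'⟩, rfl, hab, f1⟩,
    ⟨_, _, b, b, a, hA, pb, pb, pa, ⟨w2.trans hs.symm, q2', q2', q1⟩, rfl, hab, f1⟩⟩
end

section
/- (Equivariant Bifurcation Theorem.) Let U ⊆ ℝⁿ be open, F : U × ℝ → ℝⁿ be C², and G a finite group of invertible n×n matrices with F(Px, A) = P F(x, A) for all P ∈ G. Let g : ℝ → U be smooth with F(g(A), A) = 0 for all A, and set L(A) = D_x F(g(A), A). Suppose for some A₀ there is a nonzero v ∈ ker L(A₀); let H = {P ∈ G : Pv = v} be its isotropy subgroup, ℝⁿ_H = {x : Px = x for all P ∈ H} the fixed-point space, P_H = (1/|H|)Σ_{P∈H} P the averaging projection onto ℝⁿ_H, F_H(u,A) = P_H F(u,A) on (U ∩ ℝⁿ_H) × ℝ, and L_H(A) = P_H L(A)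 P_H. Assume g(A) ∈ ℝⁿ_H for all A, that the kernel of L_H(A₀) restricted to ℝⁿ_H equals span{v}, and that L_H'(A₀)v does not lie in the range of L_H(A₀) restricted to ℝⁿ_H. Then there exists a connected set C_H of nontrivial solutions of F_H(u,A) = 0 (i.e., solutions with u ≠ g(A)) whose closure contains (g(A₀), A₀), and at least one of the following holds: (i) C_H is unbounded in ℝ^{n+1}; (ii) the closure of C_H intersects ∂U × ℝ; (iii) the closure of C_H contains a trivial point (g(A_*), A_*) with A_* ≠ A₀. -/
section
open Set Filter Topology MeasureTheory
section
variable {W : Type*} [NormedAddCommGroup W] [NormedSpace ℝ W] [FiniteDimensional ℝ W]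

lemma eb_det_fd (M : W →ₗ[ℝ] W) :
    ∑ k ∈ Finset.range (Module.finrank ℝ W + 1),
      (((-1 : ℤ) ^ (Module.finrank ℝ W - k) * (Module.finrank ℝ W).choose k : ℤ) : ℝ) *
        LinearMap.det ((1 : W →ₗ[ℝ] W) + (k : ℝ) • M)
      = (Module.finrank ℝ W).factorial * LinearMap.det M := by
  set N := Module.finrank ℝ W with hN
  let b := Module.finBasis ℝ W
  set A := LinearMap.toMatrix b b M with hA
  let P : Polynomial ℝ := Matrix.det ((Polynomial.X : Polynomial ℝ) • A.map Polynomial.C +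
    (1 : Matrix (Fin N) (Fin N) ℝ).map Polynomial.C)
  have hdeg : P.natDegree ≤ N := by
    have := Polynomial.natDegree_det_X_add_C_le A 1
    rw [Fintype.card_fin] at this
    exact this
  have hcoef : P.coeff N = LinearMap.det M := by
    have := Polynomial.coeff_det_X_add_C_card A 1
    rw [Fintype.card_fin] at this
    rw [this, hA, LinearMap.det_toMatrix]
  have heval : ∀ t : ℝ, P.eval t = LinearMap.det ((1 : W →ₗ[ℝ] W) + t • M) := by
    intro t
    rw [← LinearMap.det_toMatrix b, map_add, map_smul, ← hA, LinearMap.toMatrix_one]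
    change Polynomial.eval t (Matrix.det _) = _
    rw [← Polynomial.coe_evalRingHom, RingHom.map_det]
    congr 1
    ext i j
    simp [Matrix.one_apply, add_comm]
    split_ifs <;> simp [mul_comm]
  have hfd : ((fwdDiff (1:ℝ))^[N] (fun x : ℝ => P.eval x)) 0 = N.factorial * P.coeff N := by
    rcases hdeg.lt_or_eq with h | h
    · rw [Polynomial.fwdDiff_iter_eq_zero_of_degree_lt h, Polynomial.coeff_eq_zero_of_natDegree_lt h]
      simp
    · have := congr_fun (Polynomial.fwdDiff_iter_degree_eq_factorial P) 0
      rw [h] at this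
      rw [this, Polynomial.leadingCoeff, h]
      simp [mul_comm]
  rw [fwdDiff_iter_eq_sum_shift] at hfd
  rw [← hcoef, ← hfd]
  refine Finset.sum_congr rfl fun k _ => ?_
  rw [← heval, zsmul_eq_mul]
  simp

set_option maxHeartbeats 1000000 in
/-- a compactly supported C¹ map has Jacobian of integral zero; sign-definite version -/
lemma eb_det_zero [Nontrivial W] (X : W → W) (hX : ContDiff ℝ 1 X) (hc : HasCompactSupport X)
    (δ : ℝ) (hpos : ∀ z, 0 ≤ δ * (fderiv ℝ X z).det) (z : W) : δ * (fderiv ℝ X z).det = 0 := by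
  let _ : MeasurableSpace W := borel W
  have _ : BorelSpace W := ⟨rfl⟩
  let μ : Measure W := Measure.addHaar
  set N := Module.finrank ℝ W with hN
  have hNpos : 0 < N := Module.finrank_pos
  obtain ⟨K, hK⟩ := hX.lipschitzWith_of_hasCompactSupport hc one_ne_zero
  have hdX : ∀ z, ‖fderiv ℝ X z‖ ≤ K := fun z => norm_fderiv_le_of_lipschitz ℝ hK
  have hdc : Continuous (fderiv ℝ X) := hX.continuous_fderiv one_ne_zero
  have hdetc : Continuous (fun M : W →L[ℝ] W => M.det) := ContinuousLinearMap.continuous_det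
  have hJc : Continuous (fun z => (fderiv ℝ X z).det) := hdetc.comp hdc
  -- det positive near one
  obtain ⟨ε, hε, hdet⟩ : ∃ ε > 0, ∀ M : W →L[ℝ] W, ‖M‖ < ε → 0 < (1 + M).det := by
    have h1 : ∀ᶠ M : W →L[ℝ] W in 𝓝 0, 0 < (1 + M).det := by
      have : ContinuousAt (fun M : W →L[ℝ] W => (1 + M).det) 0 :=
        (hdetc.comp (continuous_const.add continuous_id)).continuousAt
      apply this.eventually (lt_mem_nhds _)
      simp [ContinuousLinearMap.det]
    obtain ⟨ε, hε, h⟩ := Metric.eventually_nhds_iff.1 h1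
    exact ⟨ε, hε, fun M hM => h (by simpa using hM)⟩
  obtain ⟨R, hR⟩ := hc.isBounded.subset_closedBall (0 : W)
  set B := Metric.closedBall (0 : W) R with hB
  have hBc : IsCompact B := isCompact_closedBall _ _
  -- key: for small τ
  have key : ∀ τ : ℝ, 0 ≤ τ → τ * K < ε → τ * K < 1 →
      ∫ z in B, ((1 : W →L[ℝ] W) + τ • fderiv ℝ X z).det ∂μ = μ.real B := by
    intro τ hτ h1 h2
    set f : W → W := fun z => z + τ • X z with hf
    have hfd : ∀ z, HasFDerivAt f ((1 : W →L[ℝ] W) + τ • fderiv ℝ X z) z := fun z =>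
      (hasFDerivAt_id z).add (((hX.differentiable one_ne_zero) z).hasFDerivAt.const_smul τ)
    have happ : ApproximatesLinearOn f ((ContinuousLinearEquiv.refl ℝ W : W ≃L[ℝ] W) : W →L[ℝ] W) univ
        (Real.toNNReal τ * K) := by
      intro x _ y _
      have : f x - f y - ((ContinuousLinearEquiv.refl ℝ W : W ≃L[ℝ] W) : W →L[ℝ] W) (x - y)
          = τ • (X x - X y) := by
        simp [hf, smul_sub]; abel
      rw [this, norm_smul, Real.norm_of_nonneg hτ]
      have := hK.norm_sub_le x y
      simp only [NNReal.coe_mul, Real.coe_toNNReal τ hτ, mul_assoc]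
      gcongr
    have hcc : Subsingleton W ∨ (Real.toNNReal τ * K : NNReal) <
        ‖((ContinuousLinearEquiv.refl ℝ W : W ≃L[ℝ] W).symm : W →L[ℝ] W)‖₊⁻¹ := by
      right
      have : ‖((ContinuousLinearEquiv.refl ℝ W : W ≃L[ℝ] W).symm : W →L[ℝ] W)‖₊ = 1 := by
        ext; exact ContinuousLinearMap.norm_id
      rw [this, inv_one, ← NNReal.coe_lt_coe]
      simpa [hτ] using h2
    have hinj : Function.Injective f := injOn_univ.1 (happ.injOn hcc)
    have hsurj : Function.Surjective f := happ.surjective hcc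
    have hout : ∀ z ∉ B, f z = z := by
      intro z hz
      have : X z = 0 := image_eq_zero_of_notMem_tsupport fun h => hz (hR h)
      simp [hf, this]
    have himg : f '' B = B := by
      apply Subset.antisymm
      · rintro _ ⟨z, hz, rfl⟩
        by_contra h
        have := hinj (hout _ h)
        rw [this] at h; exact h hz
      · intro y hy
        obtain ⟨z, rfl⟩ := hsurj y
        by_cases hz : z ∈ B
        · exact ⟨z, hz, rfl⟩
        · rw [hout z hz] at hy; exact absurd hy hz
    have hcv := integral_image_eq_integral_abs_det_fderiv_smul μ hBc.measurableSet
      (fun z _ => (hfd z).hasFDerivWithinAt) hinj.injOn (fun _ => (1:ℝ))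
    rw [himg] at hcv
    simp only [integral_const, smul_eq_mul, mul_one] at hcv
    rw [measureReal_restrict_apply_univ] at hcv
    rw [hcv]
    refine setIntegral_congr_fun hBc.measurableSet fun z _ => ?_
    refine (abs_of_pos (hdet _ ?_)).symm
    rw [norm_smul, Real.norm_of_nonneg hτ]
    exact lt_of_le_of_lt (by gcongr; exact hdX z) h1
  -- choose step
  obtain ⟨h, hh, hh1, hh2⟩ : ∃ h : ℝ, 0 < h ∧ (N * h) * K < ε ∧ (N * h) * K < 1 := by
    refine ⟨min ε 1 / (2 * (N * K + 1)), by positivity, ?_⟩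
    have : (N * (min ε 1 / (2 * (N * K + 1)))) * K < min ε 1 := by
      have h0 : 0 < min ε 1 := by positivity
      have h1 : (N * (min ε 1 / (2 * (N * K + 1)))) * K = min ε 1 * ((N * K) / (2 * (N * K + 1))) := by
        field_simp
      rw [h1]
      have h2 : ((N:ℝ) * K) / (2 * (N * K + 1)) < 1 := by
        rw [div_lt_one (by positivity)]
        have : (0:ℝ) ≤ N * K := by positivity
        linarith
      nlinarith
    exact ⟨this.trans_le (min_le_left _ _), this.trans_le (min_le_right _ _)⟩
  have hint : ∀ k ∈ Finset.range (N + 1),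
      ∫ z in B, ((1 : W →L[ℝ] W) + (k * h) • fderiv ℝ X z).det ∂μ = μ.real B := by
    intro k hk
    have hk' : (k : ℝ) ≤ N := by exact_mod_cast Nat.lt_succ_iff.1 (Finset.mem_range.1 hk)
    have : (k * h) * K ≤ (N * h) * K := by gcongr
    exact key _ (by positivity) (by linarith) (by linarith)
  have hpt : ∀ z, (N.factorial : ℝ) * (h ^ N * (fderiv ℝ X z).det) =
      ∑ k ∈ Finset.range (N + 1), (((-1 : ℤ) ^ (N - k) * N.choose k : ℤ) : ℝ) *
        ((1 : W →L[ℝ] W) + (k * h) • fderiv ℝ X z).det := by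
    intro z
    have := eb_det_fd (h • (fderiv ℝ X z : W →ₗ[ℝ] W))
    rw [LinearMap.det_smul] at this
    rw [ContinuousLinearMap.det]
    rw [← hN] at this
    rw [← this]
    refine Finset.sum_congr rfl fun k _ => ?_
    rw [ContinuousLinearMap.det]
    congr 2
    ext u
    simp [mul_smul]
  have hzero : ∫ z in B, (fderiv ℝ X z).det ∂μ = 0 := by
    have h1 : ∫ z in B, (N.factorial : ℝ) * (h ^ N * (fderiv ℝ X z).det) ∂μ = 0 := by
      simp_rw [hpt]
      rw [integral_finsetSum]
      · simp_rw [integral_const_mul]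
        rw [Finset.sum_congr rfl fun k hk => by rw [hint k hk]]
        rw [← Finset.sum_mul]
        have : ∑ k ∈ Finset.range (N + 1), (((-1 : ℤ) ^ (N - k) * N.choose k : ℤ) : ℝ) = 0 := by
          have h2 := add_pow (1:ℝ) (-1) N
          rw [add_neg_cancel, zero_pow hNpos.ne'] at h2
          rw [h2]
          simp
        rw [this, zero_mul]
      · intro k _
        refine Integrable.const_mul ?_ _
        have hcc : Continuous (fun z => ((1 : W →L[ℝ] W) + (k * h) • fderiv ℝ X z).det) :=
          hdetc.comp (by fun_prop)
        exact hcc.continuousOn.integrableOn_compact hBc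
    rw [integral_const_mul, integral_const_mul] at h1
    have : (N.factorial : ℝ) ≠ 0 := by positivity
    have h3 : h ^ N ≠ 0 := by positivity
    simpa [this, h3] using h1
  have hsupp : ∀ z ∉ tsupport X, (fderiv ℝ X z).det = 0 := by
    intro z hz
    have h0 : fderiv ℝ X z = 0 := by
      have : fderiv ℝ X z = 0 := image_eq_zero_of_notMem_tsupport
        (fun h => hz (tsupport_fderiv_subset ℝ h))
      exact this
    rw [h0, ContinuousLinearMap.det]
    simp
  by_contra hne
  have hcs : HasCompactSupport (fun z => δ * (fderiv ℝ X z).det) := by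
    apply HasCompactSupport.intro hc
    intro z hz
    rw [hsupp z hz, mul_zero]
  have hcont : Continuous (fun z => δ * (fderiv ℝ X z).det) := continuous_const.mul hJc
  have := Continuous.integral_pos_of_hasCompactSupport_nonneg_nonzero (μ := μ)
    hcont hcs hpos hne
  rw [integral_const_mul, ← setIntegral_eq_integral_of_forall_compl_eq_zero (s := B), hzero] at this
  · simp at this
  · intro z hz
    exact hsupp z fun h => hz (hR h)
end
end

section
open Set Filter Topology MeasureTheory
section
lemma eb_cutoff {W : Type*} [NormedAddCommGroup W] [NormedSpace ℝ W] [FiniteDimensional ℝ W]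
    {E : Type*} [NormedAddCommGroup E] [NormedSpace ℝ E]
    (V K : Set W) (hV : IsOpen V) (hK : IsCompact K) (hKV : K ⊆ V) (k : ℕ∞) (f : W → E)
    (hf : ContDiffOn ℝ k f V) :
    ∃ F : W → E, ContDiff ℝ k F ∧ HasCompactSupport F ∧ (∀ᶠ x in 𝓝ˢ K, F x = f x) ∧
      ∀ z, f z = 0 → F z = 0 := by
  obtain ⟨N, hN, hKN, hNV⟩ := exists_compact_between hK hV hKV
  obtain ⟨η, h1, h0, -⟩ := exists_contMDiffMap_one_nhds_of_subset_interior (n := (k : ℕ∞))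
    (modelWithCornersSelf ℝ W) hK.isClosed hKN
  have hη : ContDiff ℝ k η := η.contMDiff.contDiff
  have hzero : ∀ x ∉ N, η x • f x = 0 := fun x hx => by rw [h0 x hx, zero_smul]
  refine ⟨fun x => η x • f x, ?_, HasCompactSupport.intro hN hzero, ?_, ?_⟩
  · rw [contDiff_iff_contDiffAt]
    intro x
    by_cases hx : x ∈ N
    · exact hη.contDiffAt.smul (hf.contDiffAt (hV.mem_nhds (hNV hx)))
    · have : (fun x => η x • f x) =ᶠ[𝓝 x] fun _ => 0 := by
        filter_upwards [hN.isClosed.isOpen_compl.mem_nhds hx] with y hy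
        exact hzero y hy
      exact contDiffAt_const.congr_of_eventuallyEq this
  · filter_upwards [h1] with x hx
    rw [hx, one_smul]
  · intro z hz
    simp [hz]

lemma eb_det_tri {E : Type*} [NormedAddCommGroup E] [NormedSpace ℝ E] [FiniteDimensional ℝ E]
    (D : (E × ℝ) →L[ℝ] E) (l : (E × ℝ) →L[ℝ] ℝ) (m : E →L[ℝ] ℝ) (c : ℝ) :
    (D.prod (c • l + m.comp D)).det = c * (D.prod l).det := by
  let T : (E × ℝ) →ₗ[ℝ] (E × ℝ) :=
    (LinearMap.fst ℝ E ℝ).prod (c • LinearMap.snd ℝ E ℝ + m.toLinearMap ∘ₗ LinearMap.fst ℝ E ℝ)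
  have hT : LinearMap.det T = c := by
    let b := (Module.finBasis ℝ E).prod (Module.Basis.singleton Unit ℝ)
    rw [← LinearMap.det_toMatrix b]
    have : LinearMap.toMatrix b b T = Matrix.fromBlocks 1 0
        (Matrix.of fun _ j => m (Module.finBasis ℝ E j)) (Matrix.of fun _ _ => c) := by
      ext i j
      rcases i with i | i <;> rcases j with j | j <;>
        simp [b, T, LinearMap.toMatrix_apply, Matrix.one_apply, Finsupp.single_apply, eq_comm]
    rw [this, Matrix.det_fromBlocks_zero₁₂]
    simp
  have : (D.prod (c • l + m.comp D) : (E × ℝ) →L[ℝ] (E × ℝ)).toLinearMap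
      = T ∘ₗ (D.prod l).toLinearMap := by
    ext <;> simp [T]
  rw [ContinuousLinearMap.det, this, LinearMap.det_comp, hT]

lemma eb_lower {W : Type*} [TopologicalSpace W] {E : Type*} [NormedAddCommGroup E]
    (Q : Set W) (hQ : IsCompact Q) (f : W → E) (hf : ContinuousOn f Q) (h : ∀ z ∈ Q, f z ≠ 0) :
    ∃ ρ > 0, ∀ z ∈ Q, ρ < ‖f z‖ := by
  rcases Q.eq_empty_or_nonempty with rfl | hne
  · exact ⟨1, one_pos, by simp⟩
  · obtain ⟨x, hx, hm⟩ := hQ.exists_isMinOn hne hf.norm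
    have h0 : 0 < ‖f x‖ := norm_pos_iff.2 (h x hx)
    exact ⟨‖f x‖ / 2, by positivity, fun z hz => lt_of_lt_of_le (by linarith) (hm hz)⟩

/-- A primitive of a hat function. -/
lemma eb_prim (σ : ℝ) (hσ : 0 < σ) : ∃ B b : ℝ → ℝ, ContDiff ℝ 1 B ∧ (∀ t, HasDerivAt B (b t) t) ∧
    (∀ t, 0 ≤ b t) ∧ 0 < b σ ∧ (∀ t, b t ≠ 0 → σ / 2 < t ∧ t < 3 * σ / 2) ∧
    ∀ t, t < σ / 2 → B t = 0 := by
  let b : ℝ → ℝ := fun t => max 0 (σ / 2 - |t - σ|)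
  have hb : Continuous b := by fun_prop
  have hd : ∀ t, HasDerivAt (fun u => ∫ x in (0:ℝ)..u, b x) (b t) t := fun t =>
    intervalIntegral.integral_hasDerivAt_right (hb.intervalIntegrable _ _)
      hb.aestronglyMeasurable.stronglyMeasurableAtFilter hb.continuousAt
  have hz : ∀ t, b t ≠ 0 → σ / 2 < t ∧ t < 3 * σ / 2 := by
    intro t ht
    have : |t - σ| < σ / 2 := by
      by_contra h
      exact ht (max_eq_left (by linarith))
    rw [abs_lt] at this
    constructor <;> linarith
  refine ⟨fun u => ∫ x in (0:ℝ)..u, b x, b, ?_, hd, fun t => le_max_left _ _, ?_, hz, ?_⟩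
  · rw [contDiff_one_iff_deriv]
    refine ⟨fun t => (hd t).differentiableAt, ?_⟩
    have : deriv (fun u => ∫ x in (0:ℝ)..u, b x) = b := funext fun t => (hd t).deriv
    rw [this]; exact hb
  · simp only [b, sub_self, abs_zero, sub_zero]
    exact lt_max_of_lt_right (by positivity)
  · intro t ht
    have : ∫ x in (0:ℝ)..t, b x = ∫ x in (0:ℝ)..t, (0:ℝ) := by
      apply intervalIntegral.integral_congr
      intro x hx
      by_contra h
      have := (hz x h).1
      rw [mem_uIcc] at hx
      rcases hx with hx | hx <;> linarith
    change ∫ x in (0:ℝ)..t, b x = 0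
    rw [this]; simp

variable {E : Type*} [NormedAddCommGroup E] [InnerProductSpace ℝ E] [FiniteDimensional ℝ E]

/-- the Jacobian map of `(f, ‖x‖²/2)` -/
noncomputable def ebJ (f : E × ℝ → E) (z : E × ℝ) : (E × ℝ) →L[ℝ] (E × ℝ) :=
  (fderiv ℝ f z).prod ((innerSL ℝ z.1).comp (ContinuousLinearMap.fst ℝ E ℝ))

set_option maxHeartbeats 1000000 in
lemma eb_analytic (V Ω : Set (E × ℝ)) (hV : IsOpen V) (hΩ : IsOpen Ω) (hΩc : IsCompact (closure Ω))
    (hΩV : closure Ω ⊆ V) (f : E × ℝ → E) (hf : ContDiffOn ℝ 1 f V) (δ s : ℝ)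
    (ha : ∀ z ∈ frontier Ω, f z = 0 → z.1 = 0)
    (hb : ∀ z ∈ closure Ω, f z = 0 → z.1 ≠ 0 → ‖z.1‖ ^ 2 < s → 0 < δ * (ebJ f z).det)
    (z₀ : E × ℝ) (hz₀ : z₀ ∈ Ω) (hz₀f : f z₀ = 0) (hz₀1 : z₀.1 ≠ 0) (hz₀s : 2 * ‖z₀.1‖ ^ 2 < s) :
    False := by
  set σ := ‖z₀.1‖ ^ 2 with hσ
  have hσ0 : 0 < σ := by positivity
  obtain ⟨B, b, hB, hBd, hb0, hbσ, hbs, hB0⟩ := eb_prim σ hσ0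
  have hfc : ContinuousOn f (closure Ω) := hf.continuousOn.mono hΩV
  have hfd : ContinuousOn (fderiv ℝ f) (closure Ω) :=
    (hf.continuousOn_fderiv_of_isOpen hV le_rfl).mono hΩV
  have hJ : ContinuousOn (fun z => δ * (ebJ f z).det) (closure Ω) := by
    refine continuousOn_const.mul
      (ContinuousLinearMap.continuous_det.comp_continuousOn ?_)
    have h2 : Continuous fun z : E × ℝ =>
        (innerSL ℝ z.1).comp (ContinuousLinearMap.fst ℝ E ℝ) := by fun_prop
    have h3 : ∀ z, ebJ f z = (ContinuousLinearMap.inl ℝ E ℝ).comp (fderiv ℝ f z) +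
        (ContinuousLinearMap.inr ℝ E ℝ).comp
          ((innerSL ℝ z.1).comp (ContinuousLinearMap.fst ℝ E ℝ)) := by
      intro z
      ext y <;> simp [ebJ]
    refine ContinuousOn.congr ?_ (fun z _ => h3 z)
    exact (continuousOn_const.clm_comp hfd).add (continuousOn_const.clm_comp h2.continuousOn)
  have hq : Continuous fun z : E × ℝ => ‖z.1‖ ^ 2 := by fun_prop
  let Q1 : Set (E × ℝ) := frontier Ω ∩ {z | σ / 2 ≤ ‖z.1‖ ^ 2}
  let Q2 : Set (E × ℝ) := (closure Ω ∩ {z | δ * (ebJ f z).det ≤ 0}) ∩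
    {z | σ / 2 ≤ ‖z.1‖ ^ 2 ∧ ‖z.1‖ ^ 2 ≤ 3 * σ / 2}
  have hfr : frontier Ω ⊆ closure Ω := frontier_subset_closure
  have hQ1 : IsCompact Q1 := (hΩc.of_isClosed_subset isClosed_frontier hfr).inter_right
    (isClosed_le continuous_const hq)
  have hQ2 : IsCompact Q2 := by
    refine IsCompact.inter_right ?_ ((isClosed_le continuous_const hq).inter
      (isClosed_le hq continuous_const))
    exact hΩc.of_isClosed_subset
      (hJ.preimage_isClosed_of_isClosed isClosed_closure isClosed_Iic) inter_subset_left
  obtain ⟨ρ, hρ, hρQ⟩ := eb_lower (Q1 ∪ Q2) (hQ1.union hQ2) f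
    (hfc.mono (union_subset (inter_subset_left.trans hfr)
      (inter_subset_left.trans inter_subset_left))) (by
      rintro z (⟨hz, hz2⟩ | ⟨⟨hz, hz2⟩, hz3, hz4⟩) h0
      · have := ha z hz h0
        simp only [mem_ofPred_eq, this] at hz2
        norm_num at hz2; linarith
      · have h1 : z.1 ≠ 0 := by
          intro h; rw [h] at hz3; norm_num at hz3; linarith
        have := hb z hz h0 h1 (by linarith)
        simp only [mem_ofPred_eq] at hz2
        linarith)
  let α : ContDiffBump (0 : E) := ⟨ρ / 2, ρ, by positivity, by linarith⟩
  have hα0 : ∀ y, α y ≠ 0 → ‖y‖ < ρ := by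
    intro y hy
    by_contra h
    exact hy (α.zero_of_le_dist (by simpa [α] using h))
  let u : E × ℝ → ℝ := Ω.indicator fun z => α (f z) * B (‖z.1‖ ^ 2)
  let C0 : Set (E × ℝ) := (closure Ω ∩ {z | ‖f z‖ ≤ ρ}) ∩ {z | σ / 2 ≤ ‖z.1‖ ^ 2}
  have hC0c : IsClosed C0 :=
    (hfc.norm.preimage_isClosed_of_isClosed isClosed_closure isClosed_Iic).inter
      (isClosed_le continuous_const hq)
  have hC0k : IsCompact C0 := hΩc.of_isClosed_subset hC0c (inter_subset_left.trans inter_subset_left)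
  have hC0Ω : C0 ⊆ Ω := by
    rintro z ⟨⟨hz, hz2⟩, hz3⟩
    by_contra h
    have h1 : z ∈ frontier Ω := by rw [hΩ.frontier_eq]; exact ⟨hz, h⟩
    have := hρQ z (Or.inl ⟨h1, hz3⟩)
    simp only [mem_ofPred_eq] at hz2
    linarith
  have hu0 : ∀ z ∉ C0, u z = 0 := by
    intro z hz
    by_cases hzΩ : z ∈ Ω
    · simp only [u, indicator_of_mem hzΩ]
      by_contra h
      obtain ⟨h1, h2⟩ := mul_ne_zero_iff.1 h
      refine hz ⟨⟨subset_closure hzΩ, (hα0 _ h1).le⟩, ?_⟩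
      by_contra h3
      exact h2 (hB0 _ (not_le.1 h3))
    · simp only [u, indicator_of_notMem hzΩ]
  have hu0' : ∀ z ∉ C0, u =ᶠ[𝓝 z] fun _ => 0 := by
    intro z hz
    filter_upwards [hC0c.isOpen_compl.mem_nhds hz] with y hy using hu0 y hy
  have huΩ : ∀ z ∈ Ω, u =ᶠ[𝓝 z] fun z => α (f z) * B (‖z.1‖ ^ 2) := by
    intro z hz
    filter_upwards [hΩ.mem_nhds hz] with y hy
    simp only [u, indicator_of_mem hy]
  have hfz : ∀ z ∈ Ω, ContDiffAt ℝ 1 f z := fun z hz =>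
    hf.contDiffAt (hV.mem_nhds (hΩV (subset_closure hz)))
  have huC : ContDiff ℝ 1 u := by
    rw [contDiff_iff_contDiffAt]
    intro z
    by_cases hz : z ∈ C0
    · have hzΩ := hC0Ω hz
      refine ContDiffAt.congr_of_eventuallyEq ?_ (huΩ z hzΩ)
      refine ContDiffAt.mul ?_ ?_
      · exact α.contDiff.contDiffAt.comp z (hfz z hzΩ)
      · refine hB.contDiffAt.comp z ?_
        exact (contDiff_fst.norm_sq ℝ).contDiffAt
    · exact contDiffAt_const.congr_of_eventuallyEq (hu0' z hz)
  obtain ⟨F, hF, hFc, hFf, -⟩ := eb_cutoff V (closure Ω) hV hΩc hΩV 1 f hf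
  have hFΩ : ∀ z ∈ Ω, F =ᶠ[𝓝 z] f := by
    intro z hz
    exact hFf.filter_mono (nhds_le_nhdsSet (subset_closure hz))
  let X : E × ℝ → E × ℝ := fun z => (F z, u z)
  have hXC : ContDiff ℝ 1 X := hF.prodMk huC
  have hXs : HasCompactSupport X := by
    refine HasCompactSupport.intro (hFc.isCompact.union hC0k) ?_
    intro z hz
    simp only [mem_union, not_or] at hz
    simp [X, hu0 z hz.2, image_eq_zero_of_notMem_tsupport hz.1]
  have hdet : ∀ z ∈ Ω, δ * (fderiv ℝ X z).det =
      (α (f z) * b (‖z.1‖ ^ 2) * 2) * (δ * (ebJ f z).det) := by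
    intro z hz
    have h1 : HasFDerivAt f (fderiv ℝ f z) z := ((hfz z hz).differentiableAt one_ne_zero).hasFDerivAt
    have h2 : HasFDerivAt F (fderiv ℝ f z) z := h1.congr_of_eventuallyEq (hFΩ z hz)
    have h3 : HasFDerivAt (fun y => α y) (fderiv ℝ α (f z)) (f z) :=
      ((α.contDiff (n := 1)).differentiable one_ne_zero (f z)).hasFDerivAt
    have h4 := h3.comp z h1
    have h5 : HasFDerivAt (fun z : E × ℝ => ‖z.1‖ ^ 2)
        (2 • (innerSL ℝ z.1).comp (ContinuousLinearMap.fst ℝ E ℝ)) z :=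
      (hasFDerivAt_fst (𝕜 := ℝ) (p := z)).norm_sq
    have h6 := (hBd (‖z.1‖ ^ 2)).comp_hasFDerivAt z h5
    have h7 := (h4.mul h6).congr_of_eventuallyEq (huΩ z hz)
    have h8 : HasFDerivAt X _ z := h2.prodMk h7
    rw [h8.fderiv]
    have h9 := eb_det_tri (fderiv ℝ f z) ((innerSL ℝ z.1).comp (ContinuousLinearMap.fst ℝ E ℝ))
      (B (‖z.1‖ ^ 2) • fderiv ℝ α (f z)) (α (f z) * b (‖z.1‖ ^ 2) * 2)
    have : (fderiv ℝ f z).prod ((α (f z) * b (‖z.1‖ ^ 2) * 2) •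
        ((innerSL ℝ z.1).comp (ContinuousLinearMap.fst ℝ E ℝ)) +
        (B (‖z.1‖ ^ 2) • fderiv ℝ α (f z)).comp (fderiv ℝ f z)) = (fderiv ℝ f z).prod
        ((α ∘ f) z • b (‖z.1‖ ^ 2) • 2 • (innerSL ℝ z.1).comp (ContinuousLinearMap.fst ℝ E ℝ) +
          (B ∘ fun z : E × ℝ => ‖z.1‖ ^ 2) z • (fderiv ℝ α (f z)).comp (fderiv ℝ f z)) := by
      congr 1
      ext y <;> simp <;> ring
    rw [← this, h9, ebJ]
    ring
  have hpos : ∀ z, 0 ≤ δ * (fderiv ℝ X z).det := by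
    intro z
    by_cases hz : z ∈ C0
    · have hzΩ := hC0Ω hz
      rw [hdet z hzΩ]
      by_cases h0 : α (f z) * b (‖z.1‖ ^ 2) = 0
      · rw [h0]; simp
      · obtain ⟨h1, h2⟩ := mul_ne_zero_iff.1 h0
        have h3 := hbs _ h2
        have h4 := hα0 _ h1
        have h5 : 0 < δ * (ebJ f z).det := by
          by_contra h
          have := hρQ z (Or.inr ⟨⟨subset_closure hzΩ, not_lt.1 h⟩, h3.1.le, h3.2.le⟩)
          linarith
        have := α.nonneg' (f z)
        have := hb0 (‖z.1‖ ^ 2)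
        positivity
    · have h1 : HasFDerivAt u (0 : (E × ℝ) →L[ℝ] ℝ) z :=
        (hasFDerivAt_const (0:ℝ) z).congr_of_eventuallyEq (hu0' z hz)
      have h2 : HasFDerivAt F (fderiv ℝ F z) z := (hF.differentiable one_ne_zero z).hasFDerivAt
      have h3 : HasFDerivAt X _ z := h2.prodMk h1
      rw [h3.fderiv]
      have := eb_det_tri (fderiv ℝ F z) 0 0 0
      simp only [zero_smul, ContinuousLinearMap.zero_comp, add_zero, zero_mul] at this
      rw [this, mul_zero]
  have hfin := eb_det_zero X hXC hXs δ hpos z₀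
  rw [hdet z₀ hz₀, hz₀f] at hfin
  have h1 : 0 < α 0 := α.pos_of_mem_ball (by simp [α, hρ])
  have h2 := hb z₀ (subset_closure hz₀) hz₀f hz₀1 (by linarith)
  have : 0 < (α 0 * b (‖z₀.1‖ ^ 2) * 2) * (δ * (ebJ f z₀).det) := by
    have : 0 < b (‖z₀.1‖ ^ 2) := hbσ
    positivity
  linarith
end
end

section
open Set Filter Topology MeasureTheory
section
lemma eb_whyburn {X : Type*} [TopologicalSpace X] [T2Space X] (Y P Q : Set X) (hY : IsCompact Y)
    (hP : IsCompact P) (hPY : P ⊆ Y)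
    (h : ∀ D ⊆ Y, IsPreconnected D → (D ∩ P).Nonempty → Disjoint D Q) (hQ : IsClosed Q) :
    ∃ Ya Yb : Set X, IsCompact Ya ∧ IsCompact Yb ∧ Ya ∪ Yb = Y ∧ Disjoint Ya Yb ∧ P ⊆ Ya ∧
      Disjoint Ya Q := by
  have : CompactSpace Y := isCompact_iff_compactSpace.1 hY
  have key : ∀ p ∈ P, ∃ T : Set Y, IsClopen T ∧ p ∈ ((↑) '' T : Set X) ∧ Disjoint ((↑) '' T : Set X) Q := by
    intro p hp
    have hcomp : connectedComponent (⟨p, hPY hp⟩ : Y) ⊆ ((↑) ⁻¹' Q : Set Y)ᶜ := by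
      have h1 : IsPreconnected ((↑) '' connectedComponent (⟨p, hPY hp⟩ : Y) : Set X) :=
        isPreconnected_connectedComponent.image _ continuous_subtype_val.continuousOn
      have h2 := h _ (by rintro _ ⟨y, -, rfl⟩; exact y.2) h1
        ⟨p, ⟨⟨p, hPY hp⟩, mem_connectedComponent, rfl⟩, hp⟩
      intro y hy hyQ
      exact disjoint_left.1 h2 ⟨y, hy, rfl⟩ hyQ
    rw [connectedComponent_eq_iInter_isClopen] at hcomp
    have hQo : IsOpen ((↑) ⁻¹' Q : Set Y)ᶜ := (hQ.preimage continuous_subtype_val).isOpen_compl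
    have hne : Nonempty { s : Set Y // IsClopen s ∧ (⟨p, hPY hp⟩ : Y) ∈ s } :=
      ⟨⟨univ, isClopen_univ, mem_univ _⟩⟩
    have hdir : Directed (· ⊇ ·)
        (fun s : { s : Set Y // IsClopen s ∧ (⟨p, hPY hp⟩ : Y) ∈ s } => (s : Set Y)) := by
      rintro ⟨s, hs, hs'⟩ ⟨t, ht, ht'⟩
      exact ⟨⟨s ∩ t, hs.inter ht, hs', ht'⟩, inter_subset_left, inter_subset_right⟩
    obtain ⟨⟨T, hT, hpT⟩, hTs⟩ := exists_subset_nhds_of_isCompact hdir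
      (fun s => s.2.1.isClosed.isCompact) (U := ((↑) ⁻¹' Q : Set Y)ᶜ)
      (fun x hx => hQo.mem_nhds (hcomp hx))
    refine ⟨T, hT, ⟨⟨p, hPY hp⟩, hpT, rfl⟩, ?_⟩
    rw [disjoint_left]
    rintro _ ⟨y, hy, rfl⟩ hyQ
    exact hTs hy hyQ
  choose! T hT hpT hTQ using key
  have hP' : IsCompact ((↑) ⁻¹' P : Set Y) := by
    rw [Subtype.isCompact_iff, Subtype.image_preimage_coe, inter_eq_right.2 hPY]
    exact hP
  obtain ⟨t, ht⟩ := hP'.elim_nhds_subcover' (fun p hp => T p)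
    (fun p hp => (hT p hp).isOpen.mem_nhds (by
      obtain ⟨y, hy, h⟩ := hpT p hp
      rwa [Subtype.ext h] at hy))
  let A : Set Y := ⋃ x ∈ t, T (x : Y)
  have hA : IsClopen A := t.finite_toSet.isClopen_biUnion fun x _ => hT _ x.2
  refine ⟨(↑) '' A, (↑) '' Aᶜ, ?_, ?_, ?_, ?_, ?_, ?_⟩
  · exact hA.isClosed.isCompact.image continuous_subtype_val
  · exact hA.compl.isClosed.isCompact.image continuous_subtype_val
  · rw [← image_union, union_compl_self]; simp
  · exact (disjoint_image_iff Subtype.val_injective).2 disjoint_compl_right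
  · intro p hp
    exact ⟨⟨p, hPY hp⟩, ht hp, rfl⟩
  · rw [disjoint_left]
    rintro _ ⟨y, hy, rfl⟩ hyQ
    simp only [A, mem_iUnion] at hy
    obtain ⟨x, -, hx⟩ := hy
    exact disjoint_left.1 (hTQ _ x.2) ⟨y, hx, rfl⟩ hyQ

variable {E : Type*} [NormedAddCommGroup E] [InnerProductSpace ℝ E] [FiniteDimensional ℝ E]

set_option maxHeartbeats 1000000 in
theorem eb_global (V : Set (E × ℝ)) (hV : IsOpen V) (f : E × ℝ → E) (hf : ContDiffOn ℝ 1 f V)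
    (A₀ : ℝ) (N0 : Set (E × ℝ)) (hN0 : IsOpen N0) (hp0 : ((0 : E), A₀) ∈ N0)
    (δ : ℝ) (S S1 S2 : Set (E × ℝ)) (hS : ∀ z, z ∈ S ↔ z ∈ V ∧ f z = 0 ∧ z.1 ≠ 0)
    (hS1 : IsPreconnected S1) (hS2 : IsPreconnected S2) (hS1S : S1 ⊆ S) (hS2S : S2 ⊆ S)
    (hc1 : ((0 : E), A₀) ∈ closure S1) (hc2 : ((0 : E), A₀) ∈ closure S2)
    (hSN : S ∩ N0 ⊆ S1 ∪ S2)
    (hsgn : ∀ z ∈ S ∩ N0, 0 < δ * (ebJ f z).det) :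
    ∃ C : Set (E × ℝ), IsConnected C ∧ C ⊆ S ∧ ((0 : E), A₀) ∈ closure C ∧
      (¬ Bornology.IsBounded C ∨ (∃ p ∈ closure C, p ∉ V) ∨
        ∃ A₁, A₁ ≠ A₀ ∧ ((0 : E), A₁) ∈ closure C) := by
  set p0 : E × ℝ := (0, A₀) with hp0def
  obtain ⟨x1, hx1⟩ : S1.Nonempty := closure_nonempty_iff.1 ⟨_, hc1⟩
  obtain ⟨x2, hx2⟩ : S2.Nonempty := closure_nonempty_iff.1 ⟨_, hc2⟩
  set C1 := connectedComponentIn S x1 with hC1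
  set C2 := connectedComponentIn S x2 with hC2
  have hS1C : S1 ⊆ C1 := hS1.subset_connectedComponentIn hx1 hS1S
  have hS2C : S2 ⊆ C2 := hS2.subset_connectedComponentIn hx2 hS2S
  have hC1S : C1 ⊆ S := connectedComponentIn_subset _ _
  have hC2S : C2 ⊆ S := connectedComponentIn_subset _ _
  by_contra hcon
  have hcon' : ∀ C : Set (E × ℝ), IsConnected C → C ⊆ S → p0 ∈ closure C →
      Bornology.IsBounded C ∧ closure C ⊆ V ∧ ∀ A₁, ((0 : E), A₁) ∈ closure C → A₁ = A₀ := by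
    intro C h1 h2 h3
    by_contra h
    apply hcon
    refine ⟨C, h1, h2, h3, ?_⟩
    by_contra h4
    push Not at h4
    apply h
    exact ⟨h4.1, h4.2.1, fun A hA => by by_contra h5; exact h4.2.2 A h5 hA⟩
  obtain ⟨hb1, hv1, ht1⟩ := hcon' C1 (isConnected_connectedComponentIn_iff.2 (hS1S hx1)) hC1S
    (closure_mono hS1C hc1)
  obtain ⟨hb2, hv2, ht2⟩ := hcon' C2 (isConnected_connectedComponentIn_iff.2 (hS2S hx2)) hC2S
    (closure_mono hS2C hc2)
  have hfV : ContinuousOn f V := hf.continuousOn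
  -- zeros are closed in V
  have hzero : ∀ T ⊆ S, ∀ z ∈ closure T, z ∈ V → f z = 0 := by
    intro T hT z hz hzV
    have h1 : ContinuousWithinAt f T z := (hfV.continuousAt (hV.mem_nhds hzV)).continuousWithinAt
    have h2 := h1.mem_closure_image hz
    have h3 : f '' T ⊆ {0} := by
      rintro _ ⟨y, hy, rfl⟩; exact ((hS y).1 (hT hy)).2.1
    have h4 := closure_mono h3 h2
    simpa using h4
  have hclos : ∀ x ∈ S, closure (connectedComponentIn S x) ∩ S ⊆ connectedComponentIn S x := by
    intro x hx z ⟨hz, hzS⟩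
    have hsub : connectedComponentIn S x ⊆ insert z (connectedComponentIn S x) := subset_insert _ _
    have h1 : IsPreconnected (insert z (connectedComponentIn S x)) :=
      isPreconnected_connectedComponentIn.subset_closure hsub
        (insert_subset hz subset_closure)
    exact h1.subset_connectedComponentIn (hsub (mem_connectedComponentIn hx))
      (insert_subset hzS (connectedComponentIn_subset _ _)) (mem_insert _ _)
  set K := closure C1 ∪ closure C2 with hK
  have hKc : IsCompact K := hb1.isCompact_closure.union hb2.isCompact_closure
  have hKV : K ⊆ V := union_subset hv1 hv2
  have hp0K : p0 ∈ K := Or.inl (closure_mono hS1C hc1)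
  have hKS : ∀ z ∈ K, z ∈ S → z ∈ C1 ∪ C2 := by
    rintro z (hz | hz) hzS
    · exact Or.inl (hclos x1 (hS1S hx1) ⟨hz, hzS⟩)
    · exact Or.inr (hclos x2 (hS2S hx2) ⟨hz, hzS⟩)
  have hKf : ∀ z ∈ K, f z = 0 := by
    rintro z (hz | hz)
    · exact hzero _ hC1S z hz (hv1 hz)
    · exact hzero _ hC2S z hz (hv2 hz)
  have hKt : ∀ z ∈ K, z ∈ S ∨ z = p0 := by
    intro z hz
    by_cases h : z.1 = 0
    · right
      have hze : z = (0, z.2) := Prod.ext h rfl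
      rw [hze] at hz ⊢
      rcases hz with hz | hz
      · rw [ht1 _ hz]
      · rw [ht2 _ hz]
    · exact Or.inl ((hS z).2 ⟨hKV hz, hKf z hz, h⟩)
  -- trivial points outside N0
  let T : Set (E × ℝ) := {z | z.1 = 0} \ N0
  have hTc : IsClosed T := (isClosed_eq continuous_fst continuous_const).sdiff hN0
  have hKT : K ⊆ V ∩ Tᶜ := by
    intro z hz
    refine ⟨hKV hz, fun hzT => ?_⟩
    rcases hKt z hz with h | h
    · exact ((hS z).1 h).2.2 hzT.1
    · rw [h] at hzT; exact hzT.2 hp0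
  obtain ⟨N, hNc, hKN, hNV⟩ := exists_compact_between hKc (hV.inter hTc.isOpen_compl) hKT
  -- Y
  let Y : Set (E × ℝ) := (N ∩ {z | f z = 0}) \ N0
  have hNf : IsClosed (N ∩ {z | f z = 0}) :=
    (hfV.mono (hNV.trans inter_subset_left)).preimage_isClosed_of_isClosed hNc.isClosed
      (isClosed_singleton (x := (0 : E)))
  have hYc : IsCompact Y := (hNc.of_isClosed_subset hNf inter_subset_left).diff hN0
  have hYS : Y ⊆ S := by
    rintro z ⟨⟨hzN, hzf⟩, hz0⟩
    refine (hS z).2 ⟨(hNV hzN).1, hzf, fun h => (hNV hzN).2 ⟨h, hz0⟩⟩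
  have hcomp : ∀ D ⊆ Y, IsPreconnected D → (D ∩ (K ∩ Y)).Nonempty → D ⊆ K := by
    rintro D hD hDc ⟨z, hzD, hzK, hzY⟩
    have hDS := hD.trans hYS
    rcases hKS z hzK (hYS hzY) with h | h
    · have : D ⊆ C1 := by
        rw [hC1, connectedComponentIn_eq h]
        exact hDc.subset_connectedComponentIn hzD hDS
      exact this.trans (subset_closure.trans subset_union_left)
    · have : D ⊆ C2 := by
        rw [hC2, connectedComponentIn_eq h]
        exact hDc.subset_connectedComponentIn hzD hDS
      exact this.trans (subset_closure.trans subset_union_right)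
  obtain ⟨Ya, Yb, hYa, hYb, hYab, hYd, hKYa, hYaQ⟩ := eb_whyburn Y (K ∩ Y) (interior N)ᶜ hYc
    (hKc.inter hYc) inter_subset_right
    (fun D hD hDc hne => by
      have := (hcomp D hD hDc hne).trans hKN
      exact disjoint_compl_right_iff_subset.2 this)
    isOpen_interior.isClosed_compl
  have hYaN : Ya ⊆ interior N := disjoint_compl_right_iff_subset.1 hYaQ
  set Ma := Ya ∪ K with hMa
  have hMac : IsCompact Ma := hYa.union hKc
  have hMaN : Ma ⊆ interior N ∩ Ybᶜ := by
    rintro z (hz | hz)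
    · exact ⟨hYaN hz, fun h => disjoint_left.1 hYd hz h⟩
    · refine ⟨hKN hz, fun h => ?_⟩
      have : z ∈ Y := hYab ▸ Or.inr h
      exact disjoint_left.1 hYd (hKYa ⟨hz, this⟩) h
  obtain ⟨Ω, hΩ, hMΩ, hΩN, hΩc⟩ := exists_open_between_and_isCompact_closure hMac
    (isOpen_interior.inter hYb.isClosed.isOpen_compl) hMaN
  have hΩN' : closure Ω ⊆ N := hΩN.trans (inter_subset_left.trans interior_subset)
  have hcl : ∀ z ∈ closure Ω, f z = 0 → z.1 ≠ 0 → z ∈ Ma := by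
    intro z hz hzf hz1
    have hzS : z ∈ S := (hS z).2 ⟨(hNV (hΩN' hz)).1, hzf, hz1⟩
    by_cases h : z ∈ N0
    · right
      rcases hSN ⟨hzS, h⟩ with h | h
      · exact Or.inl (subset_closure (hS1C h))
      · exact Or.inr (subset_closure (hS2C h))
    · have : z ∈ Ya ∪ Yb := hYab ▸ ⟨⟨hΩN' hz, hzf⟩, h⟩
      rcases this with h | h
      · exact Or.inl h
      · exact absurd h (hΩN hz).2
  -- lower bound
  obtain ⟨r, hr, hrl⟩ := eb_lower (closure Ω ∩ Y) (hΩc.inter hYc) (fun z => z.1)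
    continuous_fst.continuousOn (fun z hz => ((hS z).1 (hYS hz.2)).2.2)
  obtain ⟨z₀, hz₀1, hz₀S⟩ : ∃ z₀ ∈ {z : E × ℝ | 2 * ‖z.1‖ ^ 2 < r ^ 2}, z₀ ∈ S1 := by
    apply mem_closure_iff.1 hc1
    · exact isOpen_lt (by fun_prop) continuous_const
    · simp [hp0def]; positivity
  have hz₀ := (hS z₀).1 (hS1S hz₀S)
  refine eb_analytic V Ω hV hΩ hΩc (hΩN'.trans (hNV.trans inter_subset_left)) f hf δ (r ^ 2)
    ?_ ?_ z₀ (hMΩ (Or.inr (Or.inl (subset_closure (hS1C hz₀S))))) hz₀.2.1 hz₀.2.2 hz₀1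
  · intro z hz hzf
    by_contra h
    have := hMΩ (hcl z (frontier_subset_closure hz) hzf h)
    rw [hΩ.frontier_eq] at hz
    exact hz.2 this
  · intro z hz hzf hz1 hlt
    apply hsgn
    have hzN := hΩN' hz
    refine ⟨(hS z).2 ⟨(hNV hzN).1, hzf, hz1⟩, ?_⟩
    by_contra h
    have := hrl z ⟨hz, ⟨hzN, hzf⟩, h⟩
    have h0 : r ^ 2 < ‖z.1‖ ^ 2 := by gcongr
    linarith
end
end

section
open Set Filter Topology MeasureTheory
section
lemma eb_paramint {P E : Type*} [NormedAddCommGroup P] [NormedSpace ℝ P] [FiniteDimensional ℝ P]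
    [NormedAddCommGroup E] [NormedSpace ℝ E] [FiniteDimensional ℝ E]
    (k : ℝ × P → E) (hk : ContDiff ℝ 1 k) :
    ContDiff ℝ 1 (fun p => ∫ t in (0:ℝ)..1, k (t, p)) := by
  have hfd : Continuous (fderiv ℝ k) := hk.continuous_fderiv one_ne_zero
  let k' : P → ℝ → (P →L[ℝ] E) := fun p t => (fderiv ℝ k (t, p)).comp (ContinuousLinearMap.inr ℝ ℝ P)
  have hk' : Continuous (Function.uncurry k') := by
    simp only [k', Function.uncurry_def]
    exact (hfd.comp (by fun_prop)).clm_comp continuous_const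
  have hkd : ∀ p t, HasFDerivAt (fun p => k (t, p)) (k' p t) p := by
    intro p t
    have h1 : HasFDerivAt k (fderiv ℝ k (t, p)) (t, p) :=
      (hk.differentiable one_ne_zero (t, p)).hasFDerivAt
    exact h1.comp p (hasFDerivAt_prodMk_right t p)
  have hmain : ∀ p, HasFDerivAt (fun p => ∫ t in (0:ℝ)..1, k (t, p)) (∫ t in (0:ℝ)..1, k' p t) p := by
    intro p
    obtain ⟨Cb, hCb⟩ := ((isCompact_closedBall p 1).prod (isCompact_Icc (a := (0:ℝ)) (b := 1))).exists_bound_of_continuousOn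
      hk'.continuousOn
    refine intervalIntegral.hasFDerivAt_integral_of_dominated_of_fderiv_le
      (F := fun p t => k (t, p)) (F' := k') (bound := fun _ => Cb) (s := Metric.closedBall p 1) (μ := volume) 
      (Metric.closedBall_mem_nhds p one_pos) ?_ ?_ ?_ ?_ ?_ ?_
    · refine Eventually.of_forall fun q => ?_
      exact (hk.continuous.comp (by fun_prop : Continuous fun t : ℝ => (t, q))).aestronglyMeasurable
    · exact (hk.continuous.comp (by fun_prop : Continuous fun t : ℝ => (t, p))).intervalIntegrable _ _
    · exact (hk'.comp (by fun_prop : Continuous fun t : ℝ => (p, t))).aestronglyMeasurable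
    · refine Eventually.of_forall fun t ht x hx => hCb (x, t) ⟨hx, ?_⟩
      rw [uIoc_of_le zero_le_one] at ht
      exact ⟨ht.1.le, ht.2⟩
    · exact intervalIntegrable_const
    · exact Eventually.of_forall fun t _ x _ => hkd x t
  rw [contDiff_one_iff_fderiv]
  refine ⟨fun p => (hmain p).differentiableAt, ?_⟩
  have : fderiv ℝ (fun p => ∫ t in (0:ℝ)..1, k (t, p)) = fun p => ∫ t in (0:ℝ)..1, k' p t :=
    funext fun p => (hmain p).fderiv
  rw [this]
  exact intervalIntegral.continuous_parametric_intervalIntegral_of_continuous' hk' 0 1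

variable {E : Type*} [NormedAddCommGroup E] [InnerProductSpace ℝ E] [FiniteDimensional ℝ E]

lemma eb_h (f : E × ℝ → E) (hf : ContDiff ℝ 2 f) (hf0 : ∀ A, f (0, A) = 0) :
    ∃ h : ℝ × E × ℝ → E, ContDiff ℝ 1 h ∧ (∀ s ξ A, f (s • ξ, A) = s • h (s, ξ, A)) ∧
      ∀ ξ A, h (0, ξ, A) = fderiv ℝ f (0, A) (ξ, 0) := by
  have hfd : ContDiff ℝ 1 (fderiv ℝ f) := hf.fderiv_right (by norm_num)
  let k : ℝ × (ℝ × E × ℝ) → E := fun q =>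
    fderiv ℝ f ((q.1 * q.2.1) • q.2.2.1, q.2.2.2) (q.2.2.1, 0)
  have hk : ContDiff ℝ 1 k := by
    refine ContDiff.clm_apply (hfd.comp ?_) ?_ <;> fun_prop
  refine ⟨fun p => ∫ t in (0:ℝ)..1, k (t, p), eb_paramint k hk, ?_, ?_⟩
  · intro s ξ A
    have hd : ∀ t ∈ uIcc (0:ℝ) 1, HasDerivAt (fun t : ℝ => f ((t * s) • ξ, A)) (s • k (t, s, ξ, A)) t := by
      intro t _
      have h1 : HasFDerivAt f (fderiv ℝ f ((t * s) • ξ, A)) ((t * s) • ξ, A) :=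
        (hf.differentiable two_ne_zero _).hasFDerivAt
      have h2 : HasDerivAt (fun t : ℝ => ((t * s) • ξ, A)) (s • ξ, (0:ℝ)) t := by
        refine HasDerivAt.prodMk ?_ (hasDerivAt_const _ _)
        simpa using ((hasDerivAt_id t).mul_const s).smul_const ξ
      have h3 := h1.comp_hasDerivAt t h2
      have h4 : s • k (t, s, ξ, A) = fderiv ℝ f ((t * s) • ξ, A) (s • ξ, (0:ℝ)) := by
        simp only [k]
        rw [← map_smul]
        simp
      rw [h4]
      exact h3
    have := intervalIntegral.integral_eq_sub_of_hasDerivAt hd (by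
      apply Continuous.intervalIntegrable
      exact continuous_const.smul (hk.continuous.comp (by fun_prop)))
    simp only [intervalIntegral.integral_smul, one_mul, zero_mul, zero_smul, hf0, sub_zero] at this
    exact this.symm
  · intro ξ A
    simp [k]

lemma eb_det_diag (c : ℝ) : ((ContinuousLinearMap.fst ℝ E ℝ).prod
    (c • ContinuousLinearMap.snd ℝ E ℝ)).det = c := by
  have := eb_det_tri (ContinuousLinearMap.fst ℝ E ℝ) (ContinuousLinearMap.snd ℝ E ℝ) 0 c
  simp only [ContinuousLinearMap.zero_comp, add_zero] at this
  rw [this]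
  have : (ContinuousLinearMap.fst ℝ E ℝ).prod (ContinuousLinearMap.snd ℝ E ℝ) =
    ContinuousLinearMap.id ℝ (E × ℝ) := by ext <;> simp
  rw [this]; simp [ContinuousLinearMap.det]

/-- the desingularised Jacobian -/
noncomputable def ebM (h : ℝ × E × ℝ → E) (q : ℝ × E × ℝ) : (E × ℝ) →L[ℝ] (E × ℝ) :=
  ((fderiv ℝ h q).comp (ContinuousLinearMap.inr ℝ ℝ (E × ℝ))).prod
    ((innerSL ℝ q.2.1).comp (ContinuousLinearMap.fst ℝ E ℝ))

lemma ebM_cont (h : ℝ × E × ℝ → E) (hh : ContDiff ℝ 1 h) : Continuous fun q => (ebM h q).det := by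
  refine ContinuousLinearMap.continuous_det.comp ?_
  have hfd : Continuous (fderiv ℝ h) := hh.continuous_fderiv one_ne_zero
  have h2 : Continuous fun z : ℝ × E × ℝ =>
      (innerSL ℝ z.2.1).comp (ContinuousLinearMap.fst ℝ E ℝ) := by fun_prop
  have h3 : ∀ z, ebM h z = (ContinuousLinearMap.inl ℝ E ℝ).comp
      ((fderiv ℝ h z).comp (ContinuousLinearMap.inr ℝ ℝ (E × ℝ))) +
      (ContinuousLinearMap.inr ℝ E ℝ).comp
        ((innerSL ℝ z.2.1).comp (ContinuousLinearMap.fst ℝ E ℝ)) := by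
    intro z
    ext y <;> simp [ebM]
  rw [show ebM h = _ from funext h3]
  exact (continuous_const.clm_comp (hfd.clm_comp continuous_const)).add (continuous_const.clm_comp h2)

lemma ebM_det (f : E × ℝ → E) (hf : ContDiff ℝ 2 f) (h : ℝ × E × ℝ → E) (hh : ContDiff ℝ 1 h)
    (hfh : ∀ s ξ A, f (s • ξ, A) = s • h (s, ξ, A)) (s : ℝ) (hs : s ≠ 0) (ξ : E) (A : ℝ) :
    (ebJ f (s • ξ, A)).det = s ^ 2 * (ebM h (s, ξ, A)).det := by
  have hd : ∀ y a, fderiv ℝ f (s • ξ, A) (s • y, a) = s • fderiv ℝ h (s, ξ, A) (0, y, a) := by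
    intro y a
    have h1 : HasFDerivAt f (fderiv ℝ f (s • ξ, A)) (s • ξ, A) :=
        (hf.differentiable two_ne_zero _).hasFDerivAt
    have h2 : HasFDerivAt h (fderiv ℝ h (s, ξ, A)) (s, ξ, A) :=
        (hh.differentiable one_ne_zero _).hasFDerivAt
    have h3 : HasFDerivAt (fun p : E × ℝ => (s • p.1, p.2))
        ((s • ContinuousLinearMap.fst ℝ E ℝ).prod (ContinuousLinearMap.snd ℝ E ℝ)) (ξ, A) :=
      (hasFDerivAt_fst.const_smul s).prodMk hasFDerivAt_snd
    have h4 := h1.comp (ξ, A) h3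
    have h5 := (h2.comp (ξ, A) (hasFDerivAt_prodMk_right s (ξ, A))).const_smul s
    have h6 : (f ∘ fun p : E × ℝ => (s • p.1, p.2)) = s • (h ∘ fun p : E × ℝ => (s, p)) := by
      ext p
      exact hfh s p.1 p.2
    rw [h6] at h4
    have h7 := h4.unique h5
    simpa using congrArg (fun T => T (y, a)) h7
  have key : (ebJ f (s • ξ, A)).comp ((ContinuousLinearMap.fst ℝ E ℝ).prod
      (s⁻¹ • ContinuousLinearMap.snd ℝ E ℝ)) = ((ContinuousLinearMap.fst ℝ E ℝ).prod
      (s • ContinuousLinearMap.snd ℝ E ℝ)).comp (ebM h (s, ξ, A)) := by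
    refine ContinuousLinearMap.ext fun p => ?_
    have h1 := hd (s⁻¹ • p.1) (s⁻¹ * p.2)
    have h2 : ((0:ℝ), s⁻¹ • p.1, s⁻¹ * p.2) = s⁻¹ • ((0:ℝ), p.1, p.2) :=
      Prod.ext (by simp) (Prod.ext rfl rfl)
    rw [smul_inv_smul₀ hs, h2, map_smul, smul_inv_smul₀ hs] at h1
    refine Prod.ext ?_ ?_
    · simpa [ebJ, ebM] using h1
    · simp [ebJ, ebM]
  have h1 := congrArg ContinuousLinearMap.det key
  simp only [ContinuousLinearMap.det, ContinuousLinearMap.toLinearMap_comp, LinearMap.det_comp] at h1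
  have e1 := eb_det_diag (E := E) s
  have e2 := eb_det_diag (E := E) s⁻¹
  simp only [ContinuousLinearMap.det] at e1 e2 ⊢
  rw [e1, e2] at h1
  field_simp at h1
  linarith
end
end

section
open Set Filter Topology MeasureTheory
section
variable {E : Type*} [NormedAddCommGroup E] [InnerProductSpace ℝ E] [FiniteDimensional ℝ E]

set_option maxHeartbeats 1000000 in
lemma eb_local (f : E × ℝ → E) (hf : ContDiff ℝ 2 f) (hf0 : ∀ A, f (0, A) = 0) (A₀ : ℝ)
    (v w : E) (hv : v ≠ 0) (hker : ∀ u, fderiv ℝ f (0, A₀) (u, 0) = 0 ↔ ∃ t : ℝ, u = t • v)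
    (hw : HasDerivAt (fun A => fderiv ℝ f (0, A) (v, 0)) w A₀)
    (hrange : ∀ u, fderiv ℝ f (0, A₀) (u, 0) ≠ w) (O : Set (E × ℝ)) (hO : IsOpen O)
    (hp0 : ((0 : E), A₀) ∈ O) :
    ∃ (δ : ℝ) (N0 S1 S2 : Set (E × ℝ)), IsOpen N0 ∧ ((0 : E), A₀) ∈ N0 ∧ N0 ⊆ O ∧
      IsPreconnected S1 ∧ IsPreconnected S2 ∧ (∀ z ∈ S1 ∪ S2, z ∈ O ∧ f z = 0 ∧ z.1 ≠ 0) ∧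
      ((0 : E), A₀) ∈ closure S1 ∧ ((0 : E), A₀) ∈ closure S2 ∧
      ∀ z ∈ N0, f z = 0 → z.1 ≠ 0 → z ∈ S1 ∪ S2 ∧ 0 < δ * (ebJ f z).det := by
  obtain ⟨h, hh, hfh, hh0⟩ := eb_h f hf hf0
  have hhc : Continuous h := hh.continuous
  set q0 : ℝ × E × ℝ := (0, v, A₀) with hq0
  -- derivative of `h` at `q0`
  have hhd : HasFDerivAt h (fderiv ℝ h q0) q0 := (hh.differentiable one_ne_zero _).hasFDerivAt
  have hd1 : ∀ u, fderiv ℝ h q0 (0, u, 0) = fderiv ℝ f (0, A₀) (u, 0) := by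
    intro u
    have h1 : HasDerivAt (fun t : ℝ => ((0:ℝ), v + t • u, A₀)) ((0:ℝ), u, (0:ℝ)) 0 := by
      refine (hasDerivAt_const _ _).prodMk (HasDerivAt.prodMk ?_ (hasDerivAt_const _ _))
      simpa using ((hasDerivAt_id (0:ℝ)).smul_const u).const_add v
    have h2 : HasFDerivAt h (fderiv ℝ h q0) ((0:ℝ), v + (0:ℝ) • u, A₀) := by simpa [hq0] using hhd
    have h3 := h2.comp_hasDerivAt (0:ℝ) h1
    have h4 : HasDerivAt (fun t : ℝ => fderiv ℝ f (0, A₀) (v + t • u, 0))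
        (fderiv ℝ f (0, A₀) (u, 0)) 0 := by
      have h5 : HasDerivAt (fun t : ℝ => (v + t • u, (0:ℝ))) (u, (0:ℝ)) 0 := by
        refine HasDerivAt.prodMk ?_ (hasDerivAt_const _ _)
        simpa using ((hasDerivAt_id (0:ℝ)).smul_const u).const_add v
      exact (fderiv ℝ f (0, A₀)).hasFDerivAt.comp_hasDerivAt (0:ℝ) h5
    refine h3.unique (h4.congr_of_eventuallyEq (Eventually.of_forall fun t => ?_))
    exact hh0 _ _
  have hd2 : fderiv ℝ h q0 (0, 0, 1) = w := by
    have h1 : HasDerivAt (fun t : ℝ => ((0:ℝ), v, t)) ((0:ℝ), (0:E), (1:ℝ)) A₀ :=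
      (hasDerivAt_const _ _).prodMk (HasDerivAt.prodMk (hasDerivAt_const _ _) (hasDerivAt_id _))
    have h3 := HasFDerivAt.comp_hasDerivAt A₀ hhd h1
    refine h3.unique (hw.congr_of_eventuallyEq (Eventually.of_forall fun t => ?_))
    exact hh0 _ _
  have hd3 : ∀ u a, fderiv ℝ h q0 (0, u, a) = fderiv ℝ f (0, A₀) (u, 0) + a • w := by
    intro u a
    have : ((0:ℝ), u, a) = (0, u, 0) + a • ((0:ℝ), (0:E), (1:ℝ)) := by simp
    rw [this, map_add, map_smul, hd1, hd2]
  have hvv : (0:ℝ) < inner ℝ v v := by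
    rw [real_inner_self_eq_norm_sq]; positivity
  have hinj : ∀ u a, fderiv ℝ h q0 (0, u, a) = 0 → inner ℝ v u = 0 → u = 0 ∧ a = 0 := by
    intro u a h1 h2
    rw [hd3] at h1
    have ha : a = 0 := by
      by_contra ha
      apply hrange (-a⁻¹ • u)
      have h3 : (-a⁻¹ • u, (0:ℝ)) = (-a⁻¹) • (u, (0:ℝ)) := by simp
      rw [h3, map_smul, eq_neg_of_add_eq_zero_left h1, smul_neg, neg_smul, neg_neg, inv_smul_smul₀ ha]
    subst ha
    rw [zero_smul, add_zero, hker] at h1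
    obtain ⟨t, rfl⟩ := h1
    rw [inner_smul_right, mul_eq_zero] at h2
    rcases h2 with h2 | h2
    · simp [h2]
    · exact absurd h2 hvv.ne'
  -- determinant
  set δ := (ebM h q0).det with hδ
  have hδ0 : δ ≠ 0 := by
    have : LinearMap.ker (ebM h q0).toLinearMap = ⊥ := by
      rw [LinearMap.ker_eq_bot']
      rintro ⟨u, a⟩ hua
      have h1 : fderiv ℝ h q0 (0, u, a) = 0 := by simpa [ebM] using congrArg Prod.fst hua
      have h2 : inner ℝ v u = 0 := by simpa [ebM] using congrArg Prod.snd hua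
      obtain ⟨rfl, rfl⟩ := hinj u a h1 h2
      rfl
    intro h0
    exact (LinearMap.bot_lt_ker_of_det_eq_zero h0).ne' this
  -- the map
  let l : E →L[ℝ] ℝ := (inner ℝ v v)⁻¹ • innerSL ℝ v
  have hl : ∀ x, l x = (inner ℝ v v)⁻¹ * inner ℝ v x := fun x => by simp [l]
  have hlv : l v = 1 := by rw [hl, inv_mul_cancel₀ hvv.ne']
  let Ψ : ℝ × E × ℝ → ℝ × E × ℝ := fun q => (q.1, h q, l q.2.1)
  have hΨ : ContDiff ℝ 1 Ψ := by
    refine contDiff_fst.prodMk (hh.prodMk ?_)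
    exact l.contDiff.comp (by fun_prop)
  let D : (ℝ × E × ℝ) →L[ℝ] (ℝ × E × ℝ) := (ContinuousLinearMap.fst ℝ ℝ (E × ℝ)).prod
    ((fderiv ℝ h q0).prod (l.comp ((ContinuousLinearMap.fst ℝ E ℝ).comp
      (ContinuousLinearMap.snd ℝ ℝ (E × ℝ)))))
  have hΨD : HasStrictFDerivAt Ψ D q0 := by
    have h1 : HasFDerivAt Ψ D q0 :=
      hasFDerivAt_fst.prodMk (hhd.prodMk
        (l.hasFDerivAt.comp q0 (hasFDerivAt_fst.comp q0 hasFDerivAt_snd)))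
    exact hΨ.contDiffAt.hasStrictFDerivAt' h1 one_ne_zero
  have hDinj : Function.Injective D.toLinearMap := by
    rw [← LinearMap.ker_eq_bot, LinearMap.ker_eq_bot']
    rintro ⟨s, u, a⟩ hs
    have h0 : s = 0 := by simpa [D] using congrArg Prod.fst hs
    subst h0
    have h1 : fderiv ℝ h q0 (0, u, a) = 0 := by simpa [D] using congrArg (fun p => p.2.1) hs
    have h2 : l u = 0 := by simpa [D] using congrArg (fun p => p.2.2) hs
    rw [hl, mul_eq_zero] at h2
    obtain ⟨rfl, rfl⟩ := hinj u a h1 (h2.resolve_left (inv_ne_zero hvv.ne'))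
    rfl
  let De : (ℝ × E × ℝ) ≃L[ℝ] (ℝ × E × ℝ) :=
    (LinearEquiv.ofInjectiveEndo D.toLinearMap hDinj).toContinuousLinearEquiv
  have hDe : (De : (ℝ × E × ℝ) →L[ℝ] (ℝ × E × ℝ)) = D := by
    refine ContinuousLinearMap.ext fun x => ?_
    rfl
  rw [← hDe] at hΨD
  let Φ := hΨD.toOpenPartialHomeomorph Ψ
  have hΦ : ∀ q, Φ q = Ψ q := fun q => rfl
  have hq0s : q0 ∈ Φ.source := hΨD.mem_toOpenPartialHomeomorph_source
  have hh0q : h q0 = 0 := by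
    rw [hq0, hh0, hker]
    exact ⟨1, by simp⟩
  have hΨq0 : Ψ q0 = (0, 0, 1) := by
    simp only [Ψ, hh0q]
    simp [hq0, hlv]
  let γ : ℝ → ℝ × E × ℝ := fun s => Φ.symm (s, 0, 1)
  have hγ0 : γ 0 = q0 := by
    simp only [γ]
    rw [← hΨq0, ← hΦ]
    exact Φ.left_inv hq0s
  have h0t : ((0:ℝ), (0:E), (1:ℝ)) ∈ Φ.target := by
    rw [← hΨq0, ← hΦ]; exact Φ.map_source hq0s
  have hcs : Continuous fun s : ℝ => (s, (0:E), (1:ℝ)) := by fun_prop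
  have hγc : ∀ s, (s, (0:E), (1:ℝ)) ∈ Φ.target → ContinuousAt γ s := by
    intro s hs
    exact ContinuousAt.comp (f := fun s : ℝ => (s, (0:E), (1:ℝ))) (Φ.symm.continuousAt hs) hcs.continuousAt
  let ψ : ℝ × E × ℝ → E × ℝ := fun q => (q.1 • q.2.1, q.2.2)
  have hψ : Continuous ψ := by fun_prop
  have hψ0 : ψ q0 = (0, A₀) := by simp [ψ, hq0]
  have ev1 : ∀ᶠ q in 𝓝 q0, ψ q ∈ O :=
    hψ.continuousAt.eventually (by rw [hψ0]; exact hO.mem_nhds hp0)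
  have ev2 : ∀ᶠ s in 𝓝 (0:ℝ), (s, (0:E), (1:ℝ)) ∈ Φ.target ∧ ψ (γ s) ∈ O := by
    refine (hcs.continuousAt.eventually (Φ.open_target.mem_nhds h0t)).and ?_
    have := hγc 0 h0t
    rw [ContinuousAt, hγ0] at this
    exact this.eventually ev1
  obtain ⟨ε, hε, hεb⟩ := Metric.eventually_nhds_iff_ball.1 ev2
  have hεb' : ∀ s, |s| < ε → (s, (0:E), (1:ℝ)) ∈ Φ.target ∧ ψ (γ s) ∈ O := fun s hs =>
    hεb s (by simpa using hs)
  have hγΨ : ∀ s, |s| < ε → (γ s).1 = s ∧ h (γ s) = 0 ∧ l (γ s).2.1 = 1 := by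
    intro s hs
    have := Φ.right_inv (hεb' s hs).1
    rw [hΦ] at this
    exact ⟨congrArg Prod.fst this, congrArg (fun p => p.2.1) this, congrArg (fun p => p.2.2) this⟩
  have hgood : ∀ s, |s| < ε → s ≠ 0 → ψ (γ s) ∈ O ∧ f (ψ (γ s)) = 0 ∧ (ψ (γ s)).1 ≠ 0 := by
    intro s hs hs0
    obtain ⟨h1, h2, h3⟩ := hγΨ s hs
    refine ⟨(hεb' s hs).2, ?_, ?_⟩
    · simp only [ψ]
      rw [hfh]
      change (γ s).1 • h (γ s) = 0
      rw [h2, smul_zero]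
    · intro h4
      simp only [ψ] at h4
      have := congrArg l h4
      rw [map_smul, h3, h1] at this
      simp at this
      exact hs0 this
  have hpre : ∀ I : Set ℝ, I ⊆ Ioo (-ε) ε → IsPreconnected I → IsPreconnected ((ψ ∘ γ) '' I) := by
    intro I hI hIc
    refine hIc.image _ fun s hs => ?_
    have := hI hs
    have := hγc s (hεb' s (abs_lt.2 this)).1
    exact (hψ.continuousAt.comp this).continuousWithinAt
  have hclo : ∀ I : Set ℝ, (0:ℝ) ∈ closure I → ((0:E), A₀) ∈ closure ((ψ ∘ γ) '' I) := by
    intro I hI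
    have h1 : ContinuousAt (ψ ∘ γ) 0 := hψ.continuousAt.comp (hγc 0 h0t)
    have h2 := h1.continuousWithinAt.mem_closure_image hI
    simpa [hγ0, hψ0] using h2
  -- local uniqueness
  have evP : ∀ᶠ q in 𝓝 q0, q ∈ Φ.source ∧ |q.1| < ε ∧ 0 < δ * (ebM h q).det := by
    refine Eventually.and (Φ.open_source.mem_nhds hq0s) (Eventually.and ?_ ?_)
    · have : Continuous fun q : ℝ × E × ℝ => |q.1| := by fun_prop
      exact this.continuousAt.eventually (gt_mem_nhds (by simpa [hq0] using hε))
    · have : Continuous fun q : ℝ × E × ℝ => δ * (ebM h q).det := continuous_const.mul (ebM_cont h hh)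
      exact this.continuousAt.eventually (lt_mem_nhds
        (show 0 < δ * δ from mul_self_pos.2 hδ0))
  have evR : ∀ᶠ rA in 𝓝 ((0:ℝ), A₀), ∀ θ ∈ Metric.sphere (0:E) 1, h (rA.1, θ, rA.2) = 0 →
      l θ ≠ 0 ∧ (fun q => q ∈ Φ.source ∧ |q.1| < ε ∧ 0 < δ * (ebM h q).det)
        ((rA.1 * l θ, (l θ)⁻¹ • θ, rA.2) : ℝ × E × ℝ) := by
    apply (isCompact_sphere (0:E) 1).eventually_forall_of_forall_eventually
    intro θ hθ
    by_cases hθ0 : h (0, θ, A₀) = 0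
    · rw [hh0, hker] at hθ0
      obtain ⟨t, rfl⟩ := hθ0
      have ht : t ≠ 0 := by
        rintro rfl
        simp at hθ
      have hlt : l (t • v) = t := by rw [map_smul, hlv]; simp
      have hc1 : Continuous fun z : (ℝ × ℝ) × E => l z.2 := by fun_prop
      have e1 : ∀ᶠ z in 𝓝 (((0:ℝ), A₀), t • v), l z.2 ≠ 0 :=
        hc1.continuousAt.eventually_ne (by rw [hlt]; exact ht)
      have hc2 : ContinuousAt (fun z : (ℝ × ℝ) × E =>
          ((z.1.1 * l z.2, (l z.2)⁻¹ • z.2, z.1.2) : ℝ × E × ℝ)) (((0:ℝ), A₀), t • v) := by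
        have h1 : ContinuousAt (fun z : (ℝ × ℝ) × E => (l z.2)⁻¹) (((0:ℝ), A₀), t • v) :=
          hc1.continuousAt.inv₀ (by rw [hlt]; exact ht)
        exact ContinuousAt.prodMk (by fun_prop) ((h1.smul (by fun_prop)).prodMk (by fun_prop))
      have hval : ((0 * l (t • v), (l (t • v))⁻¹ • t • v, A₀) : ℝ × E × ℝ) = q0 := by
        rw [hlt, inv_smul_smul₀ ht, zero_mul]
      have e2 := (show Tendsto _ _ _ from hc2).eventually
        (show ∀ᶠ q in 𝓝 ((0 * l (t • v), (l (t • v))⁻¹ • t • v, A₀) : ℝ × E × ℝ),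
          q ∈ Φ.source ∧ |q.1| < ε ∧ 0 < δ * (ebM h q).det by rw [hval]; exact evP)
      filter_upwards [e1, e2] with z hz1 hz2 _
      exact ⟨hz1, hz2⟩
    · have hc : Continuous fun z : (ℝ × ℝ) × E => h (z.1.1, z.2, z.1.2) := by fun_prop
      filter_upwards [hc.continuousAt.eventually_ne hθ0] with z hz hz0
      exact absurd hz0 hz
  have hnc : Continuous fun z : E × ℝ => (‖z.1‖, z.2) := by fun_prop
  have evR' : ∀ᶠ z in 𝓝 ((0:E), A₀), ∀ θ ∈ Metric.sphere (0:E) 1, h (‖z.1‖, θ, z.2) = 0 →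
      l θ ≠ 0 ∧ (fun q => q ∈ Φ.source ∧ |q.1| < ε ∧ 0 < δ * (ebM h q).det)
        ((‖z.1‖ * l θ, (l θ)⁻¹ • θ, z.2) : ℝ × E × ℝ) :=
    Tendsto.eventually (f := fun z : E × ℝ => (‖z.1‖, z.2)) (l₂ := 𝓝 ((0:ℝ), A₀))
      (by simpa using hnc.tendsto ((0:E), A₀)) evR
  obtain ⟨N0, hN0, hN0o, hN0p⟩ := eventually_nhds_iff.1 (evR'.and (show ∀ᶠ z in 𝓝 ((0:E), A₀), z ∈ O from hO.mem_nhds hp0))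
  refine ⟨δ, N0, (ψ ∘ γ) '' Ioo 0 ε, (ψ ∘ γ) '' Ioo (-ε) 0, hN0o, hN0p, fun z hz => (hN0 z hz).2,
    hpre _ (Ioo_subset_Ioo (by linarith) le_rfl) isPreconnected_Ioo,
    hpre _ (Ioo_subset_Ioo le_rfl hε.le) isPreconnected_Ioo, ?_,
    hclo _ (by rw [closure_Ioo hε.ne]; exact ⟨le_rfl, hε.le⟩),
    hclo _ (by rw [closure_Ioo (by linarith)]; exact ⟨by linarith, le_rfl⟩), ?_⟩
  · rintro _ (⟨s, hs, rfl⟩ | ⟨s, hs, rfl⟩)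
    · exact hgood s (abs_lt.2 ⟨by linarith [hs.1], hs.2⟩) hs.1.ne'
    · exact hgood s (abs_lt.2 ⟨hs.1, by linarith [hs.2]⟩) hs.2.ne
  · intro z hz hzf hz1
    have hr : ‖z.1‖ ≠ 0 := norm_ne_zero_iff.2 hz1
    set θ := ‖z.1‖⁻¹ • z.1 with hθ
    have hθs : ‖z.1‖ • θ = z.1 := smul_inv_smul₀ hr _
    have h1 : h (‖z.1‖, θ, z.2) = 0 := by
      have := hfh ‖z.1‖ θ z.2
      rw [hθs] at this
      exact (smul_eq_zero.1 (this.symm.trans hzf)).resolve_left hr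
    obtain ⟨h2, h3, h4, h5⟩ := (hN0 z hz).1 θ (by simp [hθ, norm_smul, hr]) h1
    set s := ‖z.1‖ * l θ with hs
    have hs0 : s ≠ 0 := mul_ne_zero hr h2
    set ξ := (l θ)⁻¹ • θ with hξ
    have hsξ : s • ξ = z.1 := by
      rw [hs, hξ, mul_smul, smul_inv_smul₀ h2, hθs]
    have h6 : h (s, ξ, z.2) = 0 := by
      have := hfh s ξ z.2
      rw [hsξ] at this
      exact (smul_eq_zero.1 (this.symm.trans hzf)).resolve_left hs0
    have h7 : l ξ = 1 := by rw [hξ, map_smul, smul_eq_mul, inv_mul_cancel₀ h2]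
    have h8 : γ s = (s, ξ, z.2) := by
      have := Φ.left_inv h3
      rw [hΦ] at this
      simp only [Ψ, h6, h7] at this
      exact this
    have h9 : (ψ ∘ γ) s = z := by
      simp only [Function.comp, h8, ψ, hsξ]
    constructor
    · simp only at h4
      rw [abs_lt] at h4
      rcases lt_or_gt_of_ne hs0 with h | h
      · exact Or.inr ⟨s, ⟨h4.1, h⟩, h9⟩
      · exact Or.inl ⟨s, ⟨h, h4.2⟩, h9⟩
    · have h10 := ebM_det f hf h hh hfh s hs0 ξ z.2
      rw [hsξ] at h10
      change (ebJ f z).det = _ at h10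
      rw [h10]
      have : 0 < s ^ 2 := by positivity
      calc 0 < s ^ 2 * (δ * (ebM h (s, ξ, z.2)).det) := by positivity
        _ = _ := by ring
end
end

section
open Set Filter Topology MeasureTheory
section
variable {E : Type*} [NormedAddCommGroup E] [InnerProductSpace ℝ E] [FiniteDimensional ℝ E]

theorem eb_core (V : Set (E × ℝ)) (hV : IsOpen V) (f : E × ℝ → E) (hf : ContDiffOn ℝ 2 f V)
    (hf0 : ∀ A, f (0, A) = 0) (A₀ : ℝ) (hp0 : ((0 : E), A₀) ∈ V)
    (v w : E) (hv : v ≠ 0) (hker : ∀ u, fderiv ℝ f (0, A₀) (u, 0) = 0 ↔ ∃ t : ℝ, u = t • v)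
    (hw : HasDerivAt (fun A => fderiv ℝ f (0, A) (v, 0)) w A₀)
    (hrange : ∀ u, fderiv ℝ f (0, A₀) (u, 0) ≠ w) :
    ∃ C : Set (E × ℝ), IsConnected C ∧ (∀ z ∈ C, z ∈ V ∧ f z = 0 ∧ z.1 ≠ 0) ∧
      ((0 : E), A₀) ∈ closure C ∧
      (¬ Bornology.IsBounded C ∨ (∃ p ∈ closure C, p ∉ V) ∨
        ∃ A₁, A₁ ≠ A₀ ∧ ((0 : E), A₁) ∈ closure C) := by
  obtain ⟨f', hf', -, hff, hf'0⟩ := eb_cutoff V {((0 : E), A₀)} hV isCompact_singleton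
    (singleton_subset_iff.2 hp0) 2 f hf
  rw [nhdsSet_singleton] at hff
  obtain ⟨O, hO, hOo, hOp⟩ := eventually_nhds_iff.1
    (hff.and (show ∀ᶠ z in 𝓝 ((0:E), A₀), z ∈ V from hV.mem_nhds hp0))
  have hO' : ∀ z ∈ O, f' =ᶠ[𝓝 z] f := fun z hz => by
    filter_upwards [hOo.mem_nhds hz] with y hy using (hO y hy).1
  have hfd : ∀ z ∈ O, fderiv ℝ f' z = fderiv ℝ f z := fun z hz => (hO' z hz).fderiv_eq
  have hc : Continuous fun A : ℝ => ((0:E), A) := by fun_prop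
  obtain ⟨δ, N0, S1, S2, hN0, hpN, hNO, hS1, hS2, hS, hc1, hc2, hu⟩ := eb_local f' hf'
    (fun A => hf'0 _ (hf0 A)) A₀ v w hv (by rw [hfd _ hOp]; exact hker)
    (hw.congr_of_eventuallyEq (by
      filter_upwards [hc.continuousAt.eventually (hOo.mem_nhds hOp)] with A hA
      rw [hfd _ hA])) (by rw [hfd _ hOp]; exact hrange) O hOo hOp
  let S : Set (E × ℝ) := {z | z ∈ V ∧ f z = 0 ∧ z.1 ≠ 0}
  have hSS : S1 ∪ S2 ⊆ S := by
    intro z hz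
    obtain ⟨h1, h2, h3⟩ := hS z hz
    exact ⟨(hO z h1).2, (hO z h1).1 ▸ h2, h3⟩
  obtain ⟨C, h1, h2, h3⟩ := eb_global V hV f (hf.of_le (by norm_num)) A₀ N0 hN0 hpN δ S S1 S2
    (fun z => Iff.rfl) hS1 hS2 (subset_union_left.trans hSS) (subset_union_right.trans hSS) hc1 hc2
    (fun z hz => (hu z hz.2 ((hO z (hNO hz.2)).1.trans hz.1.2.1) hz.1.2.2).1)
    (fun z hz => by
      have := (hu z hz.2 ((hO z (hNO hz.2)).1.trans hz.1.2.1) hz.1.2.2).2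
      rwa [ebJ, hfd z (hNO hz.2)] at this)
  exact ⟨C, h1, h2, h3⟩

lemma eb_split {X : Type*} [NormedAddCommGroup X] [NormedSpace ℝ X] [FiniteDimensional ℝ X]
    (Q : X →L[ℝ] X) (hQ : ∀ x, Q (Q x) = Q x) :
    ∃ (m : ℕ) (i : EuclideanSpace ℝ (Fin m) →L[ℝ] X) (p : X →L[ℝ] EuclideanSpace ℝ (Fin m)),
      (∀ x, i (p x) = Q x) ∧ ∀ x, p (i x) = x := by
  let R : Submodule ℝ X := LinearMap.range Q.toLinearMap
  let e : EuclideanSpace ℝ (Fin (Module.finrank ℝ R)) ≃L[ℝ] R :=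
    ContinuousLinearEquiv.ofFinrankEq (by simp)
  let Q' : X →L[ℝ] R := Q.codRestrict R (fun x => ⟨x, rfl⟩)
  refine ⟨_, R.subtypeL.comp e.toContinuousLinearMap, e.symm.toContinuousLinearMap.comp Q', ?_, ?_⟩
  · intro x
    simp only [Q', ContinuousLinearMap.comp_apply, ContinuousLinearEquiv.coe_coe,
      ContinuousLinearEquiv.apply_symm_apply]
    rfl
  · intro x
    have : Q' (e x) = e x := by
      ext
      obtain ⟨y, hy⟩ := (e x).2
      change Q (e x : X) = (e x : X)
      rw [← hy]
      exact hQ y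
    simp [this]
end

open Matrix in
lemma eb_proj {n : ℕ} (G : Finset (Matrix (Fin n) (Fin n) ℝ))
    (hG1 : (1 : Matrix (Fin n) (Fin n) ℝ) ∈ G)
    (hGmul : ∀ P ∈ G, ∀ Q ∈ G, P * Q ∈ G)
    (hGinv : ∀ P ∈ G, ∃ Q ∈ G, P * Q = 1) (v : Fin n → ℝ)
    (H : Finset (Matrix (Fin n) (Fin n) ℝ))
    (hH : ∀ P, P ∈ H ↔ P ∈ G ∧ Matrix.mulVec P v = v)
    (PH : Matrix (Fin n) (Fin n) ℝ)
    (hPH : PH = (H.card : ℝ)⁻¹ • ∑ P ∈ H, P) : PH * PH = PH ∧ PH *ᵥ v = v := by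
  have hc : (H.card : ℝ) ≠ 0 := by
    have : (1 : Matrix (Fin n) (Fin n) ℝ) ∈ H := (hH 1).2 ⟨hG1, by simp⟩
    exact_mod_cast (Finset.card_pos.2 ⟨_, this⟩).ne'
  have hsum : ∀ P ∈ H, P * ∑ Q ∈ H, Q = ∑ Q ∈ H, Q := by
    intro P hP
    obtain ⟨hPG, hPv⟩ := (hH P).1 hP
    obtain ⟨R, hRG, hPR⟩ := hGinv P hPG
    have hRP : R * P = 1 := mul_eq_one_comm.1 hPR
    have hRv : R *ᵥ v = v := by
      conv_lhs => rw [← hPv]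
      rw [Matrix.mulVec_mulVec, hRP, Matrix.one_mulVec]
    rw [Finset.mul_sum]
    refine Finset.sum_bij' (fun Q _ => P * Q) (fun Q _ => R * Q) ?_ ?_ ?_ ?_ ?_
    · intro Q hQ
      obtain ⟨h1, h2⟩ := (hH Q).1 hQ
      exact (hH _).2 ⟨hGmul _ hPG _ h1, by rw [← Matrix.mulVec_mulVec, h2, hPv]⟩
    · intro Q hQ
      obtain ⟨h1, h2⟩ := (hH Q).1 hQ
      exact (hH _).2 ⟨hGmul _ hRG _ h1, by rw [← Matrix.mulVec_mulVec, h2, hRv]⟩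
    · intro Q hQ
      rw [← mul_assoc, hRP, one_mul]
    · intro Q hQ
      rw [← mul_assoc, hPR, one_mul]
    · intro Q hQ; rfl
  constructor
  · rw [hPH, smul_mul_smul_comm, Finset.sum_mul, Finset.sum_congr rfl hsum, Finset.sum_const,
      ← Nat.cast_smul_eq_nsmul ℝ, smul_smul]
    congr 1
    field_simp
  · rw [hPH, Matrix.smul_mulVec, Matrix.sum_mulVec, Finset.sum_congr rfl
      (fun P hP => ((hH P).1 hP).2), Finset.sum_const, ← Nat.cast_smul_eq_nsmul ℝ, smul_smul,
      inv_mul_cancel₀ hc, one_smul]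
end

/-- **Equivariant Bifurcation Theorem.** Let `F : U × ℝ → ℝⁿ` be `C²` and
equivariant under a finite group `G` of invertible matrices, with trivial branch
`g`. If `v` spans the kernel of the reduced linearization `L_H(A₀)` on the
fixed-point space of its isotropy subgroup `H`, and the transversality condition
`L_H'(A₀)v ∉ range L_H(A₀)|_{ℝⁿ_H}` holds, then a connected set of nontrivial
solutions of the `H`-reduced problem bifurcates from `(g(A₀), A₀)`, and it is
unbounded, meets `∂U`, or meets the trivial branch at some `A⋆ ≠ A₀`. -/
theorem stmt_10 (n : ℕ)
    (U : Set (Fin n → ℝ)) (hU : IsOpen U)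
    (F : (Fin n → ℝ) → ℝ → (Fin n → ℝ))
    (hF : ContDiffOn ℝ 2 (fun p : (Fin n → ℝ) × ℝ => F p.1 p.2) (U ×ˢ (Set.univ : Set ℝ)))
    (G : Finset (Matrix (Fin n) (Fin n) ℝ))
    (hGunit : ∀ P ∈ G, IsUnit P)
    (hG1 : (1 : Matrix (Fin n) (Fin n) ℝ) ∈ G)
    (hGmul : ∀ P ∈ G, ∀ Q ∈ G, P * Q ∈ G)
    (hGinv : ∀ P ∈ G, ∃ Q ∈ G, P * Q = 1)
    (hequiv : ∀ P ∈ G, ∀ x ∈ U, ∀ A : ℝ, F (Matrix.mulVec P x) A = Matrix.mulVec P (F x A))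
    (g : ℝ → Fin n → ℝ) (hg : ContDiff ℝ (⊤ : ℕ∞) g)
    (hgU : ∀ A : ℝ, g A ∈ U) (hgF : ∀ A : ℝ, F (g A) A = 0)
    (L : ℝ → (Fin n → ℝ) →L[ℝ] (Fin n → ℝ))
    (hL : ∀ A : ℝ, ⇑(L A) = ⇑(fderiv ℝ (fun x => F x A) (g A)))
    (A₀ : ℝ) (v : Fin n → ℝ) (hvne : v ≠ 0) (hv0 : L A₀ v = 0)
    (H : Finset (Matrix (Fin n) (Fin n) ℝ))
    (hH : ∀ P, P ∈ H ↔ P ∈ G ∧ Matrix.mulVec P v = v)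
    (PH : Matrix (Fin n) (Fin n) ℝ)
    (hPH : PH = (H.card : ℝ)⁻¹ • ∑ P ∈ H, P)
    (LH : ℝ → (Fin n → ℝ) → (Fin n → ℝ))
    (hLH : ∀ A u, LH A u = Matrix.mulVec PH (L A (Matrix.mulVec PH u)))
    (hgH : ∀ A : ℝ, Matrix.mulVec PH (g A) = g A)
    (hker : {u : Fin n → ℝ | Matrix.mulVec PH u = u ∧ LH A₀ u = 0} =
      {u : Fin n → ℝ | ∃ t : ℝ, u = t • v})
    (w : Fin n → ℝ) (hw : w = deriv (fun A => LH A v) A₀)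
    (hrange : ¬ ∃ u : Fin n → ℝ, Matrix.mulVec PH u = u ∧ LH A₀ u = w) :
    ∃ C : Set ((Fin n → ℝ) × ℝ),
      IsConnected C ∧
      (∀ p ∈ C, p.1 ∈ U ∧ Matrix.mulVec PH p.1 = p.1 ∧
        Matrix.mulVec PH (F p.1 p.2) = 0 ∧ p.1 ≠ g p.2) ∧
      (g A₀, A₀) ∈ closure C ∧
      (¬ Bornology.IsBounded C ∨
        (closure C ∩ (frontier U) ×ˢ (Set.univ : Set ℝ)).Nonempty ∨
        ∃ A₁ : ℝ, A₁ ≠ A₀ ∧ (g A₁, A₁) ∈ closure C) := by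
  obtain ⟨hPP, hPv⟩ := eb_proj G hG1 hGmul hGinv v H hH PH hPH
  obtain ⟨Q, hQ⟩ : ∃ Q : (Fin n → ℝ) →L[ℝ] (Fin n → ℝ), ∀ x, Q x = Matrix.mulVec PH x :=
    ⟨LinearMap.toContinuousLinearMap (Matrix.mulVecLin PH), fun x => rfl⟩
  have hQQ : ∀ x, Q (Q x) = Q x := fun x => by
    rw [hQ, hQ, Matrix.mulVec_mulVec, hPP]
  obtain ⟨m, i, p, hip, hpi⟩ := eb_split Q hQQ
  have hQi : ∀ x, Q (i x) = i x := fun x => by rw [← hip, hpi]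
  have hiinj : Function.Injective i := Function.LeftInverse.injective hpi
  have hp0 : ∀ y, p y = 0 ↔ Q y = 0 := by
    intro y
    rw [← hip]
    exact ⟨fun h => by rw [h, map_zero], fun h => hiinj (by rw [h, map_zero])⟩
  have hgc : Continuous g := hg.continuous
  let Θ : EuclideanSpace ℝ (Fin m) × ℝ → (Fin n → ℝ) × ℝ := fun z => (g z.2 + i z.1, z.2)
  have hΘ : Continuous Θ := by fun_prop
  let V : Set (EuclideanSpace ℝ (Fin m) × ℝ) := {z | g z.2 + i z.1 ∈ U}
  have hV : IsOpen V := hU.preimage (by fun_prop : Continuous fun z : EuclideanSpace ℝ (Fin m) × ℝ =>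
    g z.2 + i z.1)
  have hV0 : ∀ A, ((0 : EuclideanSpace ℝ (Fin m)), A) ∈ V := by
    intro A
    change g A + i 0 ∈ U
    rw [map_zero, add_zero]
    exact hgU A
  let f : EuclideanSpace ℝ (Fin m) × ℝ → EuclideanSpace ℝ (Fin m) := fun z =>
    p (F (g z.2 + i z.1) z.2)
  have hΘC : ContDiff ℝ 2 Θ := by
    have hg2 : ContDiff ℝ 2 g := contDiff_infty.1 hg 2
    fun_prop
  have hf : ContDiffOn ℝ 2 f V :=
    p.contDiff.comp_contDiffOn (hF.comp hΘC.contDiffOn (fun z hz => ⟨hz, Set.mem_univ _⟩))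
  have hf0 : ∀ A, f (0, A) = 0 := by
    intro A
    simp only [f, map_zero, add_zero, hgF]
  have hfd : ∀ A u, fderiv ℝ f (0, A) (u, 0) = p (L A (i u)) := by
    intro A u
    have h1 : HasFDerivAt f (fderiv ℝ f (0, A)) (0, A) :=
      ((hf.contDiffAt (hV.mem_nhds (hV0 A))).differentiableAt two_ne_zero).hasFDerivAt
    have h2 := h1.comp (0 : EuclideanSpace ℝ (Fin m)) 
      (hasFDerivAt_prodMk_left (𝕜 := ℝ) (0 : EuclideanSpace ℝ (Fin m)) A)
    have h3 : DifferentiableAt ℝ (fun x => F x A) (g A) := by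
      have h4 : DifferentiableAt ℝ (fun p : (Fin n → ℝ) × ℝ => F p.1 p.2) (g A, A) :=
        (hF.contDiffAt ((hU.prod isOpen_univ).mem_nhds ⟨hgU A, Set.mem_univ _⟩)).differentiableAt
          two_ne_zero
      exact h4.comp (g A) (hasFDerivAt_prodMk_left (𝕜 := ℝ) (g A) A).differentiableAt
    have h5 : HasFDerivAt (fun x : EuclideanSpace ℝ (Fin m) => g A + i x) i 0 :=
      i.hasFDerivAt.const_add (g A)
    have h6 : HasFDerivAt (fun x => F x A) (fderiv ℝ (fun x => F x A) (g A)) (g A + i 0) := by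
      simpa using h3.hasFDerivAt
    have h7 := p.hasFDerivAt.comp (0 : EuclideanSpace ℝ (Fin m)) (h6.comp 0 h5)
    have h8 := congrArg (fun T => T u) (h2.unique h7)
    simp only [ContinuousLinearMap.comp_apply, ContinuousLinearMap.inl_apply] at h8
    rw [h8, hL]
  have hiLH : ∀ A u, i (fderiv ℝ f (0, A) (u, 0)) = LH A (i u) := by
    intro A u
    rw [hfd, hip, hLH, ← hQ, ← hQ, hQi]
  have hipv : i (p v) = v := by rw [hip, hQ, hPv]
  obtain ⟨w', hw'⟩ : ∃ w', HasDerivAt (fun A => fderiv ℝ f (0, A) (p v, 0)) w' A₀ := by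
    have h1 : DifferentiableAt ℝ (fderiv ℝ f) (0, A₀) :=
      ((hf.contDiffAt (hV.mem_nhds (hV0 A₀))).fderiv_right (m := 1) (by norm_num)).differentiableAt
        one_ne_zero
    have h2 : DifferentiableAt ℝ (fun A : ℝ => fderiv ℝ f (0, A)) A₀ :=
      h1.comp A₀ (hasFDerivAt_prodMk_right (𝕜 := ℝ) (0 : EuclideanSpace ℝ (Fin m)) A₀).differentiableAt
    exact ⟨_, (h2.clm_apply (differentiableAt_const _)).hasDerivAt⟩
  have hww' : w = i w' := by
    have h1 := i.hasFDerivAt.comp_hasDerivAt A₀ hw'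
    have h2 : (i ∘ fun A => fderiv ℝ f (0, A) (p v, 0)) = fun A => LH A v := by
      funext A
      simp only [Function.comp]
      rw [hiLH, hipv]
    rw [h2] at h1
    rw [hw, h1.deriv]
  have hpv0 : p v ≠ 0 := by
    intro h
    rw [h, map_zero] at hipv
    exact hvne hipv.symm
  obtain ⟨C, hC, hCs, hCc, hC3⟩ := eb_core V hV f hf hf0 A₀ (hV0 A₀) (p v) w' hpv0
    (by
      intro u
      have h1 : fderiv ℝ f (0, A₀) (u, 0) = 0 ↔ LH A₀ (i u) = 0 := by
        rw [← hiLH]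
        exact ⟨fun h => by rw [h, map_zero], fun h => hiinj (by rw [h, map_zero])⟩
      have h2 : i u ∈ {u : Fin n → ℝ | Matrix.mulVec PH u = u ∧ LH A₀ u = 0} ↔
          i u ∈ {u : Fin n → ℝ | ∃ t : ℝ, u = t • v} := by rw [hker]
      have h3 : Matrix.mulVec PH (i u) = i u := by rw [← hQ, hQi]
      simp only [Set.mem_ofPred_eq, h3, true_and] at h2
      rw [h1, h2]
      refine exists_congr fun t => ⟨fun h => ?_, fun h => ?_⟩
      · rw [← hpi u, h, map_smul]
      · rw [h, map_smul, hipv])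
    hw'
    (by
      intro u hu
      apply hrange
      refine ⟨i u, by rw [← hQ, hQi], ?_⟩
      rw [← hiLH, hu, hww'])
  have hcl : ∀ z ∈ closure C, Θ z ∈ closure (Θ '' C) := fun z hz =>
    image_closure_subset_closure_image hΘ ⟨z, hz, rfl⟩
  have hΘ0 : ∀ A, Θ (0, A) = (g A, A) := fun A => by simp [Θ]
  refine ⟨Θ '' C, hC.image _ hΘ.continuousOn, ?_, ?_, ?_⟩
  · rintro _ ⟨z, hz, rfl⟩
    obtain ⟨h1, h2, h3⟩ := hCs z hz
    refine ⟨h1, ?_, ?_, ?_⟩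
    · simp only [Θ]
      rw [Matrix.mulVec_add, hgH, ← hQ (i z.1), hQi]
    · simp only [Θ]
      rw [← hQ]
      exact (hp0 _).1 h2
    · intro h
      simp only [Θ] at h
      have h4 : i z.1 = 0 := by simpa using h
      exact h3 (hiinj (by rw [h4, map_zero]))
  · rw [← hΘ0]; exact hcl _ hCc
  · rcases hC3 with h | ⟨z, hz, hzV⟩ | ⟨A₁, hA, hz⟩
    · left
      intro hb
      apply h
      let Ξ : (Fin n → ℝ) × ℝ → EuclideanSpace ℝ (Fin m) × ℝ := fun q => (p (q.1 - g q.2), q.2)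
      have hΞ : Continuous Ξ := by fun_prop
      have h1 : C ⊆ Ξ '' closure (Θ '' C) := by
        intro z hz
        refine ⟨Θ z, subset_closure ⟨z, hz, rfl⟩, ?_⟩
        simp [Ξ, Θ, hpi]
      exact (hb.isCompact_closure.image hΞ).isBounded.subset h1
    · right; left
      refine ⟨Θ z, hcl z hz, ?_, Set.mem_univ _⟩
      rw [hU.frontier_eq]
      refine ⟨?_, hzV⟩
      have h1 : (Prod.fst ∘ Θ) z ∈ closure ((Prod.fst ∘ Θ) '' C) :=
        image_closure_subset_closure_image (continuous_fst.comp hΘ) ⟨z, hz, rfl⟩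
      refine closure_mono ?_ h1
      rintro _ ⟨y, hy, rfl⟩
      exact (hCs y hy).1
    · right; right
      exact ⟨A₁, hA, by rw [← hΘ0]; exact hcl _ hz⟩
end

section
/- Let α, β ∈ ℝ, let H be the symmetric 6×6 matrix with all diagonal entries α, entries 0 in positions (1,4),(4,1),(2,5),(5,2),(3,6),(6,3), and all other off-diagonal entries β, and let M be the 6×5 matrix with rows (1,0,0,0,0),(0,1,0,0,0),(0,0,1,0,0),(−1,−1,−1,−1,−1),(0,0,0,1,0),(0,0,0,0,1). Then the eigenvalues of the 5×5 matrix U = Mᵗ H M are: α with multiplicity two, α − 2β, and (1/2)[7α − 6β ± √(16α² + 9(α−2β)²)]. -/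
open Polynomial

/-- The eigenvalues of `U = Mᵗ H M`, where `H` is the Hessian of the Lagrangian of
the four-particle problem at the regular tetrahedron and `M` parametrizes the
tangent space of the volume constraint, are `α` (multiplicity two), `α - 2β`, and
`(1/2)[7α - 6β ± √(16α² + 9(α-2β)²)]`. -/
theorem stmt_13 (α β : ℝ)
    (H : Matrix (Fin 6) (Fin 6) ℝ)
    (hH : H = !![α, β, β, 0, β, β;
                 β, α, β, β, 0, β;
                 β, β, α, β, β, 0;
                 0, β, β, α, β, β;
                 β, 0, β, β, α, β;
                 β, β, 0, β, β, α])
    (M : Matrix (Fin 6) (Fin 5) ℝ)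
    (hM : M = !![1, 0, 0, 0, 0;
                 0, 1, 0, 0, 0;
                 0, 0, 1, 0, 0;
                 -1, -1, -1, -1, -1;
                 0, 0, 0, 1, 0;
                 0, 0, 0, 0, 1]) :
    (M.transpose * H * M).charpoly =
      (X - C α) ^ 2 * (X - C (α - 2 * β)) *
      (X - C ((7 * α - 6 * β + Real.sqrt (16 * α ^ 2 + 9 * (α - 2 * β) ^ 2)) / 2)) *
      (X - C ((7 * α - 6 * β - Real.sqrt (16 * α ^ 2 + 9 * (α - 2 * β) ^ 2)) / 2)) := by
  have hU : M.transpose * H * M =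
      !![2*α, α, α, α, α;
         α, 2*α-2*β, α-β, α-2*β, α-β;
         α, α-β, 2*α-2*β, α-β, α-2*β;
         α, α-2*β, α-β, 2*α-2*β, α-β;
         α, α-β, α-2*β, α-β, 2*α-2*β] := by
    subst hH hM
    ext i j
    fin_cases i <;> fin_cases j <;>
      simp [Matrix.mul_apply, Fin.sum_univ_succ] <;> ring
  rw [hU]
  have hs : Real.sqrt (16 * α ^ 2 + 9 * (α - 2 * β) ^ 2) ^ 2
      = 16 * α ^ 2 + 9 * (α - 2 * β) ^ 2 := Real.sq_sqrt (by positivity)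
  generalize Real.sqrt (16 * α ^ 2 + 9 * (α - 2 * β) ^ 2) = s at hs ⊢
  apply Polynomial.funext
  intro x
  rw [Matrix.eval_charpoly]
  simp only [eval_mul, eval_pow, eval_sub, eval_X, eval_C]
  have hm : Matrix.scalar (Fin 5) x - !![2*α, α, α, α, α;
         α, 2*α-2*β, α-β, α-2*β, α-β;
         α, α-β, 2*α-2*β, α-β, α-2*β;
         α, α-2*β, α-β, 2*α-2*β, α-β;
         α, α-β, α-2*β, α-β, 2*α-2*β] =
      !![x-2*α, -α, -α, -α, -α;
         -α, x-(2*α-2*β), -(α-β), -(α-2*β), -(α-β);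
         -α, -(α-β), x-(2*α-2*β), -(α-β), -(α-2*β);
         -α, -(α-2*β), -(α-β), x-(2*α-2*β), -(α-β);
         -α, -(α-β), -(α-2*β), -(α-β), x-(2*α-2*β)] := by
    ext i j
    fin_cases i <;> fin_cases j <;> simp
  rw [hm]
  simp [Matrix.det_succ_row_zero, Fin.sum_univ_succ, Fin.succAbove]
  linear_combination (x - α) ^ 2 * (x - (α - 2 * β)) / 4 * hs
end

section
/- Let φ:(0,∞)→ℝ be C², define μ₁(V) = φ''(a_V) + (3/a_V)φ'(a_V) with a_V = (6√2 V)^{1/3}, and suppose μ₁(V₁) = 0 and μ₁'(V₁) ≠ 0 for some V₁ > 0. Then for every ε > 0 there exist V > 0, λ ∈ ℝ, and a solution of the first-order conditions g(a) = 288V², ∇E(a) + λ∇g(a) = 0 of the form a = (a, a, c, a, a, C) with (c, C) ≠ (a, a), satisfying |V − V₁| + |λ − λ_{V₁}| + max(|a − a_{V₁}|, |c − a_{V₁}|, |C − a_{V₁}|) < ε. -/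
/-- Cayley–Menger determinant of the edge data `(a,b,c,A,B,C)` of a tetrahedron,
where `a,b,c` are the edges from one vertex and `A,B,C` the opposite edges. -/
noncomputable def cayleyMenger (a b c A B C : ℝ) : ℝ :=
  Matrix.det !![0, a ^ 2, b ^ 2, c ^ 2, 1;
                a ^ 2, 0, C ^ 2, B ^ 2, 1;
                b ^ 2, C ^ 2, 0, A ^ 2, 1;
                c ^ 2, B ^ 2, A ^ 2, 0, 1;
                1, 1, 1, 1, 0]

/-- Total energy of the four-particle system. -/
noncomputable def tetE (φ : ℝ → ℝ) (x : Fin 6 → ℝ) : ℝ := ∑ i, φ (x i)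

/-- Volume constraint function of the four-particle system. -/
noncomputable def tetG (x : Fin 6 → ℝ) : ℝ :=
  cayleyMenger (x 0) (x 1) (x 2) (x 3) (x 4) (x 5)

/-- First-order (Lagrange) conditions for the tetrahedron problem:
`g(a) = 288V²` and `∇E(a) + λ∇g(a) = 0`. -/
noncomputable def tetFOC (φ : ℝ → ℝ) (V lam : ℝ) (x : Fin 6 → ℝ) : Prop :=
  tetG x = 288 * V ^ 2 ∧
  fderiv ℝ (tetE φ) x + lam • fderiv ℝ tetG x = 0

open Filter Topology


lemma ift_scalar (F : (ℝ × ℝ) × ℝ → ℝ) (x0 : ℝ × ℝ) (p0 d : ℝ)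
    (hF : ContDiffAt ℝ 1 F (x0, p0)) (hd : HasDerivAt (fun p => F (x0, p)) d p0)
    (hd0 : d ≠ 0) (h0 : F (x0, p0) = 0) :
    ∃ P : ℝ × ℝ → ℝ, P x0 = p0 ∧ (∀ᶠ x in 𝓝 x0, ContinuousAt P x) ∧
      (∀ᶠ x in 𝓝 x0, F (x, P x) = 0) ∧ ∀ᶠ v in 𝓝 (x0, p0), F v = 0 → P v.1 = v.2 := by
  have hfd : fderiv ℝ F (x0, p0) ∘L .inr ℝ (ℝ × ℝ) ℝ = d • ContinuousLinearMap.id ℝ ℝ := by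
    have h1 : HasFDerivAt F (fderiv ℝ F (x0, p0)) (x0, p0) :=
      (hF.differentiableAt (by norm_num)).hasFDerivAt
    have h2 := h1.comp p0 (hasFDerivAt_prodMk_right x0 p0)
    have h3 := h2.unique hd.hasFDerivAt
    rw [h3]; ext; simp
  have hinv : (fderiv ℝ F (x0, p0) ∘L .inr ℝ (ℝ × ℝ) ℝ).IsInvertible := by
    rw [hfd]
    refine ⟨ContinuousLinearEquiv.unitsEquivAut ℝ (Units.mk0 d hd0), ?_⟩
    ext; simp
  have hn : (1 : WithTop ℕ∞) ≠ 0 := by norm_num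
  refine ⟨hF.implicitFunction hn hinv, hF.implicitFunction_apply_self hn hinv, ?_, ?_, ?_⟩
  · have := (hF.contDiffAt_implicitFunction hn hinv).eventually (by simp)
    filter_upwards [this] with x hx using hx.continuousAt
  · filter_upwards [hF.eventually_apply_implicitFunction hn hinv] with x hx
    rw [hx, h0]
  · filter_upwards [hF.eventually_apply_eq_iff_implicitFunction hn hinv] with x hx h
    rw [← hx, h, h0]

lemma symm_quot (ψ : ℝ → ℝ) (ψ' a : ℝ) (h : HasStrictDerivAt ψ ψ' a) (P : ℝ → ℝ)
    (hP : Tendsto P (𝓝[>] 0) (𝓝 a)) :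
    Tendsto (fun s => (ψ (P s + s) - ψ (P s - s)) / (2 * s)) (𝓝[>] 0) (𝓝 ψ') := by
  have hs : Tendsto (fun s : ℝ => s) (𝓝[>] 0) (𝓝 0) := nhdsWithin_le_nhds
  have ht : Tendsto (fun s => (P s + s, P s - s)) (𝓝[>] 0) (𝓝 (a, a)) := by
    have h1 := hP.add hs
    have h2 := hP.sub hs
    simp only [add_zero, sub_zero] at h1 h2
    exact h1.prodMk_nhds h2
  have := (h.hasStrictFDerivAt.isLittleO.comp_tendsto ht).tendsto_div_nhds_zero
  have h3 := this.add_const ψ'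
  rw [zero_add] at h3
  refine h3.congr' ?_
  filter_upwards [self_mem_nhdsWithin] with s (hs : 0 < s)
  simp
  field_simp
  ring

lemma sign_change (m : ℝ → ℝ) (a k : ℝ) (h : HasDerivAt m k a) (h0 : m a = 0) (hk : k ≠ 0) :
    (∀ᶠ x in 𝓝[>] a, 0 < k * m x) ∧ (∀ᶠ x in 𝓝[<] a, k * m x < 0) := by
  have h1 := (hasDerivAt_iff_tendsto_slope.1 h).const_mul k
  have h2 := h1.eventually (lt_mem_nhds (mul_self_pos.2 hk))
  constructor
  · filter_upwards [h2.filter_mono (nhdsWithin_mono a (fun x (hx : a < x) => hx.ne')),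
      self_mem_nhdsWithin] with x hx (hx' : a < x)
    rw [slope_def_field, h0, sub_zero, ← mul_div_assoc] at hx
    exact (div_pos_iff_of_pos_right (sub_pos.2 hx')).1 hx
  · filter_upwards [h2.filter_mono (nhdsWithin_mono a (fun x (hx : x < a) => hx.ne)),
      self_mem_nhdsWithin] with x hx (hx' : x < a)
    rw [slope_def_field, h0, sub_zero, ← mul_div_assoc] at hx
    have := sub_neg.2 hx'
    by_contra hc
    push Not at hc
    exact absurd hx (not_lt.2 (div_nonpos_of_nonneg_of_nonpos hc this.le))

def RedEq (f : ℝ → ℝ) (a c C : ℝ) : Prop :=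
  a * c * f c = f a * (4 * a ^ 2 - 2 * c ^ 2 - C ^ 2) ∧
  a * C * f C = f a * (4 * a ^ 2 - c ^ 2 - 2 * C ^ 2)

lemma nondeg (f : ℝ → ℝ) (hf : ContDiffOn ℝ 1 f (Set.Ioi 0)) (a₁ k : ℝ) (ha : 0 < a₁)
    (hm : HasDerivAt (fun a => deriv f a + 3 / a * f a) k a₁) (hk : k ≠ 0)
    (h0 : deriv f a₁ + 3 / a₁ * f a₁ = 0) (hne : f a₁ ≠ 0)
    (S : Set (ℝ × ℝ × ℝ)) (hS : S ∈ 𝓝 (a₁, a₁, a₁)) :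
    ∃ a c C, (a, c, C) ∈ S ∧ RedEq f a c C ∧ (c, C) ≠ (a, a) := by
  have hfA : ∀ x, 0 < x → ContDiffAt ℝ 1 f x := fun x hx => hf.contDiffAt (Ioi_mem_nhds hx)
  set ψ : ℝ → ℝ := fun t => t * f t with hψ
  have hψA : ∀ x, 0 < x → ContDiffAt ℝ 1 ψ x := fun x hx => contDiffAt_id.mul (hfA x hx)
  have hψD : ∀ x, 0 < x → HasStrictDerivAt ψ (f x + x * deriv f x) x := by
    intro x hx
    have := (hasStrictDerivAt_id x).mul ((hfA x hx).hasStrictDerivAt (by norm_num))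
    exact this.congr_deriv (by simp)
  set F : (ℝ × ℝ) × ℝ → ℝ := fun v => v.1.1 ^ 2 * (ψ (v.2 + v.1.2) + ψ (v.2 - v.1.2)) -
    ψ v.1.1 * (8 * v.1.1 ^ 2 - 6 * v.2 ^ 2 - 6 * v.1.2 ^ 2) with hFdef
  have hF : ContDiffAt ℝ 1 F ((a₁, 0), a₁) := by
    have e1 : ContDiffAt ℝ 1 (fun v : (ℝ × ℝ) × ℝ => ψ (v.2 + v.1.2)) ((a₁, 0), a₁) :=
      ContDiffAt.comp (g := ψ) _ (by simpa using hψA a₁ ha) (by fun_prop)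
    have e2 : ContDiffAt ℝ 1 (fun v : (ℝ × ℝ) × ℝ => ψ (v.2 - v.1.2)) ((a₁, 0), a₁) :=
      ContDiffAt.comp (g := ψ) _ (by simpa using hψA a₁ ha) (by fun_prop)
    have e3 : ContDiffAt ℝ 1 (fun v : (ℝ × ℝ) × ℝ => ψ (v.1.1)) ((a₁, 0), a₁) :=
      ContDiffAt.comp (g := ψ) _ (by simpa using hψA a₁ ha) (by fun_prop)
    have e4 : ContDiffAt ℝ 1 (fun v : (ℝ × ℝ) × ℝ => v.1.1 ^ 2) ((a₁, 0), a₁) := by fun_prop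
    have e5 : ContDiffAt ℝ 1 (fun v : (ℝ × ℝ) × ℝ => 8 * v.1.1 ^ 2 - 6 * v.2 ^ 2 - 6 * v.1.2 ^ 2)
      ((a₁, 0), a₁) := by fun_prop
    exact (e4.mul (e1.add e2)).sub (e3.mul e5)
  have hd : HasDerivAt (fun p => F ((a₁, 0), p)) (8 * a₁ ^ 2 * f a₁) a₁ := by
    have h1 := (hψD a₁ ha).hasDerivAt
    have h2 := ((h1.add h1).const_mul (a₁ ^ 2)).sub
      ((((((hasDerivAt_id a₁).pow 2).const_mul 6).const_sub (8 * a₁ ^ 2))).const_mul (ψ a₁))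
    have e : (fun p => F ((a₁, 0), p)) = fun p => a₁ ^ 2 * (ψ p + ψ p) -
        ψ a₁ * (8 * a₁ ^ 2 - 6 * p ^ 2) := by
      funext p; simp [hFdef]
    rw [e]
    refine h2.congr_deriv ?_
    have : deriv f a₁ = - (3 / a₁ * f a₁) := by linarith
    simp only [hψ, this, id]
    field_simp
    ring
  obtain ⟨P, hP0, hPc, hPF, hPu⟩ := ift_scalar F (a₁, 0) a₁ _ hF hd (by positivity)
    (by simp [hFdef]; ring)
  have hPcont : ContinuousAt P (a₁, 0) := hPc.self_of_nhds
  -- trivial branch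
  have htriv : ∀ᶠ a in 𝓝 a₁, P (a, 0) = a := by
    have ht : Tendsto (fun a : ℝ => ((a, (0 : ℝ)), a)) (𝓝 a₁) (𝓝 ((a₁, 0), a₁)) :=
      Continuous.tendsto (by fun_prop) a₁
    filter_upwards [ht.eventually hPu] with a h
    apply h
    simp [hFdef]; ring
  have hev1 : ∀ᶠ x in 𝓝 (a₁, (0 : ℝ)), (x.1, P x + x.2, P x - x.2) ∈ S := by
    have : ContinuousAt (fun x : ℝ × ℝ => (x.1, P x + x.2, P x - x.2)) (a₁, 0) := by fun_prop
    apply this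
    simpa [hP0] using hS
  have hev2 : ∀ᶠ x in 𝓝 (a₁, (0 : ℝ)), 0 < P x + x.2 := by
    have : ContinuousAt (fun x : ℝ × ℝ => P x + x.2) (a₁, 0) := by fun_prop
    exact this.eventually (lt_mem_nhds (by simpa [hP0] using ha))
  have hev3 : ∀ᶠ x in 𝓝 (a₁, (0 : ℝ)), 0 < P x - x.2 := by
    have : ContinuousAt (fun x : ℝ × ℝ => P x - x.2) (a₁, 0) := by fun_prop
    exact this.eventually (lt_mem_nhds (by simpa [hP0] using ha))
  have hev4 : ∀ᶠ x in 𝓝 (a₁, (0 : ℝ)), 0 < x.1 := by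
    have : ContinuousAt (fun x : ℝ × ℝ => x.1) (a₁, 0) := by fun_prop
    exact this.eventually (lt_mem_nhds (by simpa using ha))
  obtain ⟨δ, hδ, hball⟩ := Metric.eventually_nhds_iff.1
    (hev1.and (hev2.and (hev3.and (hev4.and (hPc.and hPF)))))
  have hbox : ∀ a s : ℝ, |a - a₁| < δ → |s| < δ → dist (a, s) (a₁, (0 : ℝ)) < δ := by
    intro a s h1 h2
    simp [Prod.dist_eq, Real.dist_eq, h1, h2]
  obtain ⟨hr, hl⟩ := sign_change _ a₁ k hm h0 hk
  have hnear : ∀ᶠ a in 𝓝 a₁, |a - a₁| < δ := by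
    filter_upwards [Metric.ball_mem_nhds a₁ hδ] with a h using by simpa [Real.dist_eq] using h
  obtain ⟨ap, ⟨hap1, hap2, hap3⟩, (hap4 : a₁ < ap)⟩ := ((hr.and ((htriv.filter_mono nhdsWithin_le_nhds).and
    (hnear.filter_mono nhdsWithin_le_nhds))).and self_mem_nhdsWithin).exists
  obtain ⟨am, ⟨ham1, ham2, ham3⟩, (ham4 : am < a₁)⟩ := ((hl.and ((htriv.filter_mono nhdsWithin_le_nhds).and
    (hnear.filter_mono nhdsWithin_le_nhds))).and self_mem_nhdsWithin).exists
  set H : ℝ → ℝ → ℝ := fun s a => a ^ 2 * ((ψ (P (a, s) + s) - ψ (P (a, s) - s)) / (2 * s)) +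
    2 * ψ a * P (a, s) with hH
  have hlim : ∀ a, |a - a₁| < δ → P (a, 0) = a → Tendsto (fun s => k * H s a) (𝓝[>] 0)
      (𝓝 (a ^ 3 * (k * (deriv f a + 3 / a * f a)))) := by
    intro a h1 h2
    obtain ⟨-, -, -, hpos, hc, -⟩ := hball (hbox a 0 h1 (by simpa using hδ))
    simp only at hpos
    have hPt : Tendsto (fun s => P (a, s)) (𝓝[>] 0) (𝓝 a) := by
      have : ContinuousAt (fun s : ℝ => P (a, s)) 0 :=
        ContinuousAt.comp (f := fun s : ℝ => (a, s)) (g := P) hc (by fun_prop)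
      have := this.tendsto
      rw [h2] at this
      exact this.mono_left nhdsWithin_le_nhds
    have h3 := symm_quot ψ _ a (hψD a hpos) (fun s => P (a, s)) hPt
    have h4 := ((h3.const_mul (a ^ 2)).add (hPt.const_mul (2 * ψ a))).const_mul k
    convert h4 using 2
    simp only [hψ]
    field_simp
    ring
  obtain ⟨_, _, _, happos, _, _⟩ := hball (hbox ap 0 hap3 (by simpa using hδ))
  obtain ⟨_, _, _, hampos, _, _⟩ := hball (hbox am 0 ham3 (by simpa using hδ))
  simp only at happos hampos
  have hsp := (hlim ap hap3 hap2).eventually (lt_mem_nhds (show (0:ℝ) < _ by positivity))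
  have hsm := (hlim am ham3 ham2).eventually
    (gt_mem_nhds (show _ < (0:ℝ) from mul_neg_of_pos_of_neg (by positivity) ham1))
  obtain ⟨s, ⟨hs1, hs2⟩, hs0, hsδ⟩ := ((hsp.and hsm).and (Ioo_mem_nhdsGT hδ)).exists
  have hsabs : |s| < δ := by rwa [abs_of_pos hs0]
  have hin : ∀ a ∈ Set.Icc am ap, |a - a₁| < δ := by
    intro a ⟨h1, h2⟩
    rw [abs_lt] at *
    constructor <;> linarith
  have hcont : ContinuousOn (fun a => k * H s a) (Set.Icc am ap) := by
    intro a h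
    apply ContinuousAt.continuousWithinAt
    obtain ⟨-, hp1, hp2, hp3, hc, -⟩ := hball (hbox a s (hin a h) hsabs)
    simp only at hp1 hp2 hp3
    have hPc : ContinuousAt (fun a : ℝ => P (a, s)) a :=
        ContinuousAt.comp (f := fun a : ℝ => (a, s)) (g := P) hc (by fun_prop)
    have c1 : ContinuousAt (fun a => ψ (P (a, s) + s)) a :=
      ContinuousAt.comp (g := ψ) (hψA _ hp1).continuousAt (by fun_prop)
    have c2 : ContinuousAt (fun a => ψ (P (a, s) - s)) a :=
      ContinuousAt.comp (g := ψ) (hψA _ hp2).continuousAt (by fun_prop)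
    have c3 : ContinuousAt ψ a := (hψA _ hp3).continuousAt
    simp only [hH]
    fun_prop
  obtain ⟨a, haI, hza⟩ := intermediate_value_Icc (by linarith) hcont
    (show (0:ℝ) ∈ Set.Icc _ _ from ⟨hs2.le, hs1.le⟩)
  obtain ⟨hSa, hp1, hp2, hp3, -, hFa⟩ := hball (hbox a s (hin a haI) hsabs)
  simp only at hSa hp1 hp2 hp3 hFa hza
  have hHa : H s a = 0 := by
    rcases mul_eq_zero.1 hza with h | h
    · exact absurd h hk
    · exact h
  simp only [hH] at hHa
  simp only [hFdef] at hFa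
  set p := P (a, s)
  have hHb : a ^ 2 * (ψ (p + s) - ψ (p - s)) + 4 * s * ψ a * p = 0 := by
    field_simp at hHa
    linarith
  refine ⟨a, p + s, p - s, hSa, ⟨?_, ?_⟩, ?_⟩
  · simp only [hψ] at hFa hHb
    apply mul_left_cancel₀ hp3.ne'
    linear_combination (hFa + hHb) / 2
  · simp only [hψ] at hFa hHb
    apply mul_left_cancel₀ hp3.ne'
    linear_combination (hFa - hHb) / 2
  · intro h
    rw [Prod.mk.injEq] at h
    linarith [h.1, h.2]

lemma quad_asymp (f : ℝ → ℝ) (hf : ContDiffOn ℝ 1 f (Set.Ioi 0)) (a₁ k : ℝ) (ha : 0 < a₁)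
    (h0 : f a₁ = 0) (h1 : deriv f a₁ = 0) (h2 : HasDerivAt (deriv f) k a₁) (y : ℝ) :
    Tendsto (fun δ => f (a₁ + y * δ) / δ ^ 2) (𝓝[>] 0) (𝓝 (k / 2 * y ^ 2)) := by
  have hlo : (fun t => f t - k / 2 * (t - a₁) ^ 2) =o[𝓝 a₁] fun t => (t - a₁) ^ 2 := by
    rw [Asymptotics.isLittleO_iff]
    intro c hc
    have h3 := (hasDerivAt_iff_isLittleO.1 h2).def hc
    obtain ⟨r, hr, hb⟩ := Metric.eventually_nhds_iff_ball.1 (h3.and (lt_mem_nhds ha))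
    filter_upwards [Metric.ball_mem_nhds a₁ hr] with t ht
    have key := (convex_uIcc a₁ t).norm_image_sub_le_of_norm_hasDerivWithin_le
      (f := fun t => f t - k / 2 * (t - a₁) ^ 2) (f' := fun t => deriv f t - k * (t - a₁))
      (C := c * |t - a₁|) (x := a₁) (y := t) ?_ ?_ Set.left_mem_uIcc Set.right_mem_uIcc
    · simp only [h0, sub_self] at key
      simp only [norm_pow, Real.norm_eq_abs] at key ⊢
      calc _ = |f t - k / 2 * (t - a₁) ^ 2 - (0 - k / 2 * 0 ^ 2)| := by ring_nf
        _ ≤ _ := key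
        _ = _ := by ring
    · intro x hx
      have hxb : x ∈ Metric.ball a₁ r := by
        rw [Metric.mem_ball, Real.dist_eq] at *
        exact (Set.abs_sub_left_of_mem_uIcc hx).trans_lt ht
      have hd : HasDerivAt f (deriv f x) x :=
        ((hf.contDiffAt (Ioi_mem_nhds (hb x hxb).2)).differentiableAt (by norm_num)).hasDerivAt
      refine (HasDerivAt.congr_deriv (hd.sub
        ((((hasDerivAt_id x).sub_const a₁).pow 2).const_mul (k / 2))) ?_).hasDerivWithinAt
      simp
      ring
    · intro x hx
      have hle := Set.abs_sub_left_of_mem_uIcc hx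
      have hxb : x ∈ Metric.ball a₁ r := by
        rw [Metric.mem_ball, Real.dist_eq] at *
        exact hle.trans_lt ht
      have := (hb x hxb).1
      simp only [h1, sub_zero, smul_eq_mul, Real.norm_eq_abs] at this
      rw [Real.norm_eq_abs, mul_comm k]
      exact this.trans (by gcongr)
  have ht : Tendsto (fun δ : ℝ => a₁ + y * δ) (𝓝[>] 0) (𝓝 a₁) := by
    have : Tendsto (fun δ : ℝ => a₁ + y * δ) (𝓝 0) (𝓝 (a₁ + y * 0)) :=
      Continuous.tendsto (by fun_prop) 0
    simp only [mul_zero, add_zero] at this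
    exact this.mono_left nhdsWithin_le_nhds
  have h4 := (hlo.comp_tendsto ht).trans_isBigO (k := fun δ : ℝ => δ ^ 2) (by
    refine Asymptotics.IsBigO.of_bound (y ^ 2) (Eventually.of_forall fun δ => ?_)
    simp [mul_pow])
  have h5 := h4.tendsto_div_nhds_zero.add_const (k / 2 * y ^ 2)
  rw [zero_add] at h5
  refine h5.congr' ?_
  filter_upwards [self_mem_nhdsWithin] with s (hs : 0 < s)
  simp
  field_simp
  ring

lemma deg (f : ℝ → ℝ) (hf : ContDiffOn ℝ 1 f (Set.Ioi 0)) (a₁ k : ℝ) (ha : 0 < a₁)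
    (hm : HasDerivAt (fun a => deriv f a + 3 / a * f a) k a₁) (hk : k ≠ 0)
    (h0 : deriv f a₁ + 3 / a₁ * f a₁ = 0) (hz : f a₁ = 0)
    (S : Set (ℝ × ℝ × ℝ)) (hS : S ∈ 𝓝 (a₁, a₁, a₁)) :
    ∃ a c C, (a, c, C) ∈ S ∧ RedEq f a c C ∧ (c, C) ≠ (a, a) := by
  have hz' : deriv f a₁ = 0 := by simpa [hz] using h0
  have h2 : HasDerivAt (deriv f) k a₁ := by
    have hd : HasDerivAt f 0 a₁ := hz' ▸
      ((hf.contDiffAt (Ioi_mem_nhds ha)).differentiableAt (by norm_num)).hasDerivAt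
    have hi : HasDerivAt (fun a : ℝ => 3 / a) (3 * (-(a₁ ^ 2)⁻¹)) a₁ := by
      simpa [div_eq_mul_inv] using (hasDerivAt_inv ha.ne').const_mul 3
    have := hm.sub (hi.mul hd)
    refine (this.congr_deriv (by simp [hz])).congr_of_eventuallyEq (Eventually.of_forall fun x => ?_)
    simp
  have hq := quad_asymp f hf a₁ k ha hz hz' h2
  -- limit of the rescaled equation
  have hlim : ∀ y : ℝ, Tendsto (fun δ => k * (((a₁ + 1 * δ) * (a₁ + y * δ) * f (a₁ + y * δ) -
      f (a₁ + 1 * δ) * (4 * (a₁ + 1 * δ) ^ 2 - 3 * (a₁ + y * δ) ^ 2)) / δ ^ 2)) (𝓝[>] 0)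
      (𝓝 (k ^ 2 / 2 * a₁ ^ 2 * (y ^ 2 - 1))) := by
    intro y
    have hl : ∀ z : ℝ, Tendsto (fun δ : ℝ => a₁ + z * δ) (𝓝[>] 0) (𝓝 a₁) := by
      intro z
      have : Tendsto (fun δ : ℝ => a₁ + z * δ) (𝓝 0) (𝓝 (a₁ + z * 0)) :=
        Continuous.tendsto (by fun_prop) 0
      simp only [mul_zero, add_zero] at this
      exact this.mono_left nhdsWithin_le_nhds
    have := ((((hl 1).mul (hl y)).mul (hq y)).sub ((hq 1).mul
      ((((hl 1).pow 2).const_mul 4).sub (((hl y).pow 2).const_mul 3)))).const_mul k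
    have e : k * (a₁ * a₁ * (k / 2 * y ^ 2) - k / 2 * 1 ^ 2 * (4 * a₁ ^ 2 - 3 * a₁ ^ 2)) =
      k ^ 2 / 2 * a₁ ^ 2 * (y ^ 2 - 1) := by ring
    rw [e] at this
    refine this.congr fun δ => ?_
    ring
  have hp := (hlim (-2)).eventually (lt_mem_nhds (show (0:ℝ) < _ by norm_num; positivity))
  have hn := (hlim (-(1/2))).eventually (gt_mem_nhds (show _ < (0:ℝ) by
    apply mul_neg_of_pos_of_neg
    · positivity
    · norm_num))
  obtain ⟨r, hr, hb⟩ := Metric.mem_nhds_iff.1 hS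
  have hsm : Set.Ioo 0 (min (r / 2) (a₁ / 2)) ∈ 𝓝[>] (0 : ℝ) :=
    Ioo_mem_nhdsGT (by positivity)
  obtain ⟨δ, ⟨hδp, hδn⟩, hδ0, hδ⟩ := ((hp.and hn).and hsm).exists
  have hδr : δ < r / 2 := hδ.trans_le (min_le_left _ _)
  have hδa : δ < a₁ / 2 := hδ.trans_le (min_le_right _ _)
  set G : ℝ → ℝ := fun y => k * (((a₁ + 1 * δ) * (a₁ + y * δ) * f (a₁ + y * δ) -
      f (a₁ + 1 * δ) * (4 * (a₁ + 1 * δ) ^ 2 - 3 * (a₁ + y * δ) ^ 2)) / δ ^ 2) with hG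
  have hcont : ContinuousOn G (Set.Icc (-2) (-(1/2))) := by
    intro y hy
    apply ContinuousAt.continuousWithinAt
    have : 0 < a₁ + y * δ := by nlinarith [hy.1]
    have c1 : ContinuousAt (fun y => f (a₁ + y * δ)) y :=
      ContinuousAt.comp (g := f) (hf.contDiffAt (Ioi_mem_nhds this)).continuousAt (by fun_prop)
    simp only [hG]
    refine ContinuousAt.mul continuousAt_const (ContinuousAt.div_const ?_ _)
    have c2 : ContinuousAt (fun y : ℝ => (a₁ + 1 * δ) * (a₁ + y * δ)) y := by fun_prop
    have c3 : ContinuousAt (fun y : ℝ => 4 * (a₁ + 1 * δ) ^ 2 - 3 * (a₁ + y * δ) ^ 2) y := by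
      fun_prop
    exact (c2.mul c1).sub (continuousAt_const.mul c3)
  obtain ⟨y, hy, hyz⟩ := intermediate_value_Icc' (by norm_num) hcont
    (show (0:ℝ) ∈ Set.Icc _ _ from ⟨hδn.le, hδp.le⟩)
  simp only [hG] at hyz
  have hyz' : (a₁ + 1 * δ) * (a₁ + y * δ) * f (a₁ + y * δ) -
      f (a₁ + 1 * δ) * (4 * (a₁ + 1 * δ) ^ 2 - 3 * (a₁ + y * δ) ^ 2) = 0 := by
    rcases mul_eq_zero.1 hyz with h | h
    · exact absurd h hk
    · rcases div_eq_zero_iff.1 h with h | h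
      · exact h
      · exact absurd h (by positivity)
  have hyabs : |y * δ| < r := by
    rw [abs_lt]; constructor <;> nlinarith [hy.1, hy.2]
  have hδabs : |δ| < r := by rw [abs_of_pos hδ0]; linarith
  refine ⟨a₁ + 1 * δ, a₁ + y * δ, a₁ + y * δ, hb ?_, ⟨?_, ?_⟩, ?_⟩
  · rw [abs_mul] at hyabs
    simp [Prod.dist_eq, hyabs, hδabs]
  · linear_combination hyz'
  · linear_combination hyz'
  · intro h
    rw [Prod.mk.injEq] at h
    nlinarith [h.1, hy.2]

lemma tetG_poly (x : Fin 6 → ℝ) : tetG x = 2 * (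
    x 0 ^ 2 * x 3 ^ 2 * (x 1 ^ 2 + x 4 ^ 2 + x 2 ^ 2 + x 5 ^ 2 - x 0 ^ 2 - x 3 ^ 2) +
    x 1 ^ 2 * x 4 ^ 2 * (x 0 ^ 2 + x 3 ^ 2 + x 2 ^ 2 + x 5 ^ 2 - x 1 ^ 2 - x 4 ^ 2) +
    x 2 ^ 2 * x 5 ^ 2 * (x 1 ^ 2 + x 4 ^ 2 + x 0 ^ 2 + x 3 ^ 2 - x 2 ^ 2 - x 5 ^ 2) -
    (x 0 ^ 2 * x 1 ^ 2 * x 5 ^ 2 + x 0 ^ 2 * x 2 ^ 2 * x 4 ^ 2 + x 1 ^ 2 * x 2 ^ 2 * x 3 ^ 2 +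
      x 3 ^ 2 * x 4 ^ 2 * x 5 ^ 2)) := by
  simp [tetG, cayleyMenger, Matrix.det_succ_row_zero, Fin.sum_univ_succ, Fin.succAbove]
  ring

lemma foc_of_red (φ : ℝ → ℝ) (V lam a c C : ℝ)
    (ha : DifferentiableAt ℝ φ a) (hc : DifferentiableAt ℝ φ c) (hC : DifferentiableAt ℝ φ C)
    (hV : 2 * c ^ 2 * C ^ 2 * (4 * a ^ 2 - c ^ 2 - C ^ 2) = 288 * V ^ 2)
    (h1 : deriv φ a + lam * (4 * a * c ^ 2 * C ^ 2) = 0)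
    (h2 : deriv φ c + lam * (4 * c * C ^ 2 * (4 * a ^ 2 - 2 * c ^ 2 - C ^ 2)) = 0)
    (h3 : deriv φ C + lam * (4 * C * c ^ 2 * (4 * a ^ 2 - c ^ 2 - 2 * C ^ 2)) = 0) :
    tetFOC φ V lam ![a, a, c, a, a, C] := by
  constructor
  · rw [tetG_poly, ← hV]
    simp
    ring
  · set x : Fin 6 → ℝ := ![a, a, c, a, a, C] with hx
    have hpr : ∀ i : Fin 6, HasFDerivAt (fun y : Fin 6 → ℝ => y i)
      (ContinuousLinearMap.proj (R := ℝ) (φ := fun _ : Fin 6 => ℝ) i) x := fun i => hasFDerivAt_apply i x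
    have hE : HasFDerivAt (tetE φ) (∑ i, deriv φ (x i) •
        ContinuousLinearMap.proj (R := ℝ) (φ := fun _ : Fin 6 => ℝ) i) x := by
      have : tetE φ = fun y => ∑ i, φ (y i) := rfl
      rw [this]
      refine HasFDerivAt.fun_sum fun i _ => ?_
      have hd : DifferentiableAt ℝ φ (x i) := by
        fin_cases i <;> simpa [hx]
      exact hd.hasDerivAt.comp_hasFDerivAt x (hpr i)
    have hsq : ∀ i : Fin 6, HasFDerivAt (fun y : Fin 6 → ℝ => y i ^ 2)
      ((2 * x i) • ContinuousLinearMap.proj (R := ℝ) (φ := fun _ : Fin 6 => ℝ) i) x := by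
      intro i
      refine ((hpr i).pow 2).congr_fderiv ?_
      ext; simp
    have s0 := hsq 0
    have s1 := hsq 1
    have s2 := hsq 2
    have s3 := hsq 3
    have s4 := hsq 4
    have s5 := hsq 5
    have hG := (((((s0.mul s3).mul (((((s1.add s4).add s2).add s5).sub s0).sub s3)).add
      ((s1.mul s4).mul (((((s0.add s3).add s2).add s5).sub s1).sub s4))).add
      ((s2.mul s5).mul (((((s1.add s4).add s0).add s3).sub s2).sub s5))).sub
      (((((s0.mul s1).mul s5).add ((s0.mul s2).mul s4)).add ((s1.mul s2).mul s3)).add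
        ((s3.mul s4).mul s5))).const_mul 2
    have hGe := hG.congr_of_eventuallyEq (f₁ := tetG) (Eventually.of_forall fun y => tetG_poly y)
    rw [hE.fderiv, hGe.fderiv]
    ext v
    simp [Fin.sum_univ_six, hx]
    linear_combination (v 0 + v 1 + v 3 + v 4) * h1 + v 2 * h2 + v 5 * h3

/-- If `μ₁(V₁) = 0` and `μ₁'(V₁) ≠ 0`, where `μ₁(V) = φ''(a_V) + (3/a_V)φ'(a_V)`,
then arbitrarily close to the trivial solution at `V₁` there are solutions of the
first-order conditions of the form `(a, a, c, a, a, C)` with `(c, C) ≠ (a, a)`. -/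
theorem stmt_16 (φ : ℝ → ℝ) (hφ : ContDiffOn ℝ 2 φ (Set.Ioi 0))
    (aOf μ₁ : ℝ → ℝ)
    (haOf : ∀ V : ℝ, aOf V = (6 * Real.sqrt 2 * V) ^ ((1 : ℝ) / 3))
    (hμ₁ : ∀ V : ℝ, μ₁ V = deriv (deriv φ) (aOf V) + 3 / aOf V * deriv φ (aOf V))
    (V₁ : ℝ) (hV₁ : 0 < V₁) (hμ0 : μ₁ V₁ = 0) (hμ' : deriv μ₁ V₁ ≠ 0)
    (a₁ lam₁ : ℝ) (ha₁ : a₁ = aOf V₁) (hlam₁ : lam₁ = -(deriv φ a₁) / (4 * a₁ ^ 5)) :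
    ∀ ε : ℝ, 0 < ε →
      ∃ V lam a c C : ℝ, 0 < V ∧ 0 < a ∧ 0 < c ∧ 0 < C ∧
        tetFOC φ V lam ![a, a, c, a, a, C] ∧ (c, C) ≠ (a, a) ∧
        |V - V₁| + |lam - lam₁| + max |a - a₁| (max |c - a₁| |C - a₁|) < ε := by
  intro ε hε
  have h2 : (0:ℝ) < 6 * Real.sqrt 2 := by positivity
  have hapos : 0 < a₁ := by rw [ha₁, haOf]; positivity
  have hcube : a₁ ^ 3 = 6 * Real.sqrt 2 * V₁ := by
    rw [ha₁, haOf, ← Real.rpow_natCast, ← Real.rpow_mul (by positivity)]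
    norm_num
  have hinv : ∀ a : ℝ, 0 < a → aOf (a ^ 3 / (6 * Real.sqrt 2)) = a := by
    intro a ha
    rw [haOf, mul_div_cancel₀ _ h2.ne', ← Real.rpow_natCast, ← Real.rpow_mul ha.le]
    norm_num
  have hV1 : a₁ ^ 3 / (6 * Real.sqrt 2) = V₁ := by
    rw [hcube]; field_simp
  set f := deriv φ with hfdef
  have hf : ContDiffOn ℝ 1 f (Set.Ioi 0) :=
    ((contDiffOn_succ_iff_deriv_of_isOpen (n := 1) isOpen_Ioi).1 (by simpa [one_add_one_eq_two] using hφ)).2.2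
  have h0 : deriv f a₁ + 3 / a₁ * f a₁ = 0 := by rw [ha₁, ← hμ₁]; exact hμ0
  have hm : HasDerivAt (fun a => deriv f a + 3 / a * f a)
      (deriv μ₁ V₁ * (3 * a₁ ^ 2 / (6 * Real.sqrt 2))) a₁ := by
    have hd : HasDerivAt μ₁ (deriv μ₁ V₁) (a₁ ^ 3 / (6 * Real.sqrt 2)) := by
      rw [hV1]; exact (differentiableAt_of_deriv_ne_zero hμ').hasDerivAt
    have hi : HasDerivAt (fun a : ℝ => a ^ 3 / (6 * Real.sqrt 2)) (3 * a₁ ^ 2 / (6 * Real.sqrt 2)) a₁ := by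
      simpa using (hasDerivAt_pow 3 a₁).div_const (6 * Real.sqrt 2)
    refine (hd.comp a₁ hi).congr_of_eventuallyEq ?_
    filter_upwards [lt_mem_nhds hapos] with a ha
    simp only [Function.comp]
    rw [hμ₁, hinv a ha]
  have hk : deriv μ₁ V₁ * (3 * a₁ ^ 2 / (6 * Real.sqrt 2)) ≠ 0 :=
    mul_ne_zero hμ' (by positivity)
  set Vf : ℝ × ℝ × ℝ → ℝ := fun q =>
    Real.sqrt (2 * q.2.1 ^ 2 * q.2.2 ^ 2 * (4 * q.1 ^ 2 - q.2.1 ^ 2 - q.2.2 ^ 2) / 288) with hVf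
  set lf : ℝ × ℝ × ℝ → ℝ := fun q => - f q.1 / (4 * q.1 * q.2.1 ^ 2 * q.2.2 ^ 2) with hlf
  have hVf1 : Vf (a₁, a₁, a₁) = V₁ := by
    simp only [hVf]
    rw [show 2 * a₁ ^ 2 * a₁ ^ 2 * (4 * a₁ ^ 2 - a₁ ^ 2 - a₁ ^ 2) / 288 = (a₁ ^ 3) ^ 2 / 72 by ring,
      hcube, mul_pow, mul_pow, Real.sq_sqrt (by norm_num)]
    rw [show (6:ℝ) ^ 2 * 2 * V₁ ^ 2 / 72 = V₁ ^ 2 by ring, Real.sqrt_sq hV₁.le]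
  have hlf1 : lf (a₁, a₁, a₁) = lam₁ := by
    simp only [hlf]
    rw [hlam₁]; ring_nf
  have cV : ContinuousAt Vf (a₁, a₁, a₁) := by
    simp only [hVf]; fun_prop
  have cl : ContinuousAt lf (a₁, a₁, a₁) := by
    have : ContinuousAt (fun q : ℝ × ℝ × ℝ => f q.1) (a₁, a₁, a₁) :=
      ContinuousAt.comp (g := f) (hf.contDiffAt (Ioi_mem_nhds hapos)).continuousAt (by fun_prop)
    simp only [hlf]
    refine ContinuousAt.div this.neg (by fun_prop) ?_
    simp only
    positivity
  have ev1 : ∀ᶠ q in 𝓝 (a₁, a₁, a₁), |Vf q - V₁| + |lf q - lam₁| +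
      max |q.1 - a₁| (max |q.2.1 - a₁| |q.2.2 - a₁|) < ε := by
    have : ContinuousAt (fun q : ℝ × ℝ × ℝ => |Vf q - V₁| + |lf q - lam₁| +
      max |q.1 - a₁| (max |q.2.1 - a₁| |q.2.2 - a₁|)) (a₁, a₁, a₁) := by fun_prop
    apply this.eventually (gt_mem_nhds _)
    simpa [hVf1, hlf1] using hε
  have ev2 : ∀ᶠ q in 𝓝 (a₁, a₁, a₁), 0 < Vf q :=
    cV.eventually (lt_mem_nhds (by rw [hVf1]; exact hV₁))
  have ev3 : ∀ᶠ q : ℝ × ℝ × ℝ in 𝓝 (a₁, a₁, a₁), 0 < q.1 :=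
    (show ContinuousAt (fun q : ℝ × ℝ × ℝ => q.1) _ by fun_prop).eventually (lt_mem_nhds hapos)
  have ev4 : ∀ᶠ q : ℝ × ℝ × ℝ in 𝓝 (a₁, a₁, a₁), 0 < q.2.1 :=
    (show ContinuousAt (fun q : ℝ × ℝ × ℝ => q.2.1) _ by fun_prop).eventually (lt_mem_nhds hapos)
  have ev5 : ∀ᶠ q : ℝ × ℝ × ℝ in 𝓝 (a₁, a₁, a₁), 0 < q.2.2 :=
    (show ContinuousAt (fun q : ℝ × ℝ × ℝ => q.2.2) _ by fun_prop).eventually (lt_mem_nhds hapos)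
  have hS := ev1.and (ev2.and (ev3.and (ev4.and ev5)))
  obtain ⟨a, c, C, hmem, ⟨e1, e2⟩, hne⟩ : ∃ a c C, (a, c, C) ∈ {q | _} ∧ RedEq f a c C ∧
      (c, C) ≠ (a, a) := by
    by_cases hz : f a₁ = 0
    · exact deg f hf a₁ _ hapos hm hk h0 hz _ hS
    · exact nondeg f hf a₁ _ hapos hm hk h0 hz _ hS
  obtain ⟨m1, m2, m3, m4, m5⟩ := hmem
  simp only at m1 m3 m4 m5
  have hdφ : ∀ x, 0 < x → DifferentiableAt ℝ φ x := fun x hx =>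
    (hφ.contDiffAt (Ioi_mem_nhds hx)).differentiableAt (by norm_num)
  refine ⟨Vf (a, c, C), lf (a, c, C), a, c, C, m2, m3, m4, m5, ?_, hne, m1⟩
  apply foc_of_red φ _ _ a c C (hdφ a m3) (hdφ c m4) (hdφ C m5)
  · have : 0 < 2 * c ^ 2 * C ^ 2 * (4 * a ^ 2 - c ^ 2 - C ^ 2) / 288 := Real.sqrt_pos.1 m2
    simp only [hVf]
    rw [Real.sq_sqrt this.le]
    ring
  · simp only [hlf]
    field_simp
    ring
  · simp only [hlf]
    field_simp
    linear_combination e1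
  · simp only [hlf]
    field_simp
    linear_combination e2
end

section
/- Let φ:(0,∞)→ℝ be C², define μ₁(V) = φ''(a_V) + (3/a_V)φ'(a_V) with a_V = (6√2 V)^{1/3}, and suppose μ₁(V₁) = 0 and μ₁'(V₁) ≠ 0 for some V₁ > 0. Then for every ε > 0 there exist V > 0, λ ∈ ℝ, and a solution of the first-order conditions g(a) = 288V², ∇E(a) + λ∇g(a) = 0 of the form a = (a, a, a, A, A, A) with a ≠ A, satisfying |V − V₁| + |λ − λ_{V₁}| + max(|a − a_{V₁}|, |A − a_{V₁}|) < ε. -/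
lemma cm_poly (a b c A B C : ℝ) : cayleyMenger a b c A B C =
    2 * (a^2*A^2*(-a^2-A^2+b^2+B^2+c^2+C^2) + b^2*B^2*(a^2+A^2-b^2-B^2+c^2+C^2)
      + c^2*C^2*(a^2+A^2+b^2+B^2-c^2-C^2)
      - a^2*b^2*C^2 - a^2*c^2*B^2 - b^2*c^2*A^2 - A^2*B^2*C^2) := by
  unfold cayleyMenger
  simp [Matrix.det_succ_row_zero, Fin.sum_univ_succ, Fin.succAbove]
  ring

lemma tetG_diff (x : Fin 6 → ℝ) : DifferentiableAt ℝ tetG x := by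
  have : tetG = fun x : Fin 6 → ℝ => cayleyMenger (x 0) (x 1) (x 2) (x 3) (x 4) (x 5) := rfl
  rw [this]
  simp only [cm_poly]
  fun_prop

lemma quad_deriv (g0 p q a : ℝ) :
    HasDerivAt (fun t : ℝ => g0 + p * ((a + t)^2 - a^2) + q * ((a+t)^2 - a^2)^2) (p * (2 * a)) 0 := by
  have h1 : HasDerivAt (fun t : ℝ => (a + t)^2 - a^2) (2 * a) 0 := by
    have := (((hasDerivAt_id (0:ℝ)).const_add a).pow 2).sub_const (a^2)
    simpa using this
  have := ((h1.const_mul p).const_add g0).fun_add ((h1.fun_pow 2).const_mul q)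
  simpa using this

lemma tetG_a (a A : ℝ) (i : Fin 6) (hi : i < 3) :
    fderiv ℝ tetG ![a,a,a,A,A,A] (Pi.single i 1) = 4 * a * A^4 := by
  rw [← (tetG_diff _).lineDeriv_eq_fderiv, lineDeriv]
  have : (fun t : ℝ => tetG (![a,a,a,A,A,A] + t • Pi.single i 1)) =
      fun t : ℝ => (6*a^2*A^4-2*A^6) + (2*A^4) * ((a + t)^2 - a^2) + (-2*A^2) * ((a+t)^2 - a^2)^2 := by
    funext t
    unfold tetG
    rw [cm_poly]
    fin_cases i <;> first | (exfalso; revert hi; decide) | (simp [Pi.single_apply]; ring)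
  rw [this, (quad_deriv _ _ _ _).deriv]; ring

lemma tetG_A (a A : ℝ) (i : Fin 6) (hi : 3 ≤ i) :
    fderiv ℝ tetG ![a,a,a,A,A,A] (Pi.single i 1) = 4 * A^3 * (2*a^2-A^2) := by
  rw [← (tetG_diff _).lineDeriv_eq_fderiv, lineDeriv]
  have : (fun t : ℝ => tetG (![a,a,a,A,A,A] + t • Pi.single i 1)) =
      fun t : ℝ => (6*a^2*A^4-2*A^6) + (4*a^2*A^2-2*A^4) * ((A + t)^2 - A^2)
        + (-2*a^2) * ((A+t)^2 - A^2)^2 := by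
    funext t
    unfold tetG
    rw [cm_poly]
    fin_cases i <;> first | (exfalso; revert hi; decide) | (simp [Pi.single_apply]; ring)
  rw [this, (quad_deriv _ _ _ _).deriv]; ring

lemma tetE_fderiv (φ : ℝ → ℝ) (x : Fin 6 → ℝ) (h : ∀ i, DifferentiableAt ℝ φ (x i)) (i : Fin 6) :
    fderiv ℝ (tetE φ) x (Pi.single i 1) = deriv φ (x i) := by
  have : HasFDerivAt (tetE φ) (∑ j, (deriv φ (x j)) •
      (ContinuousLinearMap.proj j : (Fin 6 → ℝ) →L[ℝ] ℝ)) x := by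
    have : tetE φ = fun x => ∑ j, φ (x j) := rfl
    rw [this]
    refine HasFDerivAt.fun_sum fun j _ => ?_
    exact (h j).hasDerivAt.comp_hasFDerivAt x (hasFDerivAt_apply j x)
  rw [this.fderiv]
  simp [ContinuousLinearMap.sum_apply, Pi.single_apply]

lemma foc_of (φ : ℝ → ℝ) (a A : ℝ) (ha : 0 < a) (hA : 0 < A) (h3 : A^2 ≤ 3 * a^2)
    (hda : DifferentiableAt ℝ φ a) (hdA : DifferentiableAt ℝ φ A)
    (h : deriv φ A * (a * A) = deriv φ a * (2*a^2-A^2)) :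
    tetFOC φ (Real.sqrt ((6*a^2*A^4-2*A^6)/288)) (-deriv φ a / (4 * a * A^4)) ![a,a,a,A,A,A] := by
  constructor
  · rw [Real.sq_sqrt]
    · unfold tetG
      rw [cm_poly]
      simp
      ring
    · have : 0 ≤ 2 * A^4 * (3 * a^2 - A^2) := by
        have := sub_nonneg.2 h3
        positivity
      apply div_nonneg _ (by norm_num)
      linarith
  · apply ContinuousLinearMap.coe_injective
    apply (Pi.basisFun ℝ (Fin 6)).ext
    intro i
    have hd : ∀ i, DifferentiableAt ℝ φ ((![a,a,a,A,A,A] : Fin 6 → ℝ) i) := by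
      intro i; fin_cases i <;> simpa
    simp only [Pi.basisFun_apply, ContinuousLinearMap.coe_coe, ContinuousLinearMap.add_apply,
      ContinuousLinearMap.smul_apply, ContinuousLinearMap.zero_apply, tetE_fderiv φ _ hd, smul_eq_mul]
    rcases lt_or_ge i 3 with hi | hi
    · rw [tetG_a _ _ _ hi]
      have : (![a,a,a,A,A,A] : Fin 6 → ℝ) i = a := by
        fin_cases i <;> first | rfl | (exfalso; revert hi; decide)
      rw [this]; field_simp; ring
    · rw [tetG_A _ _ _ hi]
      have : (![a,a,a,A,A,A] : Fin 6 → ℝ) i = A := by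
        fin_cases i <;> first | rfl | (exfalso; revert hi; decide)
      rw [this]; field_simp; linarith

open Filter Topology in
/-- a nonzero derivative at a zero forces both signs nearby -/
lemma sign_near (m : ℝ → ℝ) (x : ℝ) (h0 : m x = 0) (h : deriv m x ≠ 0) (P : ℝ → Prop)
    (hP : ∀ᶠ y in 𝓝 x, P y) : ∃ y z, P y ∧ P z ∧ m y < 0 ∧ 0 < m z := by
  wlog hp : 0 < deriv m x generalizing m
  · have hn : deriv (fun y => - m y) x = - deriv m x := deriv.fun_neg
    obtain ⟨y, z, hy, hz, h1, h2⟩ := this (fun y => - m y) (by simp [h0])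
      (by rw [hn]; simpa using h)
      (by rw [hn]; have := lt_of_le_of_ne (not_lt.1 hp) h; linarith)
    exact ⟨z, y, hz, hy, by linarith, by linarith⟩
  have hd : HasDerivAt m (deriv m x) x := (differentiableAt_of_deriv_ne_zero h).hasDerivAt
  rw [hasDerivAt_iff_tendsto_slope] at hd
  have hs := hd.eventually (lt_mem_nhds hp)
  have hP' : ∀ᶠ y in 𝓝[≠] x, P y := hP.filter_mono nhdsWithin_le_nhds
  have hb := hs.and hP'
  have hl : ∀ᶠ y in 𝓝[<] x, 0 < slope m x y ∧ P y :=
    hb.filter_mono (nhdsWithin_mono _ fun y hy => ne_of_lt hy)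
  have hr : ∀ᶠ y in 𝓝[>] x, 0 < slope m x y ∧ P y :=
    hb.filter_mono (nhdsWithin_mono _ fun y hy => ne_of_gt hy)
  obtain ⟨y, ⟨hy1, hy2⟩, hy3⟩ := (hl.and self_mem_nhdsWithin).exists
  obtain ⟨z, ⟨hz1, hz2⟩, hz3⟩ := (hr.and self_mem_nhdsWithin).exists
  refine ⟨y, z, hy2, hz2, ?_, ?_⟩
  · rw [slope_def_field, h0, sub_zero] at hy1
    have : y - x < 0 := sub_neg.2 hy3
    by_contra hc
    exact absurd hy1 (not_lt.2 (div_nonpos_of_nonneg_of_nonpos (not_lt.1 hc) this.le))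
  · rw [slope_def_field, h0, sub_zero] at hz1
    have : 0 < z - x := sub_pos.2 hz3
    exact (div_pos_iff_of_pos_right this).1 hz1

open Filter Topology in
lemma slope_lim (f : ℝ → ℝ) (x : ℝ) (hf : DifferentiableAt ℝ f x) :
    Tendsto (fun d => (f (x+d) * (x * (x+d)) - f x * (2*x^2-(x+d)^2)) / d) (𝓝[>] 0)
      (𝓝 (deriv f x * x^2 + 3 * x * f x)) := by
  have h1 : HasDerivAt (fun d => f (x+d)) (deriv f x) 0 := by
    have : HasDerivAt f (deriv f x) (x+0) := by simpa using hf.hasDerivAt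
    exact this.comp_const_add x 0
  have h2 : HasDerivAt (fun d : ℝ => x * (x+d)) x 0 := by
    simpa using ((hasDerivAt_id (0:ℝ)).const_add x).const_mul x
  have h3 : HasDerivAt (fun d : ℝ => f x * (2*x^2-(x+d)^2)) (f x * (-(2*x))) 0 := by
    simpa using ((((hasDerivAt_id (0:ℝ)).const_add x).pow 2).const_sub (2*x^2)).const_mul (f x)
  have h := (h1.mul h2).sub h3
  rw [hasDerivAt_iff_tendsto_slope] at h
  have h' := h.mono_left (nhdsWithin_mono (0:ℝ) (fun y (hy : y ∈ Set.Ioi (0:ℝ)) => ne_of_gt hy))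
  have e : deriv f x * (x * (x + 0)) + f (x + 0) * x - f x * -(2 * x)
      = deriv f x * x^2 + 3 * x * f x := by rw [add_zero]; ring
  rw [e] at h'
  refine h'.congr fun d => ?_
  rw [slope_def_field]
  simp
  ring

open Filter Topology in
theorem stmt_17 (φ : ℝ → ℝ) (hφ : ContDiffOn ℝ 2 φ (Set.Ioi 0))
    (aOf μ₁ : ℝ → ℝ)
    (haOf : ∀ V : ℝ, aOf V = (6 * Real.sqrt 2 * V) ^ ((1 : ℝ) / 3))
    (hμ₁ : ∀ V : ℝ, μ₁ V = deriv (deriv φ) (aOf V) + 3 / aOf V * deriv φ (aOf V))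
    (V₁ : ℝ) (hV₁ : 0 < V₁) (hμ0 : μ₁ V₁ = 0) (hμ' : deriv μ₁ V₁ ≠ 0)
    (a₁ lam₁ : ℝ) (ha₁ : a₁ = aOf V₁) (hlam₁ : lam₁ = -(deriv φ a₁) / (4 * a₁ ^ 5)) :
    ∀ ε : ℝ, 0 < ε →
      ∃ V lam a A : ℝ, 0 < V ∧ 0 < a ∧ 0 < A ∧
        tetFOC φ V lam ![a, a, a, A, A, A] ∧ a ≠ A ∧
        |V - V₁| + |lam - lam₁| + max |a - a₁| |A - a₁| < ε := by
  intro ε hε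
  have hpos : 0 < a₁ := by rw [ha₁, haOf]; positivity
  have hcube : a₁^3 = 6 * Real.sqrt 2 * V₁ := by
    rw [ha₁, haOf, ← Real.rpow_natCast, ← Real.rpow_mul (by positivity)]
    norm_num
  have hV : Real.sqrt ((6*a₁^2*a₁^4-2*a₁^6)/288) = V₁ := by
    have : (6*a₁^2*a₁^4-2*a₁^6)/288 = V₁^2 := by
      have : a₁^6 = 72 * V₁^2 := by
        calc a₁^6 = (a₁^3)^2 := by ring
          _ = 36 * (Real.sqrt 2)^2 * V₁^2 := by rw [hcube]; ring
          _ = _ := by rw [Real.sq_sqrt (by norm_num)]; ring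
      linear_combination this / 72
    rw [this, Real.sqrt_sq hV₁.le]
  have hd1 : ∀ x, 0 < x → DifferentiableAt ℝ φ x := fun x hx =>
    (hφ.contDiffAt (Ioi_mem_nhds hx)).differentiableAt (by norm_num)
  have hd2 : ∀ x, 0 < x → DifferentiableAt ℝ (deriv φ) x := by
    intro x hx
    have h2 : ContDiffOn ℝ 1 (deriv φ) (Set.Ioi 0) :=
      ((contDiffOn_succ_iff_deriv_of_isOpen (n := 1) isOpen_Ioi).1 hφ).2.2
    exact (h2.contDiffAt (Ioi_mem_nhds hx)).differentiableAt (by norm_num)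
  -- closeness
  set F : ℝ × ℝ → ℝ := fun p =>
    |Real.sqrt ((6*p.1^2*p.2^4-2*p.2^6)/288) - V₁| + |-deriv φ p.1 / (4 * p.1 * p.2^4) - lam₁|
      + max |p.1 - a₁| |p.2 - a₁| with hF
  have hFc : ContinuousAt F (a₁, a₁) := by
    have hc : ContinuousAt (fun p : ℝ × ℝ => deriv φ p.1) (a₁, a₁) :=
      ContinuousAt.comp (f := Prod.fst) (x := (a₁, a₁)) (hd2 a₁ hpos).continuousAt continuousAt_fst
    have hc2 : ContinuousAt (fun p : ℝ × ℝ => -deriv φ p.1 / (4 * p.1 * p.2^4)) (a₁, a₁) := by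
      apply hc.neg.div (by fun_prop)
      simp [hpos.ne']
    apply ContinuousAt.add
    · exact ContinuousAt.add (by fun_prop) (hc2.sub continuousAt_const).abs
    · fun_prop
  have hF0 : F (a₁, a₁) = 0 := by
    have : -deriv φ a₁ / (4 * a₁ * a₁^4) = lam₁ := by rw [hlam₁]; congr 1; ring
    simp only [hF, hV, this]; simp
  have e1 : ∀ᶠ p in 𝓝 (a₁, a₁), F p < ε :=
    hFc.eventually (gt_mem_nhds (by rw [hF0]; exact hε))
  have e2 : ∀ᶠ p : ℝ × ℝ in 𝓝 (a₁, a₁), 0 < p.1 :=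
    continuousAt_fst.eventually (lt_mem_nhds hpos)
  have e3 : ∀ᶠ p : ℝ × ℝ in 𝓝 (a₁, a₁), 0 < p.2 :=
    continuousAt_snd.eventually (lt_mem_nhds hpos)
  have e4 : ∀ᶠ p : ℝ × ℝ in 𝓝 (a₁, a₁), 0 < 3 * p.1^2 - p.2^2 := by
    have : ContinuousAt (fun p : ℝ × ℝ => 3 * p.1^2 - p.2^2) (a₁, a₁) := by fun_prop
    apply this.eventually (lt_mem_nhds _)
    have := pow_pos hpos 2
    show 0 < 3 * a₁^2 - a₁^2
    linarith
  obtain ⟨η, hη, hball⟩ := Metric.eventually_nhds_iff.1 (e1.and (e2.and (e3.and e4)))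
  have hball' : ∀ a A, |a - a₁| < η → |A - a₁| < η →
      F (a, A) < ε ∧ 0 < a ∧ 0 < A ∧ 0 < 3 * a^2 - A^2 := by
    intro a A h1 h2
    have := @hball (a, A) (by rw [Prod.dist_eq]; exact max_lt h1 h2)
    exact this
  -- two sign points
  have hac : ContinuousAt aOf V₁ := by
    have : aOf = fun V => (6 * Real.sqrt 2 * V) ^ ((1 : ℝ) / 3) := funext haOf
    rw [this]
    exact ContinuousAt.rpow_const (by fun_prop) (Or.inr (by norm_num))
  have hnear : ∀ᶠ V in 𝓝 V₁, |aOf V - a₁| < η := by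
    have := hac.eventually (Metric.ball_mem_nhds (aOf V₁) hη)
    filter_upwards [this] with V hV
    rw [ha₁]; exact hV
  obtain ⟨y, z, hy, hz, hy0, hz0⟩ := sign_near μ₁ V₁ hμ0 hμ' _ hnear
  obtain ⟨p, hp⟩ : ∃ p, p = aOf y := ⟨_, rfl⟩
  obtain ⟨q, hq⟩ : ∃ q, q = aOf z := ⟨_, rfl⟩
  rw [hμ₁, ← hp] at hy0
  rw [hμ₁, ← hq] at hz0
  rw [← hp] at hy
  rw [← hq] at hz
  have hp0 : 0 < p := (hball' p p hy hy).2.1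
  have hq0 : 0 < q := (hball' q q hz hz).2.1
  have hy1 : deriv (deriv φ) p * p^2 + 3 * p * deriv φ p < 0 := by
    have := mul_neg_of_neg_of_pos hy0 (pow_pos hp0 2)
    have e : (deriv (deriv φ) p + 3 / p * deriv φ p) * p^2
      = deriv (deriv φ) p * p^2 + 3 * p * deriv φ p := by field_simp
    rwa [e] at this
  have hz1 : 0 < deriv (deriv φ) q * q^2 + 3 * q * deriv φ q := by
    have := mul_pos hz0 (pow_pos hq0 2)
    have e : (deriv (deriv φ) q + 3 / q * deriv φ q) * q^2
      = deriv (deriv φ) q * q^2 + 3 * q * deriv φ q := by field_simp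
    rwa [e] at this
  have l1 := (slope_lim (deriv φ) p (hd2 p hp0)).eventually (gt_mem_nhds hy1)
  have l2 := (slope_lim (deriv φ) q (hd2 q hq0)).eventually (lt_mem_nhds hz1)
  have c1 : ∀ x, |x - a₁| < η → ∀ᶠ d in 𝓝[>] (0:ℝ), |x + d - a₁| < η := by
    intro x hx
    have : ContinuousAt (fun d : ℝ => |x + d - a₁|) 0 := by fun_prop
    exact (this.eventually (gt_mem_nhds (by simpa using hx))).filter_mono nhdsWithin_le_nhds
  obtain ⟨d, ⟨⟨⟨hd1', hd2'⟩, hdp⟩, hdq⟩, hd0⟩ :=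
    ((((l1.and l2).and (c1 p hy)).and (c1 q hz)).and self_mem_nhdsWithin).exists
  have hd0 : 0 < d := hd0
  set K : ℝ → ℝ := fun x => deriv φ (x+d) * (x * (x+d)) - deriv φ x * (2*x^2-(x+d)^2) with hK
  have hKp : K p < 0 := by
    by_contra hc
    exact absurd hd1' (not_lt.2 (div_nonneg (not_lt.1 hc) hd0.le))
  have hKq : 0 < K q := (div_pos_iff_of_pos_right hd0).1 hd2'
  have hin : ∀ x ∈ Set.uIcc p q, |x - a₁| < η ∧ |x + d - a₁| < η := by
    intro x hx
    rw [abs_lt] at *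
    rcases Set.mem_uIcc.1 hx with h | h <;> rw [abs_lt] at * <;>
      refine ⟨⟨?_, ?_⟩, ?_, ?_⟩ <;> linarith [h.1, h.2, hy.1, hy.2, hz.1, hz.2, hdp.1, hdp.2, hdq.1, hdq.2]
  have hKc : ContinuousOn K (Set.uIcc p q) := by
    intro x hx
    obtain ⟨h1, h2⟩ := hin x hx
    obtain ⟨-, hx0, hxd, -⟩ := hball' _ _ h1 h2
    have k1 := (hd2 x hx0).continuousAt
    have k2 : ContinuousAt (fun x => deriv φ (x + d)) x :=
      ContinuousAt.comp (f := fun x => x + d) (hd2 _ hxd).continuousAt (by fun_prop)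
    apply ContinuousAt.continuousWithinAt
    exact (k2.mul (by fun_prop)).sub (k1.mul (by fun_prop))
  obtain ⟨a, haI, hKa⟩ := intermediate_value_uIcc hKc
    (Set.mem_uIcc.2 (Or.inl ⟨hKp.le, hKq.le⟩) : (0:ℝ) ∈ _)
  obtain ⟨h1, h2⟩ := hin a haI
  obtain ⟨hFa, ha0, hA0, h3⟩ := hball' _ _ h1 h2
  refine ⟨_, _, a, a + d, ?_, ha0, hA0, foc_of φ a (a+d) ha0 hA0 (by linarith)
    (hd1 _ ha0) (hd1 _ hA0) (sub_eq_zero.1 hKa), by linarith, hFa⟩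
  apply Real.sqrt_pos.2
  have : 0 < 2 * (a+d)^4 * (3 * a^2 - (a+d)^2) := by positivity
  apply div_pos _ (by norm_num)
  linarith
end
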